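/- Let k ≥ 2 and a,b ≥ 0 with d := (a+(k−1)b)/k > 1, and let τ ∈ (0,1) be the unique solution of τ e^{−τ} = d e^{−d}. If (a·ln a + (k−1)·b·ln b)/k − d·ln d > min( (1−τ)/(1 − τk/(a+(k−1)b)) · 2 ln k , 2 ln k − 2 ln(2)·e^{−a/k}(1 − (1 − e^{−b/k})^{k−1}) ), then weak recovery is solvable in SSBM(n,k,a/n,b/n): there exist ε > 0 and estimators X̂_n with P(A(X, X̂_n(G)) ≥ 1/k + ε) → 1 as n → ∞. -/

import Mathlib

open Filter
open scoped Classical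

abbrev VPair (n : ℕ) := {e : Fin n × Fin n // e.1 < e.2}

noncomputable def sbmMass {n k : ℕ} (p : Fin k → ℝ) (W : Matrix (Fin k) (Fin k) ℝ)
    (x : Fin n → Fin k) (g : VPair n → Bool) : ℝ :=
  (∏ u, p (x u)) *
    ∏ e : VPair n,
      if g e then W (x e.1.1) (x e.1.2) else 1 - W (x e.1.1) (x e.1.2)

noncomputable def sbmProb {n k : ℕ} (p : Fin k → ℝ) (W : Matrix (Fin k) (Fin k) ℝ)
    (E : (Fin n → Fin k) → (VPair n → Bool) → Prop) : ℝ :=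
  ∑ x : Fin n → Fin k, ∑ g : VPair n → Bool,
    if E x g then sbmMass p W x g else 0

noncomputable def agreement {n k : ℕ} (x y : Fin n → Fin k) : ℝ :=
  (Finset.univ : Finset (Equiv.Perm (Fin k))).sup' ⟨1, Finset.mem_univ 1⟩
    fun π => ((Finset.univ.filter fun i : Fin n => x i = π (y i)).card : ℝ) / n


def ssbmW (k : ℕ) (A B : ℝ) : Matrix (Fin k) (Fin k) ℝ :=
  Matrix.of fun i j => if i = j then A else B

namespace WeakRecovery

section Product

variable {ι α : Type*} [Fintype ι] [DecidableEq ι] [Fintype α]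

/-- The weight of `ω` under the product of the weights `m i`. -/
noncomputable def pw (m : ι → α → ℝ) (ω : ι → α) : ℝ := ∏ i, m i (ω i)

/-- The sum of `f` against the product weight. -/
noncomputable def pE (m : ι → α → ℝ) (f : (ι → α) → ℝ) : ℝ := ∑ ω, pw m ω * f ω

/-- Each `m i` is a probability weight. -/
def IsP (m : ι → α → ℝ) : Prop := (∀ i a, 0 ≤ m i a) ∧ ∀ i, ∑ a, m i a = 1

variable {m : ι → α → ℝ}

lemma pw_nonneg {ι α : Type*} [Fintype ι] {m : ι → α → ℝ} (hm : ∀ i a, 0 ≤ m i a)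
    (ω : ι → α) : 0 ≤ pw m ω :=
  Finset.prod_nonneg fun i _ => hm i _

lemma pE_prod (m : ι → α → ℝ) (f : ι → α → ℝ) :
    pE m (fun ω => ∏ i, f i (ω i)) = ∏ i, ∑ a, m i a * f i a := by
  unfold pE pw
  rw [Finset.prod_univ_sum]
  simp [Finset.prod_mul_distrib]

lemma pE_one (hm : IsP m) : pE m (fun _ => 1) = 1 := by
  have := pE_prod m (fun _ _ => 1)
  simpa [hm.2] using this

lemma pE_const (hm : IsP m) (c : ℝ) : pE m (fun _ => c) = c := by
  have := pE_one hm
  unfold pE at *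
  rw [← Finset.sum_mul] at *
  simp only [mul_one] at this
  rw [this, one_mul]

lemma pE_mono (hm : ∀ i a, 0 ≤ m i a) {f h : (ι → α) → ℝ} (hfh : ∀ ω, f ω ≤ h ω) :
    pE m f ≤ pE m h :=
  Finset.sum_le_sum fun ω _ => mul_le_mul_of_nonneg_left (hfh ω) (pw_nonneg hm ω)

lemma pE_nonneg (hm : ∀ i a, 0 ≤ m i a) {f : (ι → α) → ℝ} (hf : ∀ ω, 0 ≤ f ω) :
    0 ≤ pE m f :=
  Finset.sum_nonneg fun ω _ => mul_nonneg (pw_nonneg hm ω) (hf ω)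

lemma pE_add (f h : (ι → α) → ℝ) : pE m (fun ω => f ω + h ω) = pE m f + pE m h := by
  simp [pE, mul_add, Finset.sum_add_distrib]

lemma pE_sub (f h : (ι → α) → ℝ) : pE m (fun ω => f ω - h ω) = pE m f - pE m h := by
  simp [pE, mul_sub, Finset.sum_sub_distrib]

lemma pE_mul_left (c : ℝ) (f : (ι → α) → ℝ) : pE m (fun ω => c * f ω) = c * pE m f := by
  simp only [pE, Finset.mul_sum]
  exact Finset.sum_congr rfl fun _ _ => by ring

lemma pE_sum {κ : Type*} (s : Finset κ) (f : κ → (ι → α) → ℝ) :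
    pE m (fun ω => ∑ j ∈ s, f j ω) = ∑ j ∈ s, pE m (f j) := by
  simp only [pE, Finset.mul_sum]
  exact Finset.sum_comm

/-- Average over the coordinate `i`. -/
noncomputable def avg (m : ι → α → ℝ) (i : ι) (f : (ι → α) → ℝ) (ω : ι → α) : ℝ :=
  ∑ a, m i a * f (Function.update ω i a)

lemma pw_update_mul {ι α : Type*} [Fintype ι] [DecidableEq ι] (m : ι → α → ℝ)
    (ω : ι → α) (i : ι) (a : α) :
    pw m (Function.update ω i a) * m i (ω i) = pw m ω * m i a := by
  unfold pw
  rw [← Finset.mul_prod_erase _ _ (Finset.mem_univ i),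
    ← Finset.mul_prod_erase (Finset.univ) (fun j => m j (ω j)) (Finset.mem_univ i)]
  have : ∀ j ∈ Finset.univ.erase i, m j (Function.update ω i a j) = m j (ω j) := by
    intro j hj
    rw [Function.update_of_ne (Finset.ne_of_mem_erase hj)]
  rw [Finset.prod_congr rfl this, Function.update_self]
  ring

lemma pE_avg (hm : ∀ i, ∑ a, m i a = 1) (i : ι) (f : (ι → α) → ℝ) :
    pE m (avg m i f) = pE m f := by
  have h1 : pE m (avg m i f) =
      ∑ q : (ι → α) × α, pw m q.1 * m i q.2 * f (Function.update q.1 i q.2) := by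
    rw [Fintype.sum_prod_type]
    simp only [pE, avg, Finset.mul_sum, mul_assoc]
  have h2 : pE m f = ∑ q : (ι → α) × α, pw m q.1 * m i q.2 * f q.1 := by
    rw [Fintype.sum_prod_type]
    simp only [pE]
    refine Finset.sum_congr rfl fun ω _ => ?_
    rw [← Finset.sum_mul, ← Finset.mul_sum, hm, mul_one]
  rw [h1, h2]
  refine Finset.sum_bij' (fun q _ => (Function.update q.1 i q.2, q.1 i))
    (fun q _ => (Function.update q.1 i q.2, q.1 i)) ?_ ?_ ?_ ?_ ?_
  · simp
  · simp
  · intro q _; simp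
  · intro q _; simp
  · intro q _
    simp only
    rw [pw_update_mul]

lemma pE_sq_le_avg (hm : IsP m) (i : ι) (f : (ι → α) → ℝ) (c v : ℝ) (a₀ : α)
    (hc : ∀ ω a a', |f (Function.update ω i a) - f (Function.update ω i a')| ≤ c)
    (hv : (1 - m i a₀) * c ^ 2 ≤ v) :
    pE m (fun ω => f ω ^ 2) ≤ pE m (fun ω => avg m i f ω ^ 2) + v := by
  classical
  have hpt : ∀ ω, avg m i (fun ω => f ω ^ 2) ω ≤ avg m i f ω ^ 2 + v := by
    intro ω
    set φ : α → ℝ := fun a => f (Function.update ω i a) with hφ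
    have h1 : ∑ a, m i a * (φ a - φ a₀) ^ 2 ≤ v := by
      refine le_trans ?_ hv
      rw [← Finset.add_sum_erase _ _ (Finset.mem_univ a₀)]
      have h3 : 1 - m i a₀ = ∑ a ∈ Finset.univ.erase a₀, m i a := by
        rw [← hm.2 i, ← Finset.add_sum_erase _ _ (Finset.mem_univ a₀)]; ring
      rw [h3, Finset.sum_mul, sub_self]
      simp only [ne_eq, OfNat.ofNat_ne_zero, not_false_eq_true, zero_pow, mul_zero, zero_add]
      refine Finset.sum_le_sum fun a _ => mul_le_mul_of_nonneg_left ?_ (hm.1 i a)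
      have := hc ω a a₀
      rw [← sq_abs]
      exact pow_le_pow_left₀ (abs_nonneg _) this 2
    have h4 : ∑ a, m i a * (φ a - φ a₀) ^ 2 =
        (∑ a, m i a * φ a ^ 2) - 2 * φ a₀ * (∑ a, m i a * φ a) + φ a₀ ^ 2 := by
      have : φ a₀ ^ 2 = ∑ a, m i a * φ a₀ ^ 2 := by rw [← Finset.sum_mul, hm.2, one_mul]
      rw [this, Finset.mul_sum, ← Finset.sum_sub_distrib, ← Finset.sum_add_distrib]
      exact Finset.sum_congr rfl fun a _ => by ring
    change ∑ a, m i a * φ a ^ 2 ≤ (∑ a, m i a * φ a) ^ 2 + v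
    nlinarith [sq_nonneg (∑ a, m i a * φ a - φ a₀)]
  have := pE_mono hm.1 hpt
  rw [pE_avg hm.2, pE_add, pE_const hm] at this
  exact this

lemma avg_lipschitz {ι α : Type*} [DecidableEq ι] [Fintype α] {m : ι → α → ℝ}
    (hm : IsP m) (i j : ι) (f : (ι → α) → ℝ) (c : ℝ)
    (hc : ∀ ω a a', |f (Function.update ω j a) - f (Function.update ω j a')| ≤ c)
    (hc0 : 0 ≤ c) (ω : ι → α) (a a' : α) :
    |avg m i f (Function.update ω j a) - avg m i f (Function.update ω j a')| ≤ c := by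
  by_cases hij : j = i
  · subst hij; simp [avg, hc0]
  · unfold avg
    rw [← Finset.sum_sub_distrib]
    refine (Finset.abs_sum_le_sum_abs _ _).trans ?_
    have : ∀ b ∈ Finset.univ, |m i b * f (Function.update (Function.update ω j a) i b) -
        m i b * f (Function.update (Function.update ω j a') i b)| ≤ m i b * c := by
      intro b _
      rw [← mul_sub, abs_mul, abs_of_nonneg (hm.1 i b), Function.update_comm hij,
        Function.update_comm hij]
      exact mul_le_mul_of_nonneg_left (hc _ _ _) (hm.1 i b)
    refine (Finset.sum_le_sum this).trans ?_
    rw [← Finset.sum_mul, hm.2, one_mul]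

lemma eq_of_update_invariant {ι α β : Type*} [DecidableEq ι] {f : (ι → α) → β} (S : Finset ι)
    (hf : ∀ i ∈ S, ∀ ω a, f (Function.update ω i a) = f ω) (ω ω' : ι → α)
    (h : ∀ i ∉ S, ω i = ω' i) : f ω = f ω' := by
  induction S using Finset.induction_on generalizing ω with
  | empty => congr 1; ext i; exact h i (by simp)
  | insert i S hi ih =>
    rw [← hf i (by simp) ω (ω' i)]
    refine ih (fun j hj => hf j (by simp [hj])) _ ?_
    intro j hj
    by_cases hji : j = i
    · subst hji; simp
    · rw [Function.update_of_ne hji]; exact h j (by simp [hji, hj])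

/-- Efron–Stein inequality for a function with bounded differences. -/
theorem efron_stein (hm : IsP m) (f : (ι → α) → ℝ) (c v : ι → ℝ) (a₀ : ι → α)
    (hc0 : ∀ i, 0 ≤ c i)
    (hc : ∀ i ω a a', |f (Function.update ω i a) - f (Function.update ω i a')| ≤ c i)
    (hv : ∀ i, (1 - m i (a₀ i)) * c i ^ 2 ≤ v i) :
    pE m (fun ω => (f ω - pE m f) ^ 2) ≤ ∑ i, v i := by
  have key : ∀ S : Finset ι, ∃ h : (ι → α) → ℝ, pE m h = pE m f ∧
      (∀ i ω a a', |h (Function.update ω i a) - h (Function.update ω i a')| ≤ c i) ∧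
      (∀ i ∈ S, ∀ ω a, h (Function.update ω i a) = h ω) ∧
      pE m (fun ω => f ω ^ 2) ≤ pE m (fun ω => h ω ^ 2) + ∑ i ∈ S, v i := by
    intro S
    induction S using Finset.induction_on with
    | empty => exact ⟨f, rfl, hc, by simp, by simp⟩
    | insert i S hi ih =>
      obtain ⟨h, h1, h2, h3, h4⟩ := ih
      refine ⟨avg m i h, by rw [pE_avg hm.2, h1], fun j => avg_lipschitz hm i j h _ (h2 j) (hc0 j),
        ?_, ?_⟩
      · intro j hj ω a
        by_cases hji : j = i
        · subst hji; simp [avg]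
        · have hjS : j ∈ S := by
            rcases Finset.mem_insert.1 hj with h | h
            · exact absurd h hji
            · exact h
          unfold avg
          refine Finset.sum_congr rfl fun b _ => ?_
          rw [Function.update_comm hji, h3 j hjS]
      · rw [Finset.sum_insert hi]
        have := pE_sq_le_avg hm i h (c i) (v i) (a₀ i) (h2 i) (hv i)
        linarith
  obtain ⟨h, h1, -, h3, h4⟩ := key Finset.univ
  have hconst : ∀ ω, h ω = h a₀ := fun ω =>
    eq_of_update_invariant Finset.univ h3 _ _ (by simp)
  have h5 : pE m f = h a₀ := by
    rw [← h1, show h = fun _ => h a₀ from funext hconst]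
    exact pE_const hm _
  have h6 : pE m (fun ω => h ω ^ 2) = h a₀ ^ 2 := by
    simp only [hconst]; exact pE_const hm _
  have h7 : pE m (fun ω => (f ω - pE m f) ^ 2) = pE m (fun ω => f ω ^ 2) - (pE m f) ^ 2 := by
    have e : (fun ω => (f ω - pE m f) ^ 2) =
        fun ω => (f ω ^ 2 - 2 * pE m f * f ω) + (pE m f) ^ 2 := by ext ω; ring
    rw [e, pE_add, pE_sub, pE_mul_left, pE_const hm]
    ring
  rw [h7, h5]
  linarith

lemma pE_chebyshev (hm : IsP m) (f : (ι → α) → ℝ) (μ V t : ℝ) (ht : 0 < t)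
    (hV : pE m (fun ω => (f ω - μ) ^ 2) ≤ V) :
    pE m (fun ω => if t ≤ |f ω - μ| then 1 else 0) ≤ V / t ^ 2 := by
  rw [le_div_iff₀ (by positivity), mul_comm, ← pE_mul_left]
  refine le_trans (pE_mono hm.1 fun ω => ?_) hV
  split_ifs with h
  · rw [mul_one, ← sq_abs (f ω - μ)]
    exact pow_le_pow_left₀ ht.le h 2
  · rw [mul_zero]; positivity

/-- Functions of disjoint sets of coordinates are independent. -/
theorem pE_mul_of_disjoint (hm : IsP m) (S : Finset ι) (f h : (ι → α) → ℝ)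
    (hf : ∀ ω ω', (∀ i ∈ S, ω i = ω' i) → f ω = f ω')
    (hh : ∀ ω ω', (∀ i ∉ S, ω i = ω' i) → h ω = h ω') :
    pE m (fun ω => f ω * h ω) = pE m f * pE m h := by
  have h1 : pE m (fun ω => f ω * h ω) =
      ∑ q : (ι → α) × (ι → α), pw m q.1 * pw m q.2 * (f q.1 * h q.1) := by
    rw [Fintype.sum_prod_type]
    have := pE_one hm
    simp only [pE, mul_one] at this
    simp only [pE]
    refine Finset.sum_congr rfl fun ω _ => ?_
    rw [← Finset.sum_mul, ← Finset.mul_sum, this, mul_one]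
  have h2 : pE m f * pE m h =
      ∑ q : (ι → α) × (ι → α), pw m q.1 * pw m q.2 * (f q.1 * h q.2) := by
    rw [Fintype.sum_prod_type, pE, pE, Finset.sum_mul_sum]
    exact Finset.sum_congr rfl fun _ _ => Finset.sum_congr rfl fun _ _ => by ring
  rw [h1, h2]
  refine Finset.sum_bij' (fun q _ => (S.piecewise q.1 q.2, S.piecewise q.2 q.1))
    (fun q _ => (S.piecewise q.1 q.2, S.piecewise q.2 q.1)) (by simp) (by simp) ?_ ?_ ?_
  · intro q _; ext i <;> by_cases hi : i ∈ S <;> simp [hi]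
  · intro q _; ext i <;> by_cases hi : i ∈ S <;> simp [hi]
  · intro q _
    simp only
    have e1 : pw m (S.piecewise q.1 q.2) * pw m (S.piecewise q.2 q.1) = pw m q.1 * pw m q.2 := by
      unfold pw
      rw [← Finset.prod_mul_distrib, ← Finset.prod_mul_distrib]
      refine Finset.prod_congr rfl fun i _ => ?_
      by_cases hi : i ∈ S <;> simp [hi, mul_comm]
    rw [e1, hf (S.piecewise q.1 q.2) q.1 fun i hi => by simp [hi],
      hh (S.piecewise q.2 q.1) q.1 fun i hi => by simp [hi]]

end Product

section Bernoulli

variable {ι : Type*} [Fintype ι] [DecidableEq ι]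

/-- The family of Bernoulli weights with success probabilities `p`. -/
def bm (p : ι → ℝ) (i : ι) (b : Bool) : ℝ := if b = true then p i else 1 - p i

lemma isP_bm {ι : Type*} {p : ι → ℝ} (h0 : ∀ i, 0 ≤ p i) (h1 : ∀ i, p i ≤ 1) : IsP (bm p) := by
  refine ⟨fun i a => ?_, fun i => by simp [bm]⟩
  unfold bm
  split_ifs
  · exact h0 i
  · linarith [h1 i]

/-- Changing one success probability changes the expectation of a Lipschitz function by little. -/
lemma abs_pE_bm_update_le {p : ι → ℝ} (h0 : ∀ i, 0 ≤ p i) (h1 : ∀ i, p i ≤ 1) (i : ι) (q : ℝ)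
    (hq0 : 0 ≤ q) (hq1 : q ≤ 1) (f : (ι → Bool) → ℝ) (C : ℝ)
    (hC : ∀ ω, |f (Function.update ω i true) - f (Function.update ω i false)| ≤ C) :
    |pE (bm p) f - pE (bm (Function.update p i q)) f| ≤ |p i - q| * C := by
  have h0' : ∀ j, 0 ≤ Function.update p i q j := fun j => by
    by_cases h : j = i
    · subst h; simpa
    · simpa [h] using h0 j
  have h1' : ∀ j, Function.update p i q j ≤ 1 := fun j => by
    by_cases h : j = i
    · subst h; simpa
    · simpa [h] using h1 j
  have hP := isP_bm h0 h1
  have hP' := isP_bm h0' h1'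
  set f1 : (ι → Bool) → ℝ := fun ω => f (Function.update ω i true)
  set f0 : (ι → Bool) → ℝ := fun ω => f (Function.update ω i false)
  have e1 : ∀ (r : ι → ℝ) (hr : IsP (bm r)), pE (bm r) f =
      r i * pE (bm r) f1 + (1 - r i) * pE (bm r) f0 := by
    intro r hr
    rw [← pE_avg hr.2 i f, ← pE_mul_left, ← pE_mul_left, ← pE_add]
    congr 1
    ext ω
    simp [avg, bm, f1, f0]
  have e2 : ∀ h : (ι → Bool) → ℝ, (∀ ω a, h (Function.update ω i a) = h ω) →
      pE (bm (Function.update p i q)) h = pE (bm p) h := by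
    intro h hh
    rw [← pE_avg hP'.2 i h]
    unfold pE pw
    have hav : ∀ ω, avg (bm (Function.update p i q)) i h ω = h ω := by
      intro ω
      unfold avg
      simp only [hh]
      rw [← Finset.sum_mul, hP'.2, one_mul]
    simp only [hav]
    have h3 : pE (bm p) h = pE (bm p) h * pE (bm (Function.update p i q)) (fun _ => 1) := by
      rw [pE_one hP', mul_one]
    have h4 : pE (bm (Function.update p i q)) h =
      pE (bm (Function.update p i q)) h * pE (bm p) (fun _ => 1) := by
      rw [pE_one hP, mul_one]
    change pE (bm (Function.update p i q)) h = pE (bm p) h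
    rw [h3, h4]
    unfold pE
    rw [Finset.sum_mul_sum, Finset.sum_mul_sum, ← Fintype.sum_prod_type',
      ← Fintype.sum_prod_type']
    refine Finset.sum_bij'
      (fun r _ => (Function.update r.1 i (r.2 i), Function.update r.2 i (r.1 i)))
      (fun r _ => (Function.update r.1 i (r.2 i), Function.update r.2 i (r.1 i)))
      (by simp) (by simp) (by simp) (by simp) ?_
    intro r _
    simp only [hh, mul_one]
    have : pw (bm (Function.update p i q)) r.1 * pw (bm p) r.2 =
        pw (bm p) (Function.update r.1 i (r.2 i)) *
          pw (bm (Function.update p i q)) (Function.update r.2 i (r.1 i)) := by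
      unfold pw
      rw [← Finset.prod_mul_distrib, ← Finset.prod_mul_distrib]
      refine Finset.prod_congr rfl fun j _ => ?_
      by_cases hj : j = i
      · subst hj; simp [mul_comm]
      · simp [bm, hj]
    linear_combination h r.1 * this
  rw [e1 p hP, e1 _ hP', e2 f1 (by simp [f1]), e2 f0 (by simp [f0]), Function.update_self]
  have e3 : p i * pE (bm p) f1 + (1 - p i) * pE (bm p) f0 -
      (q * pE (bm p) f1 + (1 - q) * pE (bm p) f0) = (p i - q) * (pE (bm p) f1 - pE (bm p) f0) := by
    ring
  rw [e3, abs_mul, ← pE_sub]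
  refine mul_le_mul_of_nonneg_left ?_ (abs_nonneg _)
  rw [abs_le]
  constructor
  · rw [← pE_const hP (-C)]
    exact pE_mono hP.1 fun ω => (abs_le.1 (hC ω)).1
  · rw [← pE_const hP C]
    exact pE_mono hP.1 fun ω => (abs_le.1 (hC ω)).2

/-- The expectation of a Lipschitz function is a Lipschitz function of the success probabilities. -/
theorem abs_pE_bm_sub_le {p q : ι → ℝ} (h0 : ∀ i, 0 ≤ p i) (h1 : ∀ i, p i ≤ 1)
    (hq0 : ∀ i, 0 ≤ q i) (hq1 : ∀ i, q i ≤ 1) (f : (ι → Bool) → ℝ) (C : ℝ)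
    (hC : ∀ i ω, |f (Function.update ω i true) - f (Function.update ω i false)| ≤ C) :
    |pE (bm p) f - pE (bm q) f| ≤ ∑ i, |p i - q i| * C := by
  have key : ∀ S : Finset ι,
      |pE (bm p) f - pE (bm (S.piecewise q p)) f| ≤ ∑ i ∈ S, |p i - q i| * C := by
    intro S
    induction S using Finset.induction_on with
    | empty => simp
    | insert i S hi ih =>
      rw [Finset.sum_insert hi, Finset.piecewise_insert]
      have hS0 : ∀ j, 0 ≤ S.piecewise q p j := fun j => by
        by_cases hj : j ∈ S <;> simp [hj, h0, hq0]
      have hS1 : ∀ j, S.piecewise q p j ≤ 1 := fun j => by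
        by_cases hj : j ∈ S <;> simp [hj, h1, hq1]
      have := abs_pE_bm_update_le hS0 hS1 i (q i) (hq0 i) (hq1 i) f C (hC i)
      rw [Finset.piecewise_eq_of_notMem _ _ _ hi] at this
      have h3 := abs_sub_le (pE (bm p) f) (pE (bm (S.piecewise q p)) f)
        (pE (bm (Function.update (S.piecewise q p) i (q i))) f)
      linarith
  simpa using key Finset.univ

end Bernoulli

section Overlap

variable {n k : ℕ}

/-- The number of indices with labels `i` under `x` and `j` under `z`. -/
noncomputable def ov (x z : Fin n → Fin k) (i j : Fin k) : ℝ :=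
  ∑ u, if x u = i ∧ z u = j then 1 else 0

lemma sum_ov_perm (x z : Fin n → Fin k) (π : Equiv.Perm (Fin k)) :
    ∑ j, ov x z (π j) j = ((Finset.univ.filter fun u : Fin n => x u = π (z u)).card : ℝ) := by
  unfold ov
  rw [Finset.sum_comm, Finset.card_filter]
  push_cast
  refine Finset.sum_congr rfl fun u _ => ?_
  rw [Finset.sum_eq_single (z u)]
  · simp
  · intro j _ hj
    simp [Ne.symm hj]
  · simp

lemma sum_ov_perm_le (hn : 0 < n) {x z : Fin n → Fin k} {t : ℝ} (h : agreement x z < t)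
    (π : Equiv.Perm (Fin k)) : ∑ j, ov x z (π j) j ≤ t * n := by
  rw [sum_ov_perm, ← div_le_iff₀ (by exact_mod_cast hn)]
  refine le_trans ?_ h.le
  exact Finset.le_sup' (fun π : Equiv.Perm (Fin k) =>
    ((Finset.univ.filter fun i : Fin n => x i = π (z i)).card : ℝ) / n) (Finset.mem_univ π)

lemma sum_perm_indicator (hk : 0 < k) (i j : Fin k) :
    (∑ π : Equiv.Perm (Fin k), if i = π j then (1 : ℝ) else 0) = (k.factorial : ℝ) / k := by
  have h1 : ∀ i', (∑ π : Equiv.Perm (Fin k), if i' = π j then (1 : ℝ) else 0) =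
      ∑ π : Equiv.Perm (Fin k), if i = π j then (1 : ℝ) else 0 := by
    intro i'
    rw [← Equiv.sum_comp (Equiv.mulLeft (Equiv.swap i i'))]
    refine Finset.sum_congr rfl fun π _ => ?_
    simp only [Equiv.coe_mulLeft, Equiv.Perm.coe_mul, Function.comp_apply]
    congr 1
    rw [eq_iff_iff, eq_comm, Equiv.swap_apply_eq_iff, Equiv.swap_apply_right, eq_comm]
  have h2 : ∑ i' : Fin k, (∑ π : Equiv.Perm (Fin k), if i' = π j then (1 : ℝ) else 0) =
      k.factorial := by
    rw [Finset.sum_comm]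
    simp [Fintype.card_perm]
  simp only [h1, Finset.sum_const, Finset.card_univ, Fintype.card_fin, nsmul_eq_mul] at h2
  rw [eq_div_iff (by positivity), mul_comm]
  exact h2

lemma sum_perm_sum_ov (hk : 0 < k) (x z : Fin n → Fin k) :
    ∑ π : Equiv.Perm (Fin k), ∑ j, ov x z (π j) j = k.factorial * ((n : ℝ) / k) := by
  simp only [sum_ov_perm, Finset.card_filter]
  push_cast
  rw [Finset.sum_comm]
  simp only [sum_perm_indicator hk]
  simp
  ring

lemma abs_cross_difference_le (hk : 0 < k) (hn : 0 < n) {x z : Fin n → Fin k} {ε : ℝ} (hε : 0 ≤ ε)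
    (h : agreement x z < 1 / k + ε) (i i' j j' : Fin k) :
    |ov x z i j + ov x z i' j' - ov x z i j' - ov x z i' j| ≤ (k.factorial + 1) * ε * n := by
  set s : Equiv.Perm (Fin k) → ℝ := fun π => ∑ j, ov x z (π j) j - n / k with hs
  have hle : ∀ π, s π ≤ ε * n := by
    intro π
    have := sum_ov_perm_le hn h π
    simp only [hs]
    have e : (1 / (k : ℝ) + ε) * n = n / k + ε * n := by ring
    linarith
  have hsum : ∑ π, s π = 0 := by
    simp only [hs]
    rw [Finset.sum_sub_distrib, sum_perm_sum_ov hk]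
    simp [Fintype.card_perm]
  have hge : ∀ π, -((k.factorial : ℝ) * (ε * n)) ≤ s π := by
    intro π
    rw [← Finset.add_sum_erase _ _ (Finset.mem_univ π)] at hsum
    have h1 : ∑ σ ∈ Finset.univ.erase π, s σ ≤ ∑ σ ∈ Finset.univ.erase π, ε * n :=
      Finset.sum_le_sum fun σ _ => hle σ
    have h2 : ∑ σ ∈ Finset.univ.erase π, ε * n ≤ ∑ σ : Equiv.Perm (Fin k), ε * n :=
      Finset.sum_le_sum_of_subset_of_nonneg (Finset.erase_subset _ _)
        fun _ _ _ => by positivity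
    simp only [Finset.sum_const, Finset.card_univ, Fintype.card_perm, Fintype.card_fin,
      nsmul_eq_mul] at h2
    simp only [Finset.sum_const, nsmul_eq_mul] at h1
    linarith
  have hpos : 0 ≤ (k.factorial + 1) * ε * n := by positivity
  by_cases hi : i = i'
  · subst hi
    rw [show ov x z i j + ov x z i j' - ov x z i j' - ov x z i j = 0 by ring, abs_zero]
    exact hpos
  by_cases hj : j = j'
  · subst hj
    rw [show ov x z i j + ov x z i' j - ov x z i j - ov x z i' j = 0 by ring, abs_zero]
    exact hpos
  obtain ⟨π, h1, h2⟩ : ∃ π : Equiv.Perm (Fin k), π j = i ∧ π j' = i' := by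
    refine ⟨Equiv.swap (Equiv.swap j i j') i' * Equiv.swap j i, ?_, ?_⟩
    · simp only [Equiv.Perm.coe_mul, Function.comp_apply, Equiv.swap_apply_left]
      refine Equiv.swap_apply_of_ne_of_ne ?_ hi
      intro h
      rw [eq_comm, Equiv.swap_apply_eq_iff, Equiv.swap_apply_right] at h
      exact hj h.symm
    · simp
  have e : s π - s (Equiv.swap i i' * π) =
      ov x z i j + ov x z i' j' - ov x z i j' - ov x z i' j := by
    simp only [hs]
    rw [sub_sub_sub_cancel_right, ← Finset.sum_sub_distrib,
      ← Finset.sum_subset (Finset.subset_univ {j, j'}), Finset.sum_pair hj]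
    · simp [h1, h2]
      ring
    · intro l _ hl
      simp only [Finset.mem_insert, Finset.mem_singleton, not_or] at hl
      have e1 : π l ≠ i := fun h => hl.1 (π.injective (h.trans h1.symm))
      have e2 : π l ≠ i' := fun h => hl.2 (π.injective (h.trans h2.symm))
      simp [Equiv.swap_apply_of_ne_of_ne e1 e2]
  rw [← e, abs_le]
  constructor
  · linarith [hge π, hle (Equiv.swap i i' * π)]
  · linarith [hge (Equiv.swap i i' * π), hle π]

/-- The centred indicator of the event that two labels agree. -/
noncomputable def ci (k : ℕ) (i j : Fin k) : ℝ := (if i = j then 1 else 0) - 1 / (k : ℝ)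

lemma ci_eq (hk : 0 < k) (s t : Fin k) :
    ci k s t = 1 / (2 * k) * ∑ i : Fin k, ∑ i' : Fin k,
      ((if s = i then (1 : ℝ) else 0) - if s = i' then 1 else 0) *
        ((if t = i then (1 : ℝ) else 0) - if t = i' then 1 else 0) := by
  have hk' : (k : ℝ) ≠ 0 := by positivity
  have : ∀ i i' : Fin k, ((if s = i then (1 : ℝ) else 0) - if s = i' then 1 else 0) *
        ((if t = i then (1 : ℝ) else 0) - if t = i' then 1 else 0) =
      ((if s = i then (1 : ℝ) else 0) * (if t = i then (1 : ℝ) else 0) +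
      (if s = i' then (1 : ℝ) else 0) * (if t = i' then (1 : ℝ) else 0)) -
      ((if s = i then (1 : ℝ) else 0) * (if t = i' then (1 : ℝ) else 0) +
      (if s = i' then (1 : ℝ) else 0) * (if t = i then (1 : ℝ) else 0)) := by
    intro i i'; ring
  simp only [this, Finset.sum_sub_distrib, Finset.sum_add_distrib, ← Finset.mul_sum,
    ← Finset.sum_mul]
  simp only [mul_ite, mul_one, mul_zero, Finset.sum_ite_eq, Finset.mem_univ, if_true,
    Finset.sum_const, Finset.card_univ, Fintype.card_fin, nsmul_eq_mul, ci]
  by_cases h : s = t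
  · subst h; simp; field_simp; ring
  · simp [h]; field_simp; norm_num

lemma sum_ci_mul_ci (hk : 0 < k) (x z : Fin n → Fin k) :
    ∑ u, ∑ v, ci k (x u) (x v) * ci k (z u) (z v) =
      1 / (4 * (k : ℝ) ^ 2) * ∑ i, ∑ i', ∑ j, ∑ j',
        (ov x z i j + ov x z i' j' - ov x z i j' - ov x z i' j) ^ 2 := by
  set r : Fin k → Fin k → Fin k → ℝ := fun i i' s =>
    (if s = i then (1 : ℝ) else 0) - if s = i' then 1 else 0 with hr
  have h1 : ∀ i i' j j', ov x z i j + ov x z i' j' - ov x z i j' - ov x z i' j =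
      ∑ u, r i i' (x u) * r j j' (z u) := by
    intro i i' j j'
    unfold ov
    rw [← Finset.sum_add_distrib, ← Finset.sum_sub_distrib, ← Finset.sum_sub_distrib]
    refine Finset.sum_congr rfl fun u _ => ?_
    simp only [hr, ite_and]
    split_ifs <;> simp
  have h2 : ∀ s t, ci k s t = 1 / (2 * k) * ∑ i, ∑ i', r i i' s * r i i' t := ci_eq hk
  simp only [h1, pow_two (∑ u, _), Finset.sum_mul_sum]
  simp only [h2]
  have h3 : ∀ u v, (1 / (2 * (k : ℝ)) * ∑ i, ∑ i', r i i' (x u) * r i i' (x v)) *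
      (1 / (2 * (k : ℝ)) * ∑ j, ∑ j', r j j' (z u) * r j j' (z v)) =
      1 / (4 * (k : ℝ) ^ 2) * ∑ i, ∑ i', ∑ j, ∑ j',
        r i i' (x u) * r j j' (z u) * (r i i' (x v) * r j j' (z v)) := by
    intro u v
    rw [mul_mul_mul_comm]
    congr 1
    · ring
    · rw [Finset.sum_mul]
      refine Finset.sum_congr rfl fun i _ => ?_
      rw [Finset.sum_mul]
      refine Finset.sum_congr rfl fun i' _ => ?_
      rw [Finset.mul_sum]
      refine Finset.sum_congr rfl fun j _ => ?_
      rw [Finset.mul_sum]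
      exact Finset.sum_congr rfl fun j' _ => by ring
  simp only [h3, ← Finset.mul_sum]
  congr 1
  have sw : ∀ F : Fin n → Fin n → Fin k → Fin k → Fin k → Fin k → ℝ,
      ∑ u, ∑ v, ∑ i, ∑ i', ∑ j, ∑ j', F u v i i' j j' =
      ∑ i, ∑ i', ∑ j, ∑ j', ∑ u, ∑ v, F u v i i' j j' := by
    intro F
    calc _ = ∑ q : Fin n × Fin n, ∑ p : Fin k × Fin k × Fin k × Fin k,
          F q.1 q.2 p.1 p.2.1 p.2.2.1 p.2.2.2 := by simp only [Fintype.sum_prod_type]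
      _ = _ := by rw [Finset.sum_comm]; simp only [Fintype.sum_prod_type]
  refine (sw fun u v i i' j j' =>
    r i i' (x u) * r j j' (z u) * (r i i' (x v) * r j j' (z v))).trans ?_
  simp only [← Finset.mul_sum]

lemma sum_ci_mul_ci_le (hk : 0 < k) (hn : 0 < n) {x z : Fin n → Fin k} {ε : ℝ} (hε : 0 ≤ ε)
    (h : agreement x z < 1 / k + ε) :
    ∑ u, ∑ v, ci k (x u) (x v) * ci k (z u) (z v) ≤
      (k : ℝ) ^ 2 * (k.factorial + 1) ^ 2 / 4 * ε ^ 2 * n ^ 2 := by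
  have hk' : (k : ℝ) ≠ 0 := by positivity
  rw [sum_ci_mul_ci hk]
  have h1 : ∀ i i' j j', (ov x z i j + ov x z i' j' - ov x z i j' - ov x z i' j) ^ 2 ≤
      ((k.factorial + 1) * ε * n) ^ 2 := fun i i' j j' => by
    rw [← sq_abs]
    exact pow_le_pow_left₀ (abs_nonneg _) (abs_cross_difference_le hk hn hε h i i' j j') 2
  have h2 : ∑ i, ∑ i', ∑ j, ∑ j',
      (ov x z i j + ov x z i' j' - ov x z i j' - ov x z i' j) ^ 2 ≤
      ∑ _i : Fin k, ∑ _i' : Fin k, ∑ _j : Fin k, ∑ _j' : Fin k,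
        ((k.factorial + 1) * ε * n) ^ 2 :=
    Finset.sum_le_sum fun i _ => Finset.sum_le_sum fun i' _ => Finset.sum_le_sum fun j _ =>
      Finset.sum_le_sum fun j' _ => h1 i i' j j'
  simp only [Finset.sum_const, Finset.card_univ, Fintype.card_fin, nsmul_eq_mul] at h2
  refine (mul_le_mul_of_nonneg_left h2 (by positivity)).trans (le_of_eq ?_)
  field_simp

/-- A sum over ordered pairs splits into the diagonal and twice the sum over `VPair`. -/
lemma sum_sum_eq_two_mul_sum_vpair (f : Fin n → Fin n → ℝ) (hf : ∀ u v, f u v = f v u) :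
    ∑ u, ∑ v, f u v = 2 * ∑ e : VPair n, f e.1.1 e.1.2 + ∑ u, f u u := by
  have h1 : ∑ e : VPair n, f e.1.1 e.1.2 = ∑ u, ∑ v, if u < v then f u v else 0 := by
    rw [← Fintype.sum_prod_type' (f := fun u v => if u < v then f u v else 0),
      ← Finset.sum_filter]
    exact (Finset.sum_subtype _ (by simp) fun q : Fin n × Fin n => f q.1 q.2).symm
  have h2 : ∑ u, ∑ v, (if u < v then f u v else 0) = ∑ u, ∑ v, if v < u then f u v else 0 := by
    rw [Finset.sum_comm]
    exact Finset.sum_congr rfl fun u _ => Finset.sum_congr rfl fun v _ => by rw [hf]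
  have h3 : ∑ u, f u u = ∑ u, ∑ v, if u = v then f u v else 0 := by simp
  rw [two_mul, h1]
  nth_rewrite 2 [h2]
  rw [h3, ← Finset.sum_add_distrib, ← Finset.sum_add_distrib]
  refine Finset.sum_congr rfl fun u _ => ?_
  rw [← Finset.sum_add_distrib, ← Finset.sum_add_distrib]
  refine Finset.sum_congr rfl fun v _ => ?_
  rcases lt_trichotomy u v with h | h | h
  · simp [h, h.not_gt, h.ne]
  · simp [h]
  · simp [h, h.not_gt, h.ne']

end Overlap

section Model

variable {n k : ℕ}

/-- The affinity of a pair of labels. -/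
noncomputable def wt {k : ℕ} (a b : ℝ) (i j : Fin k) : ℝ := if i = j then a else b

/-- The edge probabilities given the labels. -/
noncomputable def ep (n : ℕ) {k : ℕ} (a b : ℝ) (x : Fin n → Fin k) (e : VPair n) : ℝ :=
  wt a b (x e.1.1) (x e.1.2) / n

lemma sbmMass_eq (a b : ℝ) (x : Fin n → Fin k) (g : VPair n → Bool) :
    sbmMass (fun _ : Fin k => 1 / (k : ℝ)) (ssbmW k (a / n) (b / n)) x g =
      (1 / (k : ℝ)) ^ n * pw (bm (ep n a b x)) g := by
  unfold sbmMass pw bm ep wt ssbmW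
  congr 1
  · simp
  · refine Finset.prod_congr rfl fun e _ => ?_
    simp only [Matrix.of_apply]
    split_ifs <;> rfl

/-- The (smoothed) likelihood ratio factor of a single pair. -/
noncomputable def lf (n : ℕ) (d β w : ℝ) (t : Bool) : ℝ :=
  if t = true then (w + β) / d else (1 - w / n) / (1 - d / n)

/-- The (smoothed) likelihood ratio of the labelling `z`. -/
noncomputable def lr (a b d β : ℝ) (z : Fin n → Fin k) (g : VPair n → Bool) : ℝ :=
  ∏ e : VPair n, lf n d β (wt a b (z e.1.1) (z e.1.2)) (g e)

lemma wt_nonneg {a b : ℝ} (ha : 0 ≤ a) (hb : 0 ≤ b) (i j : Fin k) : 0 ≤ wt a b i j := by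
  unfold wt; split_ifs <;> assumption

lemma wt_le (a b : ℝ) (i j : Fin k) : wt a b i j ≤ max a b := by
  unfold wt; split_ifs <;> simp

lemma wt_sub_eq (hk : 0 < k) {a b d : ℝ} (hd : d = (a + ((k : ℝ) - 1) * b) / k) (i j : Fin k) :
    wt a b i j - d = (a - b) * ci k i j := by
  have hk' : (k : ℝ) ≠ 0 := by positivity
  unfold wt ci
  rw [hd]
  split_ifs <;> field_simp <;> ring

lemma card_vpair_le (n : ℕ) : (Fintype.card (VPair n) : ℝ) ≤ n ^ 2 / 2 := by
  have := sum_sum_eq_two_mul_sum_vpair (n := n) (fun _ _ => (1 : ℝ)) (fun _ _ => rfl)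
  simp at this
  have h : (0 : ℝ) ≤ n := by positivity
  nlinarith

/-- The second moment of likelihood ratios of nearly uncorrelated labellings. -/
theorem pE_lr_le (hk : 0 < k) {a b d β ε : ℝ} (ha : 0 ≤ a) (hb : 0 ≤ b)
    (hd : d = (a + ((k : ℝ) - 1) * b) / k) (hd1 : 1 < d) (hβ : 0 ≤ β) (hε : 0 ≤ ε)
    (hn : 2 * d ≤ n) (hcn : max a b ≤ n) {x z : Fin n → Fin k} (h : agreement x z < 1 / k + ε) :
    pE (bm (ep n a b x)) (lr a b d β z) ≤
      Real.exp (n * ((a - b) ^ 2 * (k ^ 2 * (k.factorial + 1) ^ 2) * ε ^ 2 + max a b * β)) := by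
  have hn0 : (0 : ℝ) < n := by linarith
  have hn0' : 0 < n := by exact_mod_cast hn0
  have hq : 1 / 2 ≤ 1 - d / n := by
    have : d / n ≤ 1 / 2 := by rw [div_le_iff₀ hn0]; linarith
    linarith
  have hq0 : 0 < 1 - d / n := by linarith
  have hnd : (n : ℝ) - d ≠ 0 := by linarith
  unfold lr
  rw [pE_prod (bm (ep n a b x)) fun e t => lf n d β (wt a b (z e.1.1) (z e.1.2)) t]
  have hfac : ∀ e : VPair n,
      ∑ t, bm (ep n a b x) e t * lf n d β (wt a b (z e.1.1) (z e.1.2)) t ≤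
      Real.exp ((a - b) ^ 2 / (n * d * (1 - d / n)) *
        (ci k (x e.1.1) (x e.1.2) * ci k (z e.1.1) (z e.1.2)) + max a b * β / n) := by
    intro e
    refine le_trans ?_ (Real.add_one_le_exp _)
    have e1 := wt_sub_eq hk hd (x e.1.1) (x e.1.2)
    have e2 := wt_sub_eq hk hd (z e.1.1) (z e.1.2)
    have e3 : (a - b) ^ 2 / (n * d * (1 - d / n)) *
        (ci k (x e.1.1) (x e.1.2) * ci k (z e.1.1) (z e.1.2)) =
        (wt a b (x e.1.1) (x e.1.2) - d) * (wt a b (z e.1.1) (z e.1.2) - d) /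
          (n * d * (1 - d / n)) := by
      rw [e1, e2]; ring
    rw [e3, Fintype.sum_bool]
    simp only [bm, lf, ep, if_true, Bool.false_eq_true, if_false]
    set w := wt a b (x e.1.1) (x e.1.2)
    set w' := wt a b (z e.1.1) (z e.1.2)
    have e4 : w / n * ((w' + β) / d) + (1 - w / n) * ((1 - w' / n) / (1 - d / n)) =
        (w - d) * (w' - d) / (n * d * (1 - d / n)) + 1 + w * β / n / d := by
      have : d ≠ 0 := by linarith
      field_simp
      ring
    rw [e4]
    have e5 : w * β / n / d ≤ max a b * β / n := by
      have hw : w ≤ max a b := wt_le _ _ _ _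
      have hw0 : 0 ≤ w := wt_nonneg ha hb _ _
      have hc0 : 0 ≤ max a b := le_max_of_le_left ha
      rw [div_le_iff₀ (by linarith)]
      have : w * β / n ≤ max a b * β / n := by gcongr
      have h0 : 0 ≤ max a b * β / n := by positivity
      nlinarith
    linarith
  have hw1 : ∀ y : Fin n → Fin k, ∀ e : VPair n, wt a b (y e.1.1) (y e.1.2) / n ≤ 1 := fun y e =>
    (div_le_one hn0).2 ((wt_le _ _ _ _).trans hcn)
  have hfac0 : ∀ e : VPair n,
      0 ≤ ∑ t, bm (ep n a b x) e t * lf n d β (wt a b (z e.1.1) (z e.1.2)) t := by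
    intro e
    refine Finset.sum_nonneg fun t _ => mul_nonneg ?_ ?_
    · exact (isP_bm (fun e => div_nonneg (wt_nonneg ha hb _ _) hn0.le) (hw1 x)).1 e t
    · unfold lf
      split_ifs
      · exact div_nonneg (add_nonneg (wt_nonneg ha hb _ _) hβ) (by linarith)
      · exact div_nonneg (by linarith [hw1 z e]) hq0.le
  refine (Finset.prod_le_prod (fun e _ => hfac0 e) fun e _ => hfac e).trans ?_
  rw [← Real.exp_sum, Real.exp_le_exp, Finset.sum_add_distrib, ← Finset.mul_sum]
  have h1 := sum_sum_eq_two_mul_sum_vpair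
    (fun u v => ci k (x u) (x v) * ci k (z u) (z v)) (fun u v => by
      unfold ci; simp only [eq_comm])
  have h2 := sum_ci_mul_ci_le hk hn0' hε h
  have h3 : 0 ≤ ∑ u, ci k (x u) (x u) * ci k (z u) (z u) :=
    Finset.sum_nonneg fun u _ => by simp [ci]; exact mul_self_nonneg _
  have h4 : ∑ e : VPair n, ci k (x e.1.1) (x e.1.2) * ci k (z e.1.1) (z e.1.2) ≤
      (k : ℝ) ^ 2 * (k.factorial + 1) ^ 2 / 8 * ε ^ 2 * n ^ 2 := by linarith
  have h5 : (a - b) ^ 2 / (n * d * (1 - d / n)) ≤ (a - b) ^ 2 * (2 / n) := by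
    rw [div_eq_mul_inv]
    refine mul_le_mul_of_nonneg_left ?_ (sq_nonneg _)
    rw [inv_eq_one_div, div_le_div_iff₀ (by positivity) hn0]
    have : 1 / 2 ≤ d * (1 - d / n) := by nlinarith
    nlinarith
  have h6 : (a - b) ^ 2 / (n * d * (1 - d / n)) *
      ∑ e : VPair n, ci k (x e.1.1) (x e.1.2) * ci k (z e.1.1) (z e.1.2) ≤
      (a - b) ^ 2 * (2 / n) * ((k : ℝ) ^ 2 * (k.factorial + 1) ^ 2 / 8 * ε ^ 2 * n ^ 2) := by
    refine (mul_le_mul_of_nonneg_left h4 (by positivity)).trans ?_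
    exact mul_le_mul_of_nonneg_right h5 (by positivity)
  have h7 : (a - b) ^ 2 * (2 / n) * ((k : ℝ) ^ 2 * (k.factorial + 1) ^ 2 / 8 * ε ^ 2 * n ^ 2) =
      n * ((a - b) ^ 2 * (k ^ 2 * (k.factorial + 1) ^ 2) * ε ^ 2) / 4 := by
    field_simp; ring
  have h8 : ∑ _e : VPair n, max a b * β / n ≤ n * (max a b * β) := by
    rw [Finset.sum_const, nsmul_eq_mul, Finset.card_univ]
    have hc0 : 0 ≤ max a b * β := mul_nonneg (le_max_of_le_left ha) hβ
    refine (mul_le_mul_of_nonneg_right (card_vpair_le n) (by positivity)).trans ?_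
    have : (n : ℝ) ^ 2 / 2 * (max a b * β / n) = n * (max a b * β) / 2 := by field_simp
    rw [this]
    have : 0 ≤ n * (max a b * β) := by positivity
    linarith
  have h9 : 0 ≤ n * ((a - b) ^ 2 * (k ^ 2 * (k.factorial + 1) ^ 2) * ε ^ 2) := by positivity
  linarith

end Model

section Recovery

variable {n k : ℕ}

/-- The uniform weights on labels. -/
noncomputable def um (n k : ℕ) (_ : Fin n) (_ : Fin k) : ℝ := 1 / k

lemma isP_um (hk : 0 < k) : IsP (um n k) := by
  have : (k : ℝ) ≠ 0 := by positivity
  exact ⟨fun _ _ => by unfold um; positivity, fun _ => by simp [um, this]⟩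

lemma pw_um (x : Fin n → Fin k) : pw (um n k) x = (1 / (k : ℝ)) ^ n := by
  simp [pw, um]

/-- Expectation under the block model. -/
noncomputable def sE (n : ℕ) {k : ℕ} (a b : ℝ) (f : (Fin n → Fin k) → (VPair n → Bool) → ℝ) : ℝ :=
  pE (um n k) fun x => pE (bm (ep n a b x)) (f x)

lemma sbmProb_eq (a b : ℝ) (E : (Fin n → Fin k) → (VPair n → Bool) → Prop) :
    sbmProb (fun _ : Fin k => 1 / (k : ℝ)) (ssbmW k (a / n) (b / n)) E =
      sE n a b fun x g => if E x g then 1 else 0 := by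
  unfold sbmProb sE pE
  refine Finset.sum_congr rfl fun x _ => ?_
  rw [Finset.mul_sum]
  refine Finset.sum_congr rfl fun g _ => ?_
  rw [sbmMass_eq, pw_um]
  by_cases h : E x g <;> simp [h]

lemma ep_nonneg {a b : ℝ} (ha : 0 ≤ a) (hb : 0 ≤ b) (x : Fin n → Fin k) (e : VPair n) :
    0 ≤ ep n a b x e := div_nonneg (wt_nonneg ha hb _ _) (Nat.cast_nonneg n)

lemma ep_le {a b : ℝ} (x : Fin n → Fin k) (e : VPair n) :
    ep n a b x e ≤ max a b / n := by
  unfold ep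
  gcongr
  exact wt_le _ _ _ _

lemma ep_le_one {a b : ℝ} (hn : max a b ≤ n) (x : Fin n → Fin k) (e : VPair n) :
    ep n a b x e ≤ 1 :=
  (ep_le x e).trans (div_le_one_of_le₀ hn (Nat.cast_nonneg n))

lemma isP_ep {a b : ℝ} (ha : 0 ≤ a) (hb : 0 ≤ b) (hn : max a b ≤ n) (x : Fin n → Fin k) :
    IsP (bm (ep n a b x)) := isP_bm (ep_nonneg ha hb x) (ep_le_one hn x)

lemma sE_mono {a b : ℝ} (ha : 0 ≤ a) (hb : 0 ≤ b) (hn : max a b ≤ n)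
    {f h : (Fin n → Fin k) → (VPair n → Bool) → ℝ} (hfh : ∀ x g, f x g ≤ h x g) :
    sE n a b f ≤ sE n a b h :=
  pE_mono (fun _ _ => by unfold um; positivity)
    fun x => pE_mono (isP_ep ha hb hn x).1 fun g => hfh x g

lemma sE_add {a b : ℝ} (f h : (Fin n → Fin k) → (VPair n → Bool) → ℝ) :
    sE n a b (fun x g => f x g + h x g) = sE n a b f + sE n a b h := by
  unfold sE; rw [← pE_add]; congr 1; ext x; rw [← pE_add]

lemma sE_sub {a b : ℝ} (f h : (Fin n → Fin k) → (VPair n → Bool) → ℝ) :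
    sE n a b (fun x g => f x g - h x g) = sE n a b f - sE n a b h := by
  unfold sE; rw [← pE_sub]; congr 1; ext x; rw [← pE_sub]

lemma sE_const (hk : 0 < k) {a b : ℝ} (ha : 0 ≤ a) (hb : 0 ≤ b) (hn : max a b ≤ n) (c : ℝ) :
    sE n (k := k) a b (fun _ _ => c) = c := by
  unfold sE
  simp only [pE_const (isP_ep ha hb hn _), pE_const (isP_um hk)]

/-- The smoothed partition function. -/
noncomputable def pf (n k : ℕ) (a b d β : ℝ) (g : VPair n → Bool) : ℝ :=
  ∑ z : Fin n → Fin k, lr a b d β z g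

lemma lf_false_bounds {d w : ℝ} (hd : 0 < d) (hw : 0 ≤ w) (hn : 2 * d ≤ n) (hwn : 2 * w ≤ n)
    (β : ℝ) : 1 / 2 ≤ lf n d β w false ∧ lf n d β w false ≤ 2 := by
  have hn0 : (0 : ℝ) < n := by linarith
  have h1 : d / n ≤ 1 / 2 := by rw [div_le_iff₀ hn0]; linarith
  have h2 : w / n ≤ 1 / 2 := by rw [div_le_iff₀ hn0]; linarith
  have h3 : 0 < d / n := by positivity
  have h4 : 0 ≤ w / n := by positivity
  simp only [lf, Bool.false_eq_true, if_false]
  rw [le_div_iff₀ (by linarith), div_le_iff₀ (by linarith)]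
  constructor <;> linarith

/-- The Lipschitz constant of the smoothed free energy. -/
noncomputable def lipC (c d β : ℝ) : ℝ := Real.log (2 * (c + β) / d + 2 * d / β + 1)

lemma lipC_nonneg {c d β : ℝ} (hc : 0 ≤ c) (hd : 0 < d) (hβ : 0 < β) : 0 ≤ lipC c d β := by
  refine Real.log_nonneg ?_
  have : 0 ≤ 2 * (c + β) / d + 2 * d / β := by positivity
  linarith

lemma lf_pos {d β w : ℝ} (hd : 0 < d) (hβ : 0 < β) (hw : 0 ≤ w) (hn : 2 * d ≤ n) (hwn : 2 * w ≤ n)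
    (t : Bool) : 0 < lf n d β w t := by
  cases t
  · linarith [(lf_false_bounds hd hw hn hwn β).1]
  · simp only [lf, if_true]; positivity

lemma lr_update (a b d β : ℝ) (z : Fin n → Fin k) (g : VPair n → Bool) (e : VPair n) (t : Bool) :
    lr a b d β z (Function.update g e t) = lf n d β (wt a b (z e.1.1) (z e.1.2)) t *
      ∏ e' ∈ Finset.univ.erase e, lf n d β (wt a b (z e'.1.1) (z e'.1.2)) (g e') := by
  unfold lr
  rw [← Finset.mul_prod_erase _ _ (Finset.mem_univ e), Function.update_self]
  congr 1
  refine Finset.prod_congr rfl fun e' he' => ?_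
  rw [Function.update_of_ne (Finset.ne_of_mem_erase he')]

lemma lr_pos {a b d β : ℝ} (ha : 0 ≤ a) (hb : 0 ≤ b) (hd : 0 < d) (hβ : 0 < β) (hn : 2 * d ≤ n)
    (hcn : 2 * max a b ≤ n) (z : Fin n → Fin k) (g : VPair n → Bool) : 0 < lr a b d β z g :=
  Finset.prod_pos fun _ _ => lf_pos hd hβ (wt_nonneg ha hb _ _) hn
    ((mul_le_mul_of_nonneg_left (wt_le _ _ _ _) (by norm_num)).trans hcn) _

lemma lr_nonneg {a b d β : ℝ} (ha : 0 ≤ a) (hb : 0 ≤ b) (hd : 0 < d) (hβ : 0 ≤ β) (hn : 2 * d ≤ n)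
    (hcn : 2 * max a b ≤ n) (z : Fin n → Fin k) (g : VPair n → Bool) : 0 ≤ lr a b d β z g := by
  refine Finset.prod_nonneg fun e _ => ?_
  have hw := wt_nonneg ha hb (z e.1.1) (z e.1.2)
  cases g e
  · linarith [(lf_false_bounds hd hw hn
      ((mul_le_mul_of_nonneg_left (wt_le _ _ _ _) (by norm_num)).trans hcn) β).1]
  · simp only [lf, if_true]; positivity

lemma lr_zero_pos {a b d : ℝ} (ha : 0 ≤ a) (hb : 0 ≤ b) (hd : 0 < d) (hn : 2 * d ≤ n)
    (hcn : 2 * max a b ≤ n) {x : Fin n → Fin k} {g : VPair n → Bool}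
    (h : pw (bm (ep n a b x)) g ≠ 0) : 0 < lr a b d 0 x g := by
  refine lt_of_le_of_ne (lr_nonneg ha hb hd le_rfl hn hcn x g) (Ne.symm ?_)
  refine Finset.prod_ne_zero_iff.2 fun e he => ?_
  have h1 := Finset.prod_ne_zero_iff.1 h e he
  have hw := wt_nonneg ha hb (x e.1.1) (x e.1.2)
  cases hg : g e
  · linarith [(lf_false_bounds hd hw hn
      ((mul_le_mul_of_nonneg_left (wt_le _ _ _ _) (by norm_num)).trans hcn) 0).1]
  · rw [hg] at h1
    simp only [bm, ep, if_true] at h1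
    simp only [lf, if_true, add_zero]
    exact div_ne_zero (div_ne_zero_iff.1 h1).1 hd.ne'

lemma lr_zero_le {a b d β : ℝ} (ha : 0 ≤ a) (hb : 0 ≤ b) (hd : 0 < d) (hβ : 0 ≤ β) (hn : 2 * d ≤ n)
    (hcn : 2 * max a b ≤ n) (z : Fin n → Fin k) (g : VPair n → Bool) :
    lr a b d 0 z g ≤ lr a b d β z g := by
  refine Finset.prod_le_prod (fun e _ => ?_) fun e _ => ?_
  all_goals have hw := wt_nonneg ha hb (z e.1.1) (z e.1.2)
  all_goals cases g e
  · linarith [(lf_false_bounds hd hw hn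
      ((mul_le_mul_of_nonneg_left (wt_le _ _ _ _) (by norm_num)).trans hcn) 0).1]
  · simp only [lf, if_true]; positivity
  · simp [lf]
  · simp only [lf, if_true]
    gcongr

lemma pf_pos (hk : 0 < k) {a b d β : ℝ} (ha : 0 ≤ a) (hb : 0 ≤ b) (hd : 0 < d) (hβ : 0 < β)
    (hn : 2 * d ≤ n) (hcn : 2 * max a b ≤ n) (g : VPair n → Bool) : 0 < pf n k a b d β g := by
  have : Nonempty (Fin k) := ⟨⟨0, hk⟩⟩
  exact Finset.sum_pos (fun z _ => lr_pos ha hb hd hβ hn hcn z g) Finset.univ_nonempty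

lemma abs_log_pf_sub_le (hk : 0 < k) {a b d β : ℝ} (ha : 0 ≤ a) (hb : 0 ≤ b) (hd : 0 < d)
    (hβ : 0 < β) (hn : 2 * d ≤ n) (hcn : 2 * max a b ≤ n) (g : VPair n → Bool) (e : VPair n) :
    |Real.log (pf n k a b d β (Function.update g e true)) -
      Real.log (pf n k a b d β (Function.update g e false))| ≤ lipC (max a b) d β := by
  set M := 2 * (max a b + β) / d + 2 * d / β + 1 with hM
  have hc : 0 ≤ max a b := le_max_of_le_left ha
  have hM1 : 2 * (max a b + β) / d ≤ M := by
    have : 0 ≤ 2 * d / β := by positivity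
    linarith
  have hM2 : 2 * d / β ≤ M := by
    have : 0 ≤ 2 * (max a b + β) / d := by positivity
    linarith
  have hM0 : 0 < M := by positivity
  have hwn : ∀ z : Fin n → Fin k, 2 * wt a b (z e.1.1) (z e.1.2) ≤ n := fun z =>
    (mul_le_mul_of_nonneg_left (wt_le _ _ _ _) (by norm_num)).trans hcn
  have hrest : ∀ z : Fin n → Fin k,
      0 ≤ ∏ e' ∈ Finset.univ.erase e, lf n d β (wt a b (z e'.1.1) (z e'.1.2)) (g e') := fun z =>
    Finset.prod_nonneg fun e' _ => (lf_pos hd hβ (wt_nonneg ha hb _ _) hn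
      ((mul_le_mul_of_nonneg_left (wt_le _ _ _ _) (by norm_num)).trans hcn) _).le
  have h1 : pf n k a b d β (Function.update g e true) ≤
      M * pf n k a b d β (Function.update g e false) := by
    unfold pf
    rw [Finset.mul_sum]
    refine Finset.sum_le_sum fun z _ => ?_
    rw [lr_update, lr_update, ← mul_assoc]
    refine mul_le_mul_of_nonneg_right ?_ (hrest z)
    have h2 := (lf_false_bounds hd (wt_nonneg ha hb _ _) hn (hwn z) β).1
    have h3 : lf n d β (wt a b (z e.1.1) (z e.1.2)) true ≤ (max a b + β) / d := by
      simp only [lf, if_true]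
      gcongr
      exact wt_le _ _ _ _
    have h4 : M * (1 / 2) ≤ M * lf n d β (wt a b (z e.1.1) (z e.1.2)) false :=
      mul_le_mul_of_nonneg_left h2 hM0.le
    have h5 : (max a b + β) / d = 2 * (max a b + β) / d * (1 / 2) := by ring
    linarith
  have h2 : pf n k a b d β (Function.update g e false) ≤
      M * pf n k a b d β (Function.update g e true) := by
    unfold pf
    rw [Finset.mul_sum]
    refine Finset.sum_le_sum fun z _ => ?_
    rw [lr_update, lr_update, ← mul_assoc]
    refine mul_le_mul_of_nonneg_right ?_ (hrest z)
    have h2 := (lf_false_bounds hd (wt_nonneg ha hb _ _) hn (hwn z) β).2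
    have h3 : β / d ≤ lf n d β (wt a b (z e.1.1) (z e.1.2)) true := by
      simp only [lf, if_true]
      gcongr
      linarith [wt_nonneg ha hb (z e.1.1) (z e.1.2)]
    have h4 : M * (β / d) ≤ M * lf n d β (wt a b (z e.1.1) (z e.1.2)) true :=
      mul_le_mul_of_nonneg_left h3 hM0.le
    have h5 : 2 * d / β * (β / d) ≤ M * (β / d) :=
      mul_le_mul_of_nonneg_right hM2 (by positivity)
    have h6 : 2 * d / β * (β / d) = 2 := by field_simp
    linarith
  have p1 := pf_pos hk ha hb hd hβ hn hcn (Function.update g e true)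
  have p2 := pf_pos hk ha hb hd hβ hn hcn (Function.update g e false)
  have l1 := Real.log_le_log p1 h1
  have l2 := Real.log_le_log p2 h2
  rw [Real.log_mul hM0.ne' p2.ne'] at l1
  rw [Real.log_mul hM0.ne' p1.ne'] at l2
  unfold lipC
  rw [← hM, abs_le]
  constructor <;> linarith

lemma sum_vpair_incident_le (u : Fin n) :
    ∑ e : VPair n, (if e.1.1 = u ∨ e.1.2 = u then (1 : ℝ) else 0) ≤ n := by
  have h := sum_sum_eq_two_mul_sum_vpair
    (fun s t : Fin n => if s = u ∨ t = u then (1 : ℝ) else 0) (fun s t => by simp only [or_comm])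
  have h1 : ∑ s : Fin n, ∑ t : Fin n, (if s = u ∨ t = u then (1 : ℝ) else 0) ≤ 
      ∑ s : Fin n, ∑ t : Fin n, ((if s = u then (1 : ℝ) else 0) + if t = u then 1 else 0) := by
    refine Finset.sum_le_sum fun s _ => Finset.sum_le_sum fun t _ => ?_
    by_cases h1 : s = u <;> by_cases h2 : t = u <;> simp [h1, h2]
  have h2 : ∑ s : Fin n, ∑ t : Fin n, ((if s = u then (1 : ℝ) else 0) + if t = u then 1 else 0) =
      n + n := by
    simp [Finset.sum_add_distrib]
  have h3 : 0 ≤ ∑ s : Fin n, (if s = u ∨ s = u then (1 : ℝ) else 0) :=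
    Finset.sum_nonneg fun s _ => by split_ifs <;> norm_num
  linarith

/-- Concentration of the smoothed free energy. -/
theorem sE_log_pf_lt_le (hk : 0 < k) {a b d β : ℝ} (ha : 0 ≤ a) (hb : 0 ≤ b) (hd : 0 < d)
    (hβ : 0 < β) (hn : 2 * d ≤ n) (hcn : 2 * max a b ≤ n) {t : ℝ} (ht : 0 < t) :
    sE n (k := k) a b (fun _ g => if Real.log (pf n k a b d β g) <
      sE n (k := k) a b (fun _ g => Real.log (pf n k a b d β g)) - 2 * t then 1 else 0) ≤
      n * (max a b * (max a b + 1) * lipC (max a b) d β ^ 2) / t ^ 2 := by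
  have hn0 : (0 : ℝ) < n := by linarith
  have hc : 0 ≤ max a b := le_max_of_le_left ha
  have hcn' : max a b ≤ n := by linarith
  set C := lipC (max a b) d β with hC
  have hC0 : 0 ≤ C := lipC_nonneg hc hd hβ
  set F : (VPair n → Bool) → ℝ := fun g => Real.log (pf n k a b d β g) with hF
  have hlip : ∀ e g, |F (Function.update g e true) - F (Function.update g e false)| ≤ C :=
    fun e g => abs_log_pf_sub_le hk ha hb hd hβ hn hcn g e
  set Φ : (Fin n → Fin k) → ℝ := fun x => pE (bm (ep n a b x)) F with hΦ
  set μ := sE n (k := k) a b (fun _ g => F g) with hμ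
  have hlip' : ∀ e g s s', |F (Function.update g e s) - F (Function.update g e s')| ≤ C := by
    intro e g s s'
    cases s <;> cases s'
    · simpa using hC0
    · rw [abs_sub_comm]; exact hlip e g
    · exact hlip e g
    · simpa using hC0
  have hvar1 : ∀ x, pE (bm (ep n a b x)) (fun g => (F g - Φ x) ^ 2) ≤ n * (max a b * C ^ 2) := by
    intro x
    have := efron_stein (isP_ep ha hb hcn' x) F (fun _ => C) (fun _ => max a b / n * C ^ 2)
      (fun _ => false) (fun _ => hC0) hlip' (fun e => by
        simp only [bm, Bool.false_eq_true, if_false, sub_sub_cancel]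
        exact mul_le_mul_of_nonneg_right (ep_le x e) (sq_nonneg _))
    refine this.trans ?_
    rw [Finset.sum_const, nsmul_eq_mul, Finset.card_univ]
    refine (mul_le_mul_of_nonneg_right (card_vpair_le n) (by positivity)).trans ?_
    have e1 : (n : ℝ) ^ 2 / 2 * (max a b / n * C ^ 2) = n * (max a b * C ^ 2) / 2 := by field_simp
    rw [e1]
    have : 0 ≤ n * (max a b * C ^ 2) := by positivity
    linarith
  have hΦlip : ∀ u x i j, |Φ (Function.update x u i) - Φ (Function.update x u j)| ≤
      max a b * C := by
    intro u x i j
    refine (abs_pE_bm_sub_le (ep_nonneg ha hb _) (ep_le_one hcn' _) (ep_nonneg ha hb _)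
      (ep_le_one hcn' _) F C hlip).trans ?_
    have h1 : ∀ e ∈ Finset.univ, |ep n a b (Function.update x u i) e -
        ep n a b (Function.update x u j) e| * C ≤
        (if e.1.1 = u ∨ e.1.2 = u then (1 : ℝ) else 0) * (max a b / n * C) := by
      intro e _
      split_ifs with he
      · rw [one_mul]
        refine mul_le_mul_of_nonneg_right ?_ hC0
        rw [abs_le]
        have e1 := ep_nonneg ha hb (Function.update x u i) e
        have e2 := ep_nonneg ha hb (Function.update x u j) e
        have e3 := ep_le (a := a) (b := b) (Function.update x u i) e
        have e4 := ep_le (a := a) (b := b) (Function.update x u j) e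
        constructor <;> linarith
      · rw [not_or] at he
        simp [ep, Function.update_of_ne he.1, Function.update_of_ne he.2]
    refine (Finset.sum_le_sum h1).trans ?_
    rw [← Finset.sum_mul]
    refine (mul_le_mul_of_nonneg_right (sum_vpair_incident_le u) (by positivity)).trans ?_
    apply le_of_eq
    field_simp
  have hvar2 : pE (um n k) (fun x => (Φ x - μ) ^ 2) ≤ n * (max a b * C) ^ 2 := by
    have := efron_stein (isP_um hk) Φ (fun _ => max a b * C) (fun _ => (max a b * C) ^ 2)
      (fun _ => ⟨0, hk⟩) (fun _ => by positivity) hΦlip (fun u => by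
        have : 0 ≤ um n k u ⟨0, hk⟩ := (isP_um hk).1 _ _
        have h2 : 0 ≤ (max a b * C) ^ 2 := sq_nonneg _
        nlinarith)
    exact this.trans (le_of_eq (by simp))
  have hpt : ∀ x g, (if F g < μ - 2 * t then (1 : ℝ) else 0) ≤
      (if t ≤ |F g - Φ x| then 1 else 0) + if t ≤ |Φ x - μ| then 1 else 0 := by
    intro x g
    split_ifs with h1 h2 h3 h3 <;> try norm_num
    push Not at h2 h3
    rw [abs_lt] at h2 h3
    linarith [h2.1, h3.1]
  refine (sE_mono ha hb hcn' hpt).trans ?_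
  rw [sE_add]
  have b1 : sE n a b (fun (x : Fin n → Fin k) g => if t ≤ |F g - Φ x| then (1 : ℝ) else 0) ≤
      n * (max a b * C ^ 2) / t ^ 2 := by
    unfold sE
    rw [← pE_const (isP_um hk) (n * (max a b * C ^ 2) / t ^ 2)]
    exact pE_mono (isP_um hk).1 fun x =>
      pE_chebyshev (isP_ep ha hb hcn' x) F (Φ x) _ t ht (hvar1 x)
  have b2 : sE n a b (fun (x : Fin n → Fin k) _ => if t ≤ |Φ x - μ| then (1 : ℝ) else 0) ≤
      n * (max a b * C) ^ 2 / t ^ 2 := by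
    unfold sE
    simp only [pE_const (isP_ep ha hb hcn' _)]
    exact pE_chebyshev (isP_um hk) Φ μ _ t ht hvar2
  have e : n * (max a b * (max a b + 1) * C ^ 2) / t ^ 2 =
      n * (max a b * C ^ 2) / t ^ 2 + n * (max a b * C) ^ 2 / t ^ 2 := by ring
  rw [e]
  linarith

/-- A maximum a posteriori type estimator recovers as soon as the free energy is large. -/
theorem one_sub_le_sE_agreement (hk : 0 < k) {a b d β ε : ℝ} (ha : 0 ≤ a) (hb : 0 ≤ b)
    (hd : d = (a + ((k : ℝ) - 1) * b) / k) (hd1 : 1 < d)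
    (hβ : 0 < β) (hε : 0 ≤ ε) (hn : 2 * d ≤ n) (hcn : 2 * max a b ≤ n) (l : ℝ)
    (est : (VPair n → Bool) → (Fin n → Fin k))
    (hest : ∀ (g : VPair n → Bool) (y : Fin n → Fin k),
      ∑ x, pw (bm (ep n a b x)) g * (if 1 / (k : ℝ) + ε ≤ agreement x y then 1 else 0)
      ≤ ∑ x, pw (bm (ep n a b x)) g *
        (if 1 / (k : ℝ) + ε ≤ agreement x (est g) then 1 else 0)) :
    1 - sE n (k := k) a b (fun _ g => if Real.log (pf n k a b d β g) < n * l then 1 else 0) -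
      Real.exp (n * (Real.log k - l +
        ((a - b) ^ 2 * (k ^ 2 * (k.factorial + 1) ^ 2) * ε ^ 2 + max a b * β))) ≤
      sE n a b fun x g => if 1 / (k : ℝ) + ε ≤ agreement x (est g) then 1 else 0 := by
  have hc : 0 ≤ max a b := le_max_of_le_left ha
  have hcn' : max a b ≤ n := by linarith
  have hd0 : 0 < d := by linarith
  have hZ := pf_pos (n := n) hk ha hb hd0 hβ hn hcn
  have hl := lr_pos (n := n) (k := k) ha hb hd0 hβ hn hcn
  set G : (Fin n → Fin k) → (Fin n → Fin k) → ℝ :=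
    fun x z => if 1 / (k : ℝ) + ε ≤ agreement x z then 1 else 0 with hG
  have h1 : sE n a b (fun x g => ∑ z, lr a b d β z g / pf n k a b d β g * G x z) ≤
      sE n a b fun x g => G x (est g) := by
    have sw : ∀ f : (Fin n → Fin k) → (VPair n → Bool) → ℝ, sE n a b f =
        ∑ g, (1 / (k : ℝ)) ^ n * ∑ x, pw (bm (ep n a b x)) g * f x g := by
      intro f
      unfold sE pE
      simp only [pw_um, Finset.mul_sum]
      exact Finset.sum_comm
    rw [sw, sw]
    refine Finset.sum_le_sum fun g _ => mul_le_mul_of_nonneg_left ?_ (by positivity)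
    have e1 : ∑ x, pw (bm (ep n a b x)) g * ∑ z, lr a b d β z g / pf n k a b d β g * G x z =
        ∑ z, lr a b d β z g / pf n k a b d β g * ∑ x, pw (bm (ep n a b x)) g * G x z := by
      simp only [Finset.mul_sum]
      rw [Finset.sum_comm]
      exact Finset.sum_congr rfl fun _ _ => Finset.sum_congr rfl fun _ _ => by ring
    rw [e1]
    have e2 : ∑ z, lr a b d β z g / pf n k a b d β g * ∑ x, pw (bm (ep n a b x)) g * G x z ≤
        ∑ z, lr a b d β z g / pf n k a b d β g * ∑ x, pw (bm (ep n a b x)) g * G x (est g) :=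
      Finset.sum_le_sum fun z _ => mul_le_mul_of_nonneg_left (hest g z)
        (div_nonneg (hl z g).le (hZ g).le)
    refine e2.trans (le_of_eq ?_)
    rw [← Finset.sum_mul, ← Finset.sum_div]
    have : (∑ z, lr a b d β z g) / pf n k a b d β g = 1 := div_self (hZ g).ne'
    rw [this, one_mul]
  refine le_trans ?_ h1
  have h2 : ∀ (x : Fin n → Fin k) g,
      1 - (if Real.log (pf n k a b d β g) < n * l then (1 : ℝ) else 0) -
        Real.exp (-(n * l)) * ∑ z, lr a b d β z g * (1 - G x z) ≤
      ∑ z, lr a b d β z g / pf n k a b d β g * G x z := by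
    intro x g
    have hG1 : ∀ z, 0 ≤ 1 - G x z := fun z => by simp only [hG]; split_ifs <;> norm_num
    have hG0 : ∀ z, 0 ≤ G x z := fun z => by simp only [hG]; split_ifs <;> norm_num
    have hs : 0 ≤ ∑ z, lr a b d β z g * (1 - G x z) :=
      Finset.sum_nonneg fun z _ => mul_nonneg (hl z g).le (hG1 z)
    split_ifs with hlt
    · have e1 : 0 ≤ ∑ z, lr a b d β z g / pf n k a b d β g * G x z :=
        Finset.sum_nonneg fun z _ => mul_nonneg (div_nonneg (hl z g).le (hZ g).le) (hG0 z)
      have e2 := mul_nonneg (Real.exp_pos (-(n * l))).le hs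
      linarith
    · push Not at hlt
      have e0 : ∑ z, lr a b d β z g / pf n k a b d β g * G x z =
          1 - (pf n k a b d β g)⁻¹ * ∑ z, lr a b d β z g * (1 - G x z) := by
        have : (1 : ℝ) = (pf n k a b d β g)⁻¹ * ∑ z : Fin n → Fin k, lr a b d β z g :=
          (inv_mul_cancel₀ (hZ g).ne').symm
        nth_rewrite 1 [this]
        rw [← mul_sub, ← Finset.sum_sub_distrib, Finset.mul_sum]
        exact Finset.sum_congr rfl fun z _ => by ring
      rw [e0, sub_zero]
      have e3 : (pf n k a b d β g)⁻¹ ≤ Real.exp (-(n * l)) := by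
        rw [Real.exp_neg]
        refine inv_anti₀ (Real.exp_pos _) ?_
        rw [← Real.exp_log (hZ g)]
        exact Real.exp_le_exp.2 hlt
      have := mul_le_mul_of_nonneg_right e3 hs
      linarith
  refine le_trans ?_ (sE_mono ha hb hcn' h2)
  rw [sE_sub, sE_sub, sE_const hk ha hb hcn']
  have h3 : sE n a b (fun x g => Real.exp (-(n * l)) * ∑ z, lr a b d β z g * (1 - G x z)) ≤
      Real.exp (n * (Real.log k - l +
        ((a - b) ^ 2 * (k ^ 2 * (k.factorial + 1) ^ 2) * ε ^ 2 + max a b * β))) := by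
    unfold sE
    refine (pE_mono (isP_um hk).1 fun x => ?_).trans_eq (pE_const (isP_um (n := n) hk) _)
    rw [pE_mul_left, pE_sum]
    set T := (a - b) ^ 2 * (k ^ 2 * (k.factorial + 1) ^ 2) * ε ^ 2 + max a b * β with hT
    have e1 : ∀ z ∈ (Finset.univ : Finset (Fin n → Fin k)),
        pE (bm (ep n a b x)) (fun g => lr a b d β z g * (1 - G x z)) ≤ Real.exp (n * T) := by
      intro z _
      by_cases hz : 1 / (k : ℝ) + ε ≤ agreement x z
      · simp only [hG, if_pos hz, sub_self, mul_zero, pE_const (isP_ep ha hb hcn' x)]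
        positivity
      · simp only [hG, if_neg hz, sub_zero, mul_one]
        exact pE_lr_le hk ha hb hd hd1 hβ.le hε hn hcn' (not_le.1 hz)
    refine (mul_le_mul_of_nonneg_left (Finset.sum_le_sum e1) (Real.exp_pos _).le).trans ?_
    rw [Finset.sum_const, nsmul_eq_mul, Finset.card_univ, Fintype.card_pi]
    have hk' : (0 : ℝ) < k := by exact_mod_cast hk
    have e2 : ((∏ _i : Fin n, Fintype.card (Fin k) : ℕ) : ℝ) = Real.exp (n * Real.log k) := by
      rw [mul_comm, Real.exp_mul, Real.exp_log hk']
      simp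
    rw [e2, ← Real.exp_add, ← Real.exp_add]
    refine Real.exp_le_exp.2 (le_of_eq ?_)
    ring
  linarith

/-- Weak recovery is possible as soon as the free energy density exceeds `log k`. -/
theorem recovery_of_freeEnergy (hk : 0 < k) {a b d L : ℝ} (ha : 0 ≤ a) (hb : 0 ≤ b)
    (hd : d = (a + ((k : ℝ) - 1) * b) / k) (hd1 : 1 < d) (hL : Real.log k < L)
    (hF : ∀ᶠ n : ℕ in atTop,
      n * L ≤ sE n (k := k) a b fun _ g => Real.log (pf n k a b d 0 g)) :
    ∃ ε > (0 : ℝ), ∃ est : (n : ℕ) → (VPair n → Bool) → (Fin n → Fin k),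
      Tendsto
        (fun n : ℕ =>
          sbmProb (fun _ : Fin k => 1 / (k : ℝ)) (ssbmW k (a / n) (b / n))
            fun x g => 1 / (k : ℝ) + ε ≤ agreement x (est n g))
        atTop (nhds 1) := by
  set K₁ : ℝ := (a - b) ^ 2 * (k ^ 2 * (k.factorial + 1) ^ 2) with hK₁
  have hK₁0 : 0 ≤ K₁ := by positivity
  have hc : 0 ≤ max a b := le_max_of_le_left ha
  set δ := (L - Real.log k) / 4 with hδ
  have hδ0 : 0 < δ := by simp only [hδ]; linarith
  obtain ⟨ε, hε0, hε⟩ : ∃ ε > 0, K₁ * ε ^ 2 ≤ δ / 2 := by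
    refine ⟨min 1 (δ / (2 * (K₁ + 1))), by positivity, ?_⟩
    have h1 : min 1 (δ / (2 * (K₁ + 1))) ≤ 1 := min_le_left _ _
    have h2 : min 1 (δ / (2 * (K₁ + 1))) ≤ δ / (2 * (K₁ + 1)) := min_le_right _ _
    have h0 : 0 < min 1 (δ / (2 * (K₁ + 1))) := by positivity
    have h3 : min 1 (δ / (2 * (K₁ + 1))) ^ 2 ≤ δ / (2 * (K₁ + 1)) := by nlinarith
    calc _ ≤ (K₁ + 1) * (δ / (2 * (K₁ + 1))) := by gcongr; linarith
      _ = δ / 2 := by field_simp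
  obtain ⟨β, hβ0, hβ⟩ : ∃ β > 0, max a b * β ≤ δ / 2 := by
    refine ⟨δ / (2 * (max a b + 1)), by positivity, ?_⟩
    calc _ ≤ (max a b + 1) * (δ / (2 * (max a b + 1))) := by gcongr; linarith
      _ = δ / 2 := by field_simp
  have : Nonempty (Fin k) := ⟨⟨0, hk⟩⟩
  have hex : ∀ (n : ℕ) (g : VPair n → Bool), ∃ y₀ : Fin n → Fin k, ∀ y,
      ∑ x, pw (bm (ep n a b x)) g * (if 1 / (k : ℝ) + ε ≤ agreement x y then 1 else 0)
      ≤ ∑ x, pw (bm (ep n a b x)) g *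
        (if 1 / (k : ℝ) + ε ≤ agreement x y₀ then 1 else 0) := fun n g =>
    Finite.exists_max fun y : Fin n → Fin k =>
      ∑ x, pw (bm (ep n a b x)) g * (if 1 / (k : ℝ) + ε ≤ agreement x y then 1 else 0)
  choose est hest using hex
  refine ⟨ε, hε0, est, ?_⟩
  simp only [sbmProb_eq]
  set K₂ := max a b * (max a b + 1) * lipC (max a b) d β ^ 2 with hK₂
  have hlarge : ∀ᶠ n : ℕ in atTop, 2 * d ≤ n ∧ 2 * max a b ≤ n ∧ (1 : ℝ) ≤ n := by
    filter_upwards [tendsto_natCast_atTop_atTop.eventually_ge_atTop (2 * d),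
      tendsto_natCast_atTop_atTop.eventually_ge_atTop (2 * max a b),
      tendsto_natCast_atTop_atTop.eventually_ge_atTop (1 : ℝ)] with n h1 h2 h3
    exact ⟨h1, h2, h3⟩
  have hlow : ∀ᶠ n : ℕ in atTop, 1 - K₂ / (δ / 2) ^ 2 / n - Real.exp (-(n * (2 * δ))) ≤
      sE n a b fun (x : Fin n → Fin k) g =>
        if 1 / (k : ℝ) + ε ≤ agreement x (est n g) then 1 else 0 := by
    filter_upwards [hlarge, hF] with n ⟨hn, hcn, hn1⟩ hFn
    have hn0 : (0 : ℝ) < n := by linarith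
    have hcn' : max a b ≤ n := by linarith
    have hd0 : 0 < d := by linarith
    refine le_trans ?_ (one_sub_le_sE_agreement hk ha hb hd hd1 hβ0 hε0.le hn hcn (L - δ) (est n)
      (hest n))
    have h1 : Real.exp (n * (Real.log k - (L - δ) +
        ((a - b) ^ 2 * (k ^ 2 * (k.factorial + 1) ^ 2) * ε ^ 2 + max a b * β))) ≤
        Real.exp (-(n * (2 * δ))) := by
      rw [Real.exp_le_exp, ← mul_neg]
      refine mul_le_mul_of_nonneg_left ?_ hn0.le
      have : L = Real.log k + 4 * δ := by simp only [hδ]; ring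
      rw [← hK₁]
      linarith
    have h2 := sE_log_pf_lt_le (k := k) hk ha hb hd0 hβ0 hn hcn (t := n * (δ / 2)) (by positivity)
    have h3 : n * L ≤ sE n (k := k) a b (fun _ g => Real.log (pf n k a b d β g)) := by
      refine hFn.trans ?_
      unfold sE pE
      refine Finset.sum_le_sum fun x _ => mul_le_mul_of_nonneg_left
        (Finset.sum_le_sum fun g _ => ?_) (pw_nonneg (isP_um hk).1 _)
      by_cases h0 : pw (bm (ep n a b x)) g = 0
      · simp [h0]
      refine mul_le_mul_of_nonneg_left ?_ (pw_nonneg (isP_ep ha hb hcn' x).1 _)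
      refine Real.log_le_log ?_ (Finset.sum_le_sum fun z _ =>
        lr_zero_le ha hb hd0 hβ0.le hn hcn z g)
      exact Finset.sum_pos' (fun z _ => lr_nonneg ha hb hd0 le_rfl hn hcn z g)
        ⟨x, Finset.mem_univ _, lr_zero_pos ha hb hd0 hn hcn h0⟩
    have h4 : sE n (k := k) a b
        (fun _ g => if Real.log (pf n k a b d β g) < n * (L - δ) then 1 else 0) ≤
        K₂ / (δ / 2) ^ 2 / n := by
      have e : K₂ / (δ / 2) ^ 2 / n = n * K₂ / (n * (δ / 2)) ^ 2 := by field_simp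
      rw [e]
      refine le_trans (sE_mono ha hb hcn' fun x g => ?_) h2
      split_ifs with p q
      · exact le_rfl
      · exfalso; apply q; linarith
      · norm_num
      · exact le_rfl
    linarith
  have hup : ∀ᶠ n : ℕ in atTop, (sE n a b fun (x : Fin n → Fin k) g =>
        if 1 / (k : ℝ) + ε ≤ agreement x (est n g) then (1 : ℝ) else 0) ≤ 1 := by
    filter_upwards [hlarge] with n ⟨hn, hcn, hn1⟩
    have hcn' : max a b ≤ n := by linarith
    refine (sE_mono ha hb hcn' fun x g => ?_).trans_eq (sE_const (n := n) hk ha hb hcn' 1)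
    split_ifs <;> norm_num
  refine tendsto_of_tendsto_of_tendsto_of_le_of_le' ?_ tendsto_const_nhds hlow hup
  have t1 : Tendsto (fun n : ℕ => K₂ / (δ / 2) ^ 2 / (n : ℝ)) atTop (nhds 0) :=
    tendsto_const_div_atTop_nhds_zero_nat _
  have t2 : Tendsto (fun n : ℕ => Real.exp (-((n : ℝ) * (2 * δ)))) atTop (nhds 0) :=
    Real.tendsto_exp_neg_atTop_nhds_zero.comp
      (tendsto_natCast_atTop_atTop.atTop_mul_const (by positivity))
  simpa using (tendsto_const_nhds.sub t1).sub t2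

end Recovery

section Single

variable {ι α : Type*} [Fintype ι] [DecidableEq ι] [Fintype α] {m : ι → α → ℝ}

lemma pE_single (hm : IsP m) (i : ι) (φ : α → ℝ) :
    pE m (fun ω => φ (ω i)) = ∑ a, m i a * φ a := by
  rw [← pE_avg hm.2 i]
  unfold avg
  simp only [Function.update_self]
  exact pE_const hm _

end Single

section FreeEnergy

variable {n k : ℕ}

/-- The posterior probability of the labelling `x`. -/
noncomputable def post (n : ℕ) {k : ℕ} (a b : ℝ) (x : Fin n → Fin k) (g : VPair n → Bool) : ℝ :=
  pw (bm (ep n a b x)) g / ∑ z : Fin n → Fin k, pw (bm (ep n a b z)) g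

/-- The information gain per vertex, up to a factor of two. -/
noncomputable def infoGain (k : ℕ) (a b d : ℝ) : ℝ :=
  (a * Real.log a + ((k : ℝ) - 1) * (b * Real.log b)) / k - d * Real.log d

lemma pE_um_eq (hk : 0 < k) {u v : Fin n} (huv : u ≠ v) (s t : ℝ) :
    pE (um n k) (fun x => if x u = x v then s else t) = (s + ((k : ℝ) - 1) * t) / k := by
  have hk' : (k : ℝ) ≠ 0 := by positivity
  rw [← pE_avg (isP_um hk).2 v]
  have : avg (um n k) v (fun x => if x u = x v then s else t) =
      fun _ => (s + ((k : ℝ) - 1) * t) / k := by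
    ext x
    simp only [avg, um, Function.update_self, Function.update_of_ne huv]
    have h1 : ∀ a : Fin k, (if x u = a then s else t) = t + if x u = a then s - t else 0 := by
      intro a; split_ifs <;> ring
    rw [← Finset.mul_sum]
    simp only [h1, Finset.sum_add_distrib, Finset.sum_ite_eq, Finset.mem_univ, if_true,
      Finset.sum_const, Finset.card_univ, Fintype.card_fin, nsmul_eq_mul]
    field_simp
    ring
  rw [this, pE_const (isP_um hk)]

lemma card_vpair (n : ℕ) : (Fintype.card (VPair n) : ℝ) = n * (n - 1) / 2 := by
  have := sum_sum_eq_two_mul_sum_vpair (n := n) (fun _ _ => (1 : ℝ)) (fun _ _ => rfl)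
  simp at this
  linarith

lemma sE_log_lr_ge (hk : 0 < k) {a b d : ℝ} (ha : 0 ≤ a) (hb : 0 ≤ b)
    (hd : d = (a + ((k : ℝ) - 1) * b) / k) (hd1 : 1 < d) (hn : 2 * d ≤ n)
    (hcn : 2 * max a b ≤ n) :
    ((n : ℝ) - 1) * (infoGain k a b d / 2) ≤
      sE n a b fun (x : Fin n → Fin k) g => Real.log (lr a b d 0 x g) := by
  have hk' : (k : ℝ) ≠ 0 := by positivity
  have hd0 : 0 < d := by linarith
  have hn0 : (0 : ℝ) < n := by linarith
  have hc : 0 ≤ max a b := le_max_of_le_left ha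
  have hcn' : max a b ≤ n := by linarith
  have h1 : ∀ x : Fin n → Fin k, ∑ e : VPair n,
      (wt a b (x e.1.1) (x e.1.2) / n * Real.log (wt a b (x e.1.1) (x e.1.2) / d) +
        (d - wt a b (x e.1.1) (x e.1.2)) / n) ≤
      pE (bm (ep n a b x)) fun g => Real.log (lr a b d 0 x g) := by
    intro x
    have e1 : (pE (bm (ep n a b x)) fun g => Real.log (lr a b d 0 x g)) =
        pE (bm (ep n a b x)) fun g => ∑ e : VPair n,
          Real.log (lf n d 0 (wt a b (x e.1.1) (x e.1.2)) (g e)) := by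
      unfold pE
      refine Finset.sum_congr rfl fun g _ => ?_
      by_cases h0 : pw (bm (ep n a b x)) g = 0
      · simp [h0]
      congr 1
      refine Real.log_prod fun e he => ?_
      have := (lr_zero_pos ha hb hd0 hn hcn h0).ne'
      exact Finset.prod_ne_zero_iff.1 this e he
    rw [e1, pE_sum]
    refine Finset.sum_le_sum fun e _ => ?_
    rw [pE_single (isP_ep ha hb hcn' x) e
      fun t => Real.log (lf n d 0 (wt a b (x e.1.1) (x e.1.2)) t), Fintype.sum_bool]
    simp only [bm, lf, ep, if_true, Bool.false_eq_true, if_false, add_zero]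
    set w := wt a b (x e.1.1) (x e.1.2) with hw
    have hw0 : 0 ≤ w := wt_nonneg ha hb _ _
    have hwc : w ≤ max a b := wt_le _ _ _ _
    have h2 : w / n ≤ 1 / 2 := by rw [div_le_iff₀ hn0]; linarith
    have h3 : d / n ≤ 1 / 2 := by rw [div_le_iff₀ hn0]; linarith
    have hp : 0 < (1 - w / n) / (1 - d / n) := div_pos (by linarith) (by linarith)
    have h4 := Real.one_sub_inv_le_log_of_pos hp
    have h5 : (1 - w / n) * (1 - ((1 - w / n) / (1 - d / n))⁻¹) = (d - w) / n := by
      have : 1 - w / n ≠ 0 := by linarith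
      rw [inv_div, mul_sub, mul_div_cancel₀ _ this]
      ring
    have h6 := mul_le_mul_of_nonneg_left h4 (show 0 ≤ 1 - w / n by linarith)
    linarith
  have h2 : ∀ x : Fin n → Fin k, ∀ e : VPair n,
      wt a b (x e.1.1) (x e.1.2) / n * Real.log (wt a b (x e.1.1) (x e.1.2) / d) +
        (d - wt a b (x e.1.1) (x e.1.2)) / n =
      if x e.1.1 = x e.1.2 then (a * Real.log a - a * Real.log d + d - a) / n
        else (b * Real.log b - b * Real.log d + d - b) / n := by
    intro x e
    have h3 : ∀ w : ℝ, w / n * Real.log (w / d) + (d - w) / n =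
        (w * Real.log w - w * Real.log d + d - w) / n := by
      intro w
      by_cases hw : w = 0
      · simp [hw]
      · rw [Real.log_div hw hd0.ne']; ring
    rw [h3]
    unfold wt
    split_ifs <;> rfl
  refine le_trans (le_of_eq ?_) (pE_mono (isP_um hk).1 h1)
  simp only [h2]
  rw [pE_sum]
  have h3 : ∀ e ∈ (Finset.univ : Finset (VPair n)), pE (um n k) (fun x => if x e.1.1 = x e.1.2 then
      (a * Real.log a - a * Real.log d + d - a) / n
        else (b * Real.log b - b * Real.log d + d - b) / n) = infoGain k a b d / n := by
    intro e _
    rw [pE_um_eq hk e.2.ne]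
    unfold infoGain
    have : d * k = a + ((k : ℝ) - 1) * b := by rw [hd]; field_simp
    field_simp
    linear_combination ((1 : ℝ) + Real.log d) * this
  rw [Finset.sum_congr rfl h3, Finset.sum_const, nsmul_eq_mul, Finset.card_univ, card_vpair]
  field_simp

lemma log_pf_eq {a b d : ℝ} (ha : 0 ≤ a) (hb : 0 ≤ b) (hd0 : 0 < d) (hn : 2 * d ≤ n)
    (hcn : 2 * max a b ≤ n) :
    (sE n (k := k) a b fun _ g => Real.log (pf n k a b d 0 g)) =
      (sE n a b fun (x : Fin n → Fin k) g => Real.log (lr a b d 0 x g)) +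
      sE n a b fun (x : Fin n → Fin k) g => -Real.log (post n a b x g) := by
  have hn0 : (0 : ℝ) < n := by linarith
  have hc : 0 ≤ max a b := le_max_of_le_left ha
  have hcn' : max a b ≤ n := by linarith
  have h3 : d / n ≤ 1 / 2 := by rw [div_le_iff₀ hn0]; linarith
  rw [← sE_add]
  unfold sE
  congr 1
  ext x
  unfold pE
  refine Finset.sum_congr rfl fun g _ => ?_
  by_cases h0 : pw (bm (ep n a b x)) g = 0
  · simp [h0]
  congr 1
  set Q := pw (bm fun _ : VPair n => d / n) g with hQ
  have hQ0 : 0 < Q := Finset.prod_pos fun e _ => by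
    unfold bm
    split_ifs
    · positivity
    · linarith
  have hL : ∀ z : Fin n → Fin k, pw (bm (ep n a b z)) g = lr a b d 0 z g * Q := by
    intro z
    rw [hQ]
    unfold pw lr
    rw [← Finset.prod_mul_distrib]
    refine Finset.prod_congr rfl fun e _ => ?_
    have : 1 - d / n ≠ 0 := by linarith
    cases g e
    · simp only [bm, lf, ep, Bool.false_eq_true, if_false]
      rw [div_mul_cancel₀ _ this]
    · simp only [bm, lf, ep, if_true]
      field_simp
      ring_nf
  have hx := lr_zero_pos ha hb hd0 hn hcn h0
  have hZ : 0 < pf n k a b d 0 g := Finset.sum_pos'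
    (fun z _ => lr_nonneg ha hb hd0 le_rfl hn hcn z g) ⟨x, Finset.mem_univ _, hx⟩
  have hpost : post n a b x g = lr a b d 0 x g / pf n k a b d 0 g := by
    unfold post pf
    simp only [hL]
    rw [← Finset.sum_mul, mul_div_mul_right _ _ hQ0.ne']
  simp only
  rw [hpost, Real.log_div hx.ne' hZ.ne']
  ring

/-- Weak recovery is possible as soon as the posterior entropy is large. -/
theorem recovery_of_entropy (hk : 0 < k) {a b d h : ℝ} (ha : 0 ≤ a) (hb : 0 ≤ b)
    (hd : d = (a + ((k : ℝ) - 1) * b) / k) (hd1 : 1 < d)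
    (hh : Real.log k < infoGain k a b d / 2 + h)
    (hF : ∀ᶠ n : ℕ in atTop,
      n * h ≤ sE n a b fun (x : Fin n → Fin k) g => -Real.log (post n a b x g)) :
    ∃ ε > (0 : ℝ), ∃ est : (n : ℕ) → (VPair n → Bool) → (Fin n → Fin k),
      Tendsto
        (fun n : ℕ =>
          sbmProb (fun _ : Fin k => 1 / (k : ℝ)) (ssbmW k (a / n) (b / n))
            fun x g => 1 / (k : ℝ) + ε ≤ agreement x (est n g))
        atTop (nhds 1) := by
  set δ := (infoGain k a b d / 2 + h - Real.log k) / 2 with hδ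
  have hδ0 : 0 < δ := by simp only [hδ]; linarith
  refine recovery_of_freeEnergy hk (L := Real.log k + δ) ha hb hd hd1 (by linarith) ?_
  filter_upwards [hF, tendsto_natCast_atTop_atTop.eventually_ge_atTop (2 * d),
      tendsto_natCast_atTop_atTop.eventually_ge_atTop (2 * max a b),
      tendsto_natCast_atTop_atTop.eventually_ge_atTop (infoGain k a b d / 2 / δ)] with n h1 h2 h3 h4
  rw [log_pf_eq ha hb (by linarith) h2 h3]
  have h5 := sE_log_lr_ge hk ha hb hd hd1 h2 h3
  rw [div_le_iff₀ hδ0] at h4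
  have h6 : n * (infoGain k a b d / 2 + h) = n * (Real.log k + 2 * δ) := by
    simp only [hδ]; ring
  linarith

end FreeEnergy

section Entropy

variable {ι α : Type*} [Fintype ι] [DecidableEq ι] [Fintype α] {L : (ι → α) → ℝ}

/-- The mass of the configurations agreeing with `x` on `B`. -/
noncomputable def mg (L : (ι → α) → ℝ) (B : Finset ι) (x : ι → α) : ℝ :=
  ∑ y, if ∀ i ∈ B, y i = x i then L y else 0

/-- The (unnormalized) conditional entropy of the coordinate `v` given the coordinates in `B`. -/
noncomputable def cent (L : (ι → α) → ℝ) (v : ι) (B : Finset ι) : ℝ :=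
  ∑ x, L x * -Real.log (mg L (insert v B) x / mg L B x)

lemma mg_nonneg (hL : ∀ x, 0 ≤ L x) (B : Finset ι) (x : ι → α) : 0 ≤ mg L B x :=
  Finset.sum_nonneg fun y _ => by split_ifs <;> simp [hL]

lemma mg_anti (hL : ∀ x, 0 ≤ L x) {B B' : Finset ι} (h : B ⊆ B') (x : ι → α) :
    mg L B' x ≤ mg L B x := by
  refine Finset.sum_le_sum fun y _ => ?_
  split_ifs with h1 h2 h2
  · exact le_rfl
  · exact absurd (fun i hi => h1 i (h hi)) h2
  · exact hL y
  · exact le_rfl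

lemma mg_univ (x : ι → α) : mg L Finset.univ x = L x := by
  unfold mg
  rw [Finset.sum_eq_single x]
  · simp
  · intro y _ hy
    rw [if_neg]
    exact fun h => hy (funext fun i => h i (Finset.mem_univ i))
  · simp

lemma mg_empty (x : ι → α) : mg L ∅ x = ∑ y, L y := by simp [mg]

lemma le_mg (hL : ∀ x, 0 ≤ L x) (B : Finset ι) (x : ι → α) : L x ≤ mg L B x := by
  rw [← mg_univ (L := L) x]
  exact mg_anti hL (Finset.subset_univ _) x

lemma mg_congr {B : Finset ι} {x y : ι → α} (h : ∀ i ∈ B, x i = y i) : mg L B x = mg L B y := by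
  unfold mg
  refine Finset.sum_congr rfl fun z _ => ?_
  have : (∀ i ∈ B, z i = x i) ↔ ∀ i ∈ B, z i = y i :=
    forall₂_congr fun i hi => by rw [h i hi]
  simp only [this]

/-- Sums over fibres: replacing a function measurable with respect to the coordinates in `B` and
in `v` by a sum over the values at `v`. -/
lemma sum_mul_ratio_le (hL : ∀ x, 0 ≤ L x) (v : ι) {B B' : Finset ι} (h : B ⊆ B') (y : ι → α) :
    (∑ x, if ∀ i ∈ B', x i = y i then
      L x * (mg L (insert v B) x / mg L (insert v B') x) else 0) ≤ mg L B y := by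
  set m' : α → ℝ := fun j => ∑ z, if (∀ i ∈ B', z i = y i) ∧ z v = j then L z else 0 with hm'
  set w : α → ℝ := fun j => ∑ z, if (∀ i ∈ B, z i = y i) ∧ z v = j then L z else 0 with hw
  have hw0 : ∀ j, 0 ≤ w j := fun j => Finset.sum_nonneg fun z _ => by split_ifs <;> simp [hL]
  have e1 : ∀ x, (∀ i ∈ B', x i = y i) → mg L (insert v B') x = m' (x v) := by
    intro x hx
    unfold mg
    refine Finset.sum_congr rfl fun z _ => ?_
    have : (∀ i ∈ insert v B', z i = x i) ↔ (∀ i ∈ B', z i = y i) ∧ z v = x v := by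
      rw [Finset.forall_mem_insert, and_comm]
      exact and_congr_left fun _ => forall₂_congr fun i hi => by rw [hx i hi]
    simp only [this]
  have e2 : ∀ x, (∀ i ∈ B', x i = y i) → mg L (insert v B) x = w (x v) := by
    intro x hx
    unfold mg
    refine Finset.sum_congr rfl fun z _ => ?_
    have : (∀ i ∈ insert v B, z i = x i) ↔ (∀ i ∈ B, z i = y i) ∧ z v = x v := by
      rw [Finset.forall_mem_insert, and_comm]
      exact and_congr_left fun _ => forall₂_congr fun i hi => by rw [hx i (h hi)]
    simp only [this]
  have e3 : (∑ x, if ∀ i ∈ B', x i = y i then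
      L x * (mg L (insert v B) x / mg L (insert v B') x) else 0) = ∑ j, m' j * (w j / m' j) := by
    simp only [hm', Finset.sum_mul]
    rw [Finset.sum_comm]
    refine Finset.sum_congr rfl fun x _ => ?_
    rw [Finset.sum_eq_single (x v)]
    · by_cases hx : ∀ i ∈ B', x i = y i
      · rw [if_pos hx, if_pos ⟨hx, rfl⟩, e1 x hx, e2 x hx]
      · rw [if_neg hx, if_neg fun h => hx h.1, zero_mul]
    · intro j _ hj
      rw [if_neg fun h => hj h.2.symm, zero_mul]
    · simp
  have e4 : mg L B y = ∑ j, w j := by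
    simp only [hw]
    rw [Finset.sum_comm]
    refine Finset.sum_congr rfl fun x _ => ?_
    rw [Finset.sum_eq_single (x v)]
    · simp
    · intro j _ hj
      rw [if_neg fun h => hj h.2.symm]
    · simp
  rw [e3, e4]
  refine Finset.sum_le_sum fun j _ => ?_
  by_cases h0 : m' j = 0
  · simp [h0, hw0]
  · rw [mul_div_cancel₀ _ h0]

lemma cent_anti (hL : ∀ x, 0 ≤ L x) (v : ι) {B B' : Finset ι} (h : B ⊆ B') :
    cent L v B' ≤ cent L v B := by
  set t : (ι → α) → ℝ := fun x =>
    mg L B' x * (mg L (insert v B) x / mg L (insert v B') x) / mg L B x with ht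
  have h1 : cent L v B' - cent L v B ≤ ∑ x, L x * (t x - 1) := by
    unfold cent
    rw [← Finset.sum_sub_distrib]
    refine Finset.sum_le_sum fun x _ => ?_
    rcases (hL x).eq_or_lt with h0 | h0
    · simp [← h0]
    have p : ∀ C, 0 < mg L C x := fun C => h0.trans_le (le_mg hL C x)
    have ht0 : 0 < t x := by
      simp only [ht]
      exact div_pos (mul_pos (p _) (div_pos (p _) (p _))) (p _)
    have e : Real.log (t x) = -Real.log (mg L (insert v B') x / mg L B' x) +
        Real.log (mg L (insert v B) x / mg L B x) := by
      simp only [ht]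
      rw [Real.log_div (mul_pos (p _) (div_pos (p _) (p _))).ne' (p _).ne',
        Real.log_mul (p _).ne' (div_pos (p _) (p _)).ne', Real.log_div (p _).ne' (p _).ne',
        Real.log_div (p _).ne' (p _).ne', Real.log_div (p _).ne' (p _).ne']
      ring
    have := Real.log_le_sub_one_of_pos ht0
    rw [← mul_sub]
    refine mul_le_mul_of_nonneg_left ?_ h0.le
    linarith
  have h2 : ∑ x, L x * t x ≤ ∑ y, L y := by
    have e1 : ∑ x, L x * t x = ∑ y, L y / mg L B y * ∑ x, if ∀ i ∈ B', x i = y i then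
      L x * (mg L (insert v B) x / mg L (insert v B') x) else 0 := by
      simp only [Finset.mul_sum]
      rw [Finset.sum_comm]
      refine Finset.sum_congr rfl fun x _ => ?_
      have e2 : t x = ∑ y, if ∀ i ∈ B', y i = x i then
          L y * (mg L (insert v B) x / mg L (insert v B') x) / mg L B x else 0 := by
        simp only [ht]
        nth_rewrite 1 [mg]
        rw [Finset.sum_mul, Finset.sum_div]
        exact Finset.sum_congr rfl fun y _ => by split_ifs <;> simp
      rw [e2, Finset.mul_sum]
      refine Finset.sum_congr rfl fun y _ => ?_
      by_cases hy : ∀ i ∈ B', y i = x i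
      · rw [if_pos hy, if_pos fun i hi => (hy i hi).symm, mg_congr fun i hi => hy i (h hi)]
        ring
      · rw [if_neg hy, if_neg fun h' => hy fun i hi => (h' i hi).symm]
        ring
    rw [e1]
    refine Finset.sum_le_sum fun y _ => ?_
    refine (mul_le_mul_of_nonneg_left (sum_mul_ratio_le hL v h y)
      (div_nonneg (hL y) (mg_nonneg hL _ _))).trans ?_
    by_cases h0 : mg L B y = 0
    · simp [h0, hL]
    · rw [div_mul_cancel₀ _ h0]
  simp only [mul_sub, mul_one, Finset.sum_sub_distrib] at h1
  linarith

/-- Chain rule lower bound for the entropy. -/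
theorem sum_cent_le_entropy (hL : ∀ x, 0 ≤ L x) (U : Finset ι) (D : ι → Finset ι) (ρ : ι → ℕ)
    (hD : ∀ u ∈ U, ∀ v ∈ U, u ≠ v → u ∈ D v → ρ u < ρ v) :
    ∑ v ∈ U, cent L v (D v)ᶜ ≤ ∑ x, L x * -Real.log (L x / ∑ y, L y) := by
  have key : ∑ v ∈ U, cent L v (D v)ᶜ ≤ ∑ x, L x * -Real.log (mg L U x / ∑ y, L y) := by
    induction U using Finset.induction_on_min_value ρ with
    | empty =>
      simp only [mg_empty, Finset.sum_empty]
      refine Finset.sum_nonneg fun x _ => mul_nonneg (hL x) (neg_nonneg.2 ?_)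
      by_cases h0 : ∑ y, L y = 0
      · simp [h0]
      · simp [div_self h0]
    | insert v U hv hmin ih =>
      rw [Finset.sum_insert hv]
      have ih' := ih fun u hu w hw => hD u (Finset.mem_insert_of_mem hu) w
        (Finset.mem_insert_of_mem hw)
      have hsub : U ⊆ (D v)ᶜ := by
        intro u hu
        rw [Finset.mem_compl]
        intro huD
        have := hD u (Finset.mem_insert_of_mem hu) v (Finset.mem_insert_self _ _)
          (fun h => hv (h ▸ hu)) huD
        exact absurd (hmin u hu) (by omega)
      have h1 := cent_anti hL v hsub
      have h2 : cent L v U + ∑ x, L x * -Real.log (mg L U x / ∑ y, L y) =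
          ∑ x, L x * -Real.log (mg L (insert v U) x / ∑ y, L y) := by
        unfold cent
        rw [← Finset.sum_add_distrib]
        refine Finset.sum_congr rfl fun x _ => ?_
        rcases (hL x).eq_or_lt with h0 | h0
        · simp [← h0]
        have p : ∀ C, 0 < mg L C x := fun C => h0.trans_le (le_mg hL C x)
        have p0 : 0 < ∑ y, L y := by rw [← mg_empty x]; exact p _
        rw [Real.log_div (p _).ne' (p _).ne', Real.log_div (p _).ne' p0.ne',
          Real.log_div (p _).ne' p0.ne']
        ring
      linarith
  refine key.trans (Finset.sum_le_sum fun x _ => ?_)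
  rcases (hL x).eq_or_lt with h0 | h0
  · simp [← h0]
  refine mul_le_mul_of_nonneg_left (neg_le_neg ?_) h0.le
  have p0 : 0 < ∑ y, L y := by rw [← mg_empty x]; exact h0.trans_le (le_mg hL _ x)
  exact Real.log_le_log (div_pos h0 p0) (div_le_div_of_nonneg_right (le_mg hL U x) p0.le)

end Entropy

section Posterior

variable {n k : ℕ}

/-- Adjacency in the graph encoded by `g`. -/
def gg (g : VPair n → Bool) (u v : Fin n) : Prop :=
  ∃ e : VPair n, g e = true ∧ ((e.1.1 = u ∧ e.1.2 = v) ∨ (e.1.1 = v ∧ e.1.2 = u))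

lemma gg_comm (g : VPair n → Bool) (u v : Fin n) : gg g u v ↔ gg g v u := by
  unfold gg
  exact exists_congr fun e => and_congr_right fun _ => or_comm

lemma gg_pair (g : VPair n → Bool) (e : VPair n) : gg g e.1.1 e.1.2 ↔ g e = true := by
  constructor
  · rintro ⟨e', h, h' | h'⟩
    · rwa [show e = e' from Subtype.ext (Prod.ext h'.1.symm h'.2.symm)]
    · have := e.2
      have h2 := e'.2
      rw [h'.1, h'.2] at h2
      exact absurd h2 (not_lt.2 this.le)
  · exact fun h => ⟨e, h, Or.inl ⟨rfl, rfl⟩⟩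

/-- The pair `e` has exactly one endpoint in `D`. -/
def Crosses (D : Finset (Fin n)) (e : VPair n) : Prop :=
  (e.1.1 ∈ D ∧ e.1.2 ∉ D) ∨ (e.1.1 ∉ D ∧ e.1.2 ∈ D)

lemma sum_crosses (D : Finset (Fin n)) (f : Fin n → Fin n → ℝ) (hf : ∀ u v, f u v = f v u) :
    (∑ e : VPair n, if Crosses D e then f e.1.1 e.1.2 else 0) = ∑ s ∈ D, ∑ t ∈ Dᶜ, f s t := by
  have h := sum_sum_eq_two_mul_sum_vpair (n := n)
    (fun u v => if (u ∈ D ∧ v ∉ D) ∨ (u ∉ D ∧ v ∈ D) then f u v else 0) (by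
      intro u v
      rw [hf u v]
      by_cases hu : u ∈ D <;> by_cases hv : v ∈ D <;> simp [hu, hv])
  have h1 : ∀ u v, (if (u ∈ D ∧ v ∉ D) ∨ (u ∉ D ∧ v ∈ D) then f u v else 0) =
      (if u ∈ D then if v ∈ Dᶜ then f u v else 0 else 0) +
      (if v ∈ D then if u ∈ Dᶜ then f v u else 0 else 0) := by
    intro u v
    rw [hf v u]
    by_cases hu : u ∈ D <;> by_cases hv : v ∈ D <;> simp [hu, hv]
  have h2 : ∀ u, (if (u ∈ D ∧ u ∉ D) ∨ (u ∉ D ∧ u ∈ D) then f u u else 0) = 0 := by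
    intro u
    rw [if_neg]
    tauto
  simp only [h2] at h
  simp only [h1, Finset.sum_add_distrib] at h
  rw [Finset.sum_comm (f := fun u v => if v ∈ D then if u ∈ Dᶜ then f v u else 0 else 0)] at h
  have h3 : ∑ u, ∑ v, (if u ∈ D then if v ∈ Dᶜ then f u v else 0 else 0) =
      ∑ s ∈ D, ∑ t ∈ Dᶜ, f s t := by
    rw [← Finset.sum_filter_add_sum_filter_not Finset.univ (fun u => u ∈ D)]
    rw [Finset.sum_eq_zero (s := Finset.univ.filter fun u => ¬ u ∈ D)]
    · rw [add_zero, Finset.filter_univ_mem]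
      refine Finset.sum_congr rfl fun u hu => ?_
      simp only [hu, if_true]
      rw [← Finset.sum_filter, Finset.filter_univ_mem]
    · intro u hu
      simp [(Finset.mem_filter.1 hu).2]
  rw [h3] at h
  simp only [Finset.sum_const_zero, add_zero] at h
  have h4 : ∀ e : VPair n, (if Crosses D e then f e.1.1 e.1.2 else 0) =
      (if e.1.1 ∈ D then if e.1.2 ∈ Dᶜ then f e.1.1 e.1.2 else 0 else 0) +
      (if e.1.2 ∈ D then if e.1.1 ∈ Dᶜ then f e.1.2 e.1.1 else 0 else 0) := fun e => by
    rw [← h1]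
    unfold Crosses
    congr
  simp only [h4, Finset.sum_add_distrib]
  linarith

/-- Edges across the boundary of `D`, contribution to the likelihood. -/
noncomputable def crossEdge (n : ℕ) (a b : ℝ) (g : VPair n → Bool) (D : Finset (Fin n))
    (x : Fin n → Fin k) : ℝ :=
  ∏ e : VPair n, if Crosses D e ∧ g e = true then ep n a b x e else 1

/-- The number of vertices outside of `D` with label `i` which are not adjacent to `s`. -/
noncomputable def cntOut (g : VPair n → Bool) (D : Finset (Fin n)) (x : Fin n → Fin k) (s : Fin n)
    (i : Fin k) : ℝ :=
  ∑ t ∈ Dᶜ, if x t = i ∧ ¬ gg g s t then 1 else 0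

lemma crossNonedge_eq (a b : ℝ) (g : VPair n → Bool) (D : Finset (Fin n)) (hca : a < n)
    (hcb : b < n) (hn : 0 < n) (y : Fin n → Fin k) :
    (∏ e : VPair n, if Crosses D e ∧ g e = false then 1 - ep n a b y e else 1) =
      Real.exp (∑ s ∈ D, ((∑ t ∈ Dᶜ, if gg g s t then 0 else Real.log (1 - b / n)) +
        cntOut g D y s (y s) * (Real.log (1 - a / n) - Real.log (1 - b / n)))) := by
  have hn' : (0 : ℝ) < n := by exact_mod_cast hn
  have hpos : ∀ u v, 0 < 1 - wt a b (y u) (y v) / n := by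
    intro u v
    rw [sub_pos, div_lt_one hn']
    exact (wt_le _ _ _ _).trans_lt (max_lt hca hcb)
  have h1 : (∏ e : VPair n, if Crosses D e ∧ g e = false then 1 - ep n a b y e else 1) =
      Real.exp (∑ e : VPair n, if Crosses D e then
        (fun u v => if gg g u v then 0 else Real.log (1 - wt a b (y u) (y v) / n))
          e.1.1 e.1.2 else 0) := by
    rw [Real.exp_sum]
    refine Finset.prod_congr rfl fun e _ => ?_
    dsimp only
    rw [gg_pair]
    by_cases h1 : Crosses D e
    · by_cases h2 : g e = true
      · simp [h1, h2]
      · simp only [Bool.not_eq_true] at h2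
        simp only [h1, h2, true_and, if_true, Bool.false_eq_true, if_false]
        rw [Real.exp_log (hpos _ _)]
        rfl
    · simp [h1]
  rw [h1, sum_crosses D (fun u v => if gg g u v then 0 else
    Real.log (1 - wt a b (y u) (y v) / n))]
  · congr 1
    refine Finset.sum_congr rfl fun s _ => ?_
    unfold cntOut
    rw [Finset.sum_mul, ← Finset.sum_add_distrib]
    refine Finset.sum_congr rfl fun t _ => ?_
    by_cases h2 : gg g s t
    · simp [h2]
    · by_cases h3 : y s = y t
      · simp [h2, h3, wt]
      · simp [h2, h3, Ne.symm h3, wt]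
  · intro u v
    rw [gg_comm g u v]
    unfold wt
    simp only [eq_comm (a := y u)]

/-- Exchanging the labels `j` and `j'` on `D`. -/
noncomputable def swapOn (D : Finset (Fin n)) (j j' : Fin k) (y : Fin n → Fin k) : Fin n → Fin k :=
  fun s => if s ∈ D then Equiv.swap j j' (y s) else y s

lemma swapOn_swapOn (D : Finset (Fin n)) (j j' : Fin k) (y : Fin n → Fin k) :
    swapOn D j j' (swapOn D j j' y) = y := by
  ext s
  unfold swapOn
  by_cases h : s ∈ D <;> simp [h]

lemma pw_ep_split (a b : ℝ) (g : VPair n → Bool) (D : Finset (Fin n)) (y : Fin n → Fin k) :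
    pw (bm (ep n a b y)) g =
      (∏ e : VPair n, if Crosses D e then 1 else bm (ep n a b y) e (g e)) *
        crossEdge n a b g D y *
        ∏ e : VPair n, if Crosses D e ∧ g e = false then 1 - ep n a b y e else 1 := by
  unfold pw crossEdge
  rw [← Finset.prod_mul_distrib, ← Finset.prod_mul_distrib]
  refine Finset.prod_congr rfl fun e _ => ?_
  by_cases h1 : Crosses D e
  · cases h2 : g e <;> simp [h1, bm]
  · simp [h1]

theorem swap_likelihood (a b : ℝ) (ha : 0 ≤ a) (hb : 0 ≤ b) (g : VPair n → Bool)
    (D : Finset (Fin n)) (hcn : 2 * max a b ≤ n) (hn : 0 < n) (y : Fin n → Fin k)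
    (j j' : Fin k) (m δ : ℝ) (hδ : 0 ≤ δ)
    (hcnt : ∀ s ∈ D, |cntOut g D y s j - m| ≤ δ ∧ |cntOut g D y s j' - m| ≤ δ) :
    Real.exp (-(D.card * (4 * δ * max a b / n))) *
      (pw (bm (ep n a b y)) g * crossEdge n a b g D (swapOn D j j' y)) ≤
      pw (bm (ep n a b (swapOn D j j' y))) g * crossEdge n a b g D y := by
  have hn' : (0 : ℝ) < n := by exact_mod_cast hn
  have hc0 : 0 ≤ max a b := le_max_of_le_left ha
  have hca : a < n := by have := le_max_left a b; linarith [hn', hcn]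
  have hcb : b < n := by have := le_max_right a b; linarith [hn', hcn]
  set y' := swapOn D j j' y with hy'
  have hR : (∏ e : VPair n, if Crosses D e then 1 else bm (ep n a b y') e (g e)) =
      ∏ e : VPair n, if Crosses D e then 1 else bm (ep n a b y) e (g e) := by
    refine Finset.prod_congr rfl fun e _ => ?_
    by_cases h : Crosses D e
    · simp [h]
    · simp only [h, if_false]
      have : ep n a b y' e = ep n a b y e := by
        unfold ep wt
        simp only [hy', swapOn]
        unfold Crosses at h
        by_cases h1 : e.1.1 ∈ D <;> by_cases h2 : e.1.2 ∈ D <;> simp [h1, h2] at h ⊢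
      unfold bm
      rw [this]
  rw [pw_ep_split a b g D y, pw_ep_split a b g D y', hR, crossNonedge_eq a b g D hca hcb hn,
    crossNonedge_eq a b g D hca hcb hn]
  have hR0 : 0 ≤ ∏ e : VPair n, if Crosses D e then 1 else bm (ep n a b y) e (g e) := by
    refine Finset.prod_nonneg fun e _ => ?_
    split_ifs
    · exact zero_le_one
    · exact (isP_ep ha hb (by linarith) y).1 e _
  have hE : ∀ z : Fin n → Fin k, 0 ≤ crossEdge n a b g D z := fun z =>
    Finset.prod_nonneg fun e _ => by
      split_ifs
      · exact ep_nonneg ha hb _ _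
      · exact zero_le_one
  set κ := Real.log (1 - a / n) - Real.log (1 - b / n) with hκ
  have hκ' : |κ| ≤ 2 * max a b / n := by
    have key : ∀ w : ℝ, 0 ≤ w → w ≤ max a b →
        -(2 * max a b / n) ≤ Real.log (1 - w / n) ∧ Real.log (1 - w / n) ≤ 0 := by
      intro w hw0 hw
      have h1 : w / n ≤ 1 / 2 := by rw [div_le_iff₀ hn']; linarith
      have h2 : 0 ≤ w / n := by positivity
      refine ⟨?_, Real.log_nonpos (by linarith) (by linarith)⟩
      have h3 := Real.one_sub_inv_le_log_of_pos (x := 1 - w / n) (by linarith)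
      have h4 : 1 - (1 - w / n)⁻¹ ≥ -(2 * (w / n)) := by
        have : (1 - w / n)⁻¹ ≤ 1 + 2 * (w / n) := by
          rw [inv_le_comm₀ (by linarith) (by linarith), inv_le_iff_one_le_mul₀ (by linarith)]
          nlinarith
        linarith
      have h5 : 2 * (w / n) ≤ 2 * max a b / n := by
        rw [mul_div_assoc]; gcongr
      linarith
    have h1 := key a ha (le_max_left _ _)
    have h2 := key b hb (le_max_right _ _)
    rw [abs_le]
    constructor <;> simp only [hκ] <;> linarith
  have hcnt' : ∀ s i, cntOut g D y' s i = cntOut g D y s i := by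
    intro s i
    refine Finset.sum_congr rfl fun t ht => ?_
    simp only [hy', swapOn, Finset.mem_compl.1 ht, if_false]
  have hX : -(D.card * (4 * δ * max a b / n)) +
      ∑ s ∈ D, ((∑ t ∈ Dᶜ, if gg g s t then 0 else Real.log (1 - b / n)) +
        cntOut g D y s (y s) * κ) ≤
      ∑ s ∈ D, ((∑ t ∈ Dᶜ, if gg g s t then 0 else Real.log (1 - b / n)) +
        cntOut g D y' s (y' s) * κ) := by
    rw [← nsmul_eq_mul, ← smul_neg, ← Finset.sum_const, ← Finset.sum_add_distrib]
    refine Finset.sum_le_sum fun s hs => ?_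
    rw [hcnt']
    have hd : |cntOut g D y s (y s) - cntOut g D y s (y' s)| ≤ 2 * δ := by
      simp only [hy', swapOn, hs, if_true]
      obtain ⟨h1, h2⟩ := hcnt s hs
      rw [abs_le] at h1 h2
      by_cases e1 : y s = j
      · rw [e1, Equiv.swap_apply_left, abs_le]; constructor <;> linarith
      · by_cases e2 : y s = j'
        · rw [e2, Equiv.swap_apply_right, abs_le]; constructor <;> linarith
        · rw [Equiv.swap_apply_of_ne_of_ne e1 e2, sub_self, abs_zero]; linarith
    have hm := mul_le_mul hd hκ' (abs_nonneg _) (by linarith)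
    rw [← abs_mul] at hm
    have := (abs_le.1 hm).2
    have e3 : 2 * δ * (2 * max a b / n) = 4 * δ * max a b / n := by ring
    rw [e3] at this
    linarith
  have hX' := Real.exp_le_exp.2 hX
  rw [Real.exp_add] at hX'
  have := mul_le_mul_of_nonneg_left hX' (mul_nonneg hR0 (mul_nonneg (hE y) (hE y')))
  refine le_trans (le_of_eq ?_) (this.trans (le_of_eq ?_)) <;> ring

end Posterior

section Local

variable {n k : ℕ}

lemma mg_eq_sum_update {ι α : Type*} [Fintype ι] [DecidableEq ι] [Fintype α] (L : (ι → α) → ℝ)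
    {B : Finset ι} {v : ι} (hv : v ∉ B) (x : ι → α) :
    mg L B x = ∑ j, mg L (insert v B) (Function.update x v j) := by
  unfold mg
  rw [Finset.sum_comm]
  refine Finset.sum_congr rfl fun y _ => ?_
  rw [Finset.sum_eq_single (y v)]
  · have : (∀ i ∈ insert v B, y i = Function.update x v (y v) i) ↔ ∀ i ∈ B, y i = x i := by
      rw [Finset.forall_mem_insert, Function.update_self]
      simp only [true_and]
      exact forall₂_congr fun i hi => by rw [Function.update_of_ne (ne_of_mem_of_not_mem hi hv)]
    simp only [this]
  · intro j _ hj
    rw [if_neg]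
    intro h
    have := h v (Finset.mem_insert_self _ _)
    rw [Function.update_self] at this
    exact hj this.symm
  · simp

/-- The likelihood of a labelling, given the graph. -/
noncomputable def lik (n : ℕ) {k : ℕ} (a b : ℝ) (g : VPair n → Bool) (x : Fin n → Fin k) : ℝ :=
  pw (bm (ep n a b x)) g

lemma lik_nonneg {a b : ℝ} (ha : 0 ≤ a) (hb : 0 ≤ b) (hn : max a b ≤ n) (g : VPair n → Bool)
    (x : Fin n → Fin k) : 0 ≤ lik n a b g x := pw_nonneg (isP_ep ha hb hn x).1 _

lemma crossEdge_congr (a b : ℝ) {g : VPair n → Bool} {D : Finset (Fin n)} {v : Fin n}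
    (hD : ∀ s ∈ D, ∀ t ∉ D, gg g s t → s = v) {x y : Fin n → Fin k}
    (hxy : ∀ t ∉ D, y t = x t) (hv : y v = x v) :
    crossEdge n a b g D y = crossEdge n a b g D x := by
  unfold crossEdge
  refine Finset.prod_congr rfl fun e _ => ?_
  by_cases h : Crosses D e ∧ g e = true
  · rw [if_pos h, if_pos h]
    have hg := (gg_pair g e).2 h.2
    unfold ep
    rcases h.1 with ⟨h1, h2⟩ | ⟨h1, h2⟩
    · have := hD _ h1 _ h2 hg
      rw [hxy _ h2, this, hv]
    · have := hD _ h2 _ h1 ((gg_comm _ _ _).1 hg)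
      rw [hxy _ h1, this, hv]
  · rw [if_neg h, if_neg h]

theorem swap_mass {a b : ℝ} (ha : 0 ≤ a) (hb : 0 ≤ b) (g : VPair n → Bool)
    (D : Finset (Fin n)) {v : Fin n} (hv : v ∈ D) (hD : ∀ s ∈ D, ∀ t ∉ D, gg g s t → s = v)
    (hcn : 2 * max a b ≤ n) (hn : 0 < n) (x : Fin n → Fin k)
    (j j' : Fin k) (m δ : ℝ) (hδ : 0 ≤ δ)
    (hcnt : ∀ s ∈ D, |cntOut g D x s j - m| ≤ δ ∧ |cntOut g D x s j' - m| ≤ δ) :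
    Real.exp (-(D.card * (4 * δ * max a b / n))) *
      (mg (lik n a b g) (insert v Dᶜ) (Function.update x v j) *
        crossEdge n a b g D (Function.update x v j')) ≤
      mg (lik n a b g) (insert v Dᶜ) (Function.update x v j') *
        crossEdge n a b g D (Function.update x v j) := by
  have hiff : ∀ (i : Fin k) (y : Fin n → Fin k),
      (∀ t ∈ insert v Dᶜ, y t = Function.update x v i t) ↔ (∀ t ∉ D, y t = x t) ∧ y v = i := by
    intro i y
    rw [Finset.forall_mem_insert, Function.update_self, and_comm]
    refine and_congr_left fun _ => ?_
    simp only [Finset.mem_compl]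
    exact forall₂_congr fun t ht => by rw [Function.update_of_ne (ne_of_mem_of_not_mem hv ht).symm]
  have e1 : mg (lik n a b g) (insert v Dᶜ) (Function.update x v j') =
      ∑ y, if (∀ t ∉ D, y t = x t) ∧ y v = j then lik n a b g (swapOn D j j' y) else 0 := by
    unfold mg
    have hbij : Function.Bijective (swapOn (n := n) D j j') :=
      Function.Involutive.bijective fun y => swapOn_swapOn D j j' y
    rw [← hbij.sum_comp]
    refine Finset.sum_congr rfl fun y _ => ?_
    simp only [hiff]
    have : ((∀ t ∉ D, swapOn D j j' y t = x t) ∧ swapOn D j j' y v = j') ↔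
        ((∀ t ∉ D, y t = x t) ∧ y v = j) := by
      refine and_congr (forall₂_congr fun t ht => by simp [swapOn, ht]) ?_
      simp only [swapOn, hv, if_true]
      rw [Equiv.swap_apply_eq_iff, Equiv.swap_apply_right]
    simp only [this]
  rw [e1]
  unfold mg
  simp only [hiff]
  rw [Finset.sum_mul, Finset.mul_sum, Finset.sum_mul]
  refine Finset.sum_le_sum fun y _ => ?_
  by_cases h : (∀ t ∉ D, y t = x t) ∧ y v = j
  · rw [if_pos h, if_pos h]
    have hu : ∀ i, ∀ t ∉ D, Function.update x v i t = x t := fun i t ht =>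
      Function.update_of_ne (ne_of_mem_of_not_mem hv ht).symm _ _
    have h1 : crossEdge n a b g D (Function.update x v j) = crossEdge n a b g D y :=
      crossEdge_congr a b hD (fun t ht => by rw [hu j t ht, h.1 t ht])
        (by rw [Function.update_self, h.2])
    have h2 : crossEdge n a b g D (Function.update x v j') =
        crossEdge n a b g D (swapOn D j j' y) :=
      crossEdge_congr a b hD (fun t ht => by rw [hu j' t ht]; simp [swapOn, ht, h.1 t ht])
        (by simp [swapOn, hv, h.2])
    rw [h1, h2]
    refine swap_likelihood a b ha hb g D hcn hn y j j' m δ hδ fun s hs => ?_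
    have h3 : ∀ i, cntOut g D y s i = cntOut g D x s i := fun i =>
      Finset.sum_congr rfl fun t ht => by rw [h.1 t (Finset.mem_compl.1 ht)]
    rw [h3, h3]
    exact hcnt s hs
  · simp [h]

/-- All label classes have size close to `n / k`. -/
def Bal (δ : ℝ) (x : Fin n → Fin k) : Prop :=
  ∀ i, |(∑ t, if x t = i then (1 : ℝ) else 0) - n / k| ≤ δ * n

/-- All label classes outside of `D` have size close to `n / k`. -/
def BalOut (δ : ℝ) (D : Finset (Fin n)) (x : Fin n → Fin k) : Prop :=
  ∀ i, |(∑ t ∈ Dᶜ, if x t = i then (1 : ℝ) else 0) - n / k| ≤ 2 * δ * n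

lemma Bal.out {δ : ℝ} {x : Fin n → Fin k} (h : Bal δ x) {D : Finset (Fin n)}
    (hD : (D.card : ℝ) ≤ δ * n) : BalOut δ D x := by
  intro i
  have h1 := h i
  rw [← Finset.sum_add_sum_compl D] at h1
  have h2 : 0 ≤ ∑ t ∈ D, (if x t = i then (1 : ℝ) else 0) :=
    Finset.sum_nonneg fun t _ => by split_ifs <;> norm_num
  have h3 : ∑ t ∈ D, (if x t = i then (1 : ℝ) else 0) ≤ D.card := by
    refine (Finset.sum_le_sum (g := fun _ => (1 : ℝ)) fun t _ => ?_).trans (by simp)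
    split_ifs <;> norm_num
  rw [abs_le] at h1 ⊢
  constructor <;> linarith

lemma abs_cntOut_sub_le {δ r : ℝ} {x : Fin n → Fin k} {D : Finset (Fin n)} {g : VPair n → Bool}
    {s : Fin n} {i : Fin k} (h : BalOut δ D x)
    (hr : (∑ t ∈ Dᶜ, if x t = i ∧ gg g s t then (1 : ℝ) else 0) ≤ r) :
    |cntOut g D x s i - n / k| ≤ 2 * δ * n + r := by
  have h1 := h i
  have h2 : ∑ t ∈ Dᶜ, (if x t = i then (1 : ℝ) else 0) =
      cntOut g D x s i + ∑ t ∈ Dᶜ, if x t = i ∧ gg g s t then (1 : ℝ) else 0 := by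
    unfold cntOut
    rw [← Finset.sum_add_distrib]
    refine Finset.sum_congr rfl fun t _ => ?_
    by_cases h1 : x t = i <;> by_cases h2 : gg g s t <;> simp [h1, h2]
  have h3 : 0 ≤ ∑ t ∈ Dᶜ, (if x t = i ∧ gg g s t then (1 : ℝ) else 0) :=
    Finset.sum_nonneg fun t _ => by split_ifs <;> norm_num
  rw [h2] at h1
  rw [abs_le] at h1 ⊢
  constructor <;> linarith

section Cent

variable {ι α : Type*} [Fintype ι] [DecidableEq ι] [Fintype α] {L : (ι → α) → ℝ}

lemma neg_log_ratio_nonneg (hL : ∀ x, 0 ≤ L x) (v : ι) (B : Finset ι) (x : ι → α) :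
    0 ≤ -Real.log (mg L (insert v B) x / mg L B x) := by
  rw [neg_nonneg]
  exact Real.log_nonpos (div_nonneg (mg_nonneg hL _ _) (mg_nonneg hL _ _))
    (div_le_one_of_le₀ (mg_anti hL (Finset.subset_insert _ _) x) (mg_nonneg hL _ _))

lemma cent_nonneg (hL : ∀ x, 0 ≤ L x) (v : ι) (B : Finset ι) : 0 ≤ cent L v B :=
  Finset.sum_nonneg fun x _ => mul_nonneg (hL x) (neg_log_ratio_nonneg hL v B x)

lemma le_neg_log_ratio {v : ι} {B : Finset ι} {x : ι → α} {K ε : ℝ} (hL : ∀ x, 0 ≤ L x)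
    (hx : 0 < L x) (hK : 0 < K)
    (h : Real.exp (-ε) * mg L (insert v B) x * K ≤ mg L B x) :
    Real.log K - ε ≤ -Real.log (mg L (insert v B) x / mg L B x) := by
  have p : ∀ C, 0 < mg L C x := fun C => hx.trans_le (le_mg hL C x)
  have := Real.log_le_log (mul_pos (mul_pos (Real.exp_pos _) (p _)) hK) h
  rw [Real.log_mul (mul_pos (Real.exp_pos _) (p _)).ne' hK.ne',
    Real.log_mul (Real.exp_pos _).ne' (p _).ne', Real.log_exp] at this
  rw [Real.log_div (p _).ne' (p _).ne']
  linarith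

lemma le_cent_of_pointwise (hL : ∀ x, 0 ≤ L x) (v : ι) (B : Finset ι) (P : (ι → α) → Prop)
    [DecidablePred P] (κ : ℝ)
    (h : ∀ x, 0 < L x → P x → κ ≤ -Real.log (mg L (insert v B) x / mg L B x)) :
    ∑ x, L x * (if P x then κ else 0) ≤ cent L v B := by
  refine Finset.sum_le_sum fun x _ => ?_
  rcases (hL x).eq_or_lt with h0 | h0
  · simp [← h0]
  refine mul_le_mul_of_nonneg_left ?_ h0.le
  split_ifs with hP
  · exact h x h0 hP
  · exact neg_log_ratio_nonneg hL v B x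

/-- Averaging over the fibres of the restriction to `B`. -/
lemma sum_mul_eq_sum_fiber (hL : ∀ x, 0 ≤ L x) (B : Finset ι) (ψ : (ι → α) → ℝ) :
    ∑ x, L x * ψ x =
      ∑ x, L x / mg L B x * ∑ y, if ∀ i ∈ B, y i = x i then L y * ψ y else 0 := by
  simp only [Finset.mul_sum]
  rw [Finset.sum_comm]
  refine Finset.sum_congr rfl fun y _ => ?_
  have : ∀ x, L x / mg L B x * (if ∀ i ∈ B, y i = x i then L y * ψ y else 0) =
      (if ∀ i ∈ B, x i = y i then L x else 0) * (L y * ψ y / mg L B y) := by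
    intro x
    by_cases h : ∀ i ∈ B, y i = x i
    · rw [if_pos h, if_pos fun i hi => (h i hi).symm, mg_congr h]
      ring
    · rw [if_neg h, if_neg fun h' => h fun i hi => (h' i hi).symm]
      ring
  simp only [this]
  rw [← Finset.sum_mul]
  change _ = mg L B y * _
  rcases (hL y).eq_or_lt with h0 | h0
  · simp [← h0]
  · have := h0.trans_le (le_mg hL B y)
    field_simp

end Cent

section Bounds

variable {a b : ℝ} {g : VPair n → Bool} {D : Finset (Fin n)} {v : Fin n} {δ ε : ℝ}

theorem root_cent (hk : 0 < k) (ha : 0 ≤ a) (hb : 0 ≤ b) (hcn : 2 * max a b ≤ n) (hn : 0 < n)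
    (hδ : 0 ≤ δ) (hv : v ∈ D) (hD : ∀ s ∈ D, ∀ t ∉ D, ¬ gg g s t) (hDc : (D.card : ℝ) ≤ δ * n)
    (hε : D.card * (4 * (2 * δ * n + 1) * max a b / n) ≤ ε) :
    ∑ x : Fin n → Fin k, lik n a b g x * (if Bal δ x then Real.log k - ε else 0) ≤
      cent (lik n (k := k) a b g) v Dᶜ := by
  have hL : ∀ x : Fin n → Fin k, 0 ≤ lik n a b g x :=
    lik_nonneg ha hb (by have := le_max_of_le_left (c := b) ha; linarith) g
  refine le_cent_of_pointwise hL v _ _ _ fun x hx hbal => ?_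
  have hE : ∀ z : Fin n → Fin k, crossEdge n a b g D z = 1 := by
    intro z
    refine Finset.prod_eq_one fun e _ => if_neg ?_
    rintro ⟨h1 | h1, h2⟩
    · exact hD _ h1.1 _ h1.2 ((gg_pair g e).2 h2)
    · exact hD _ h1.2 _ h1.1 ((gg_comm _ _ _).1 ((gg_pair g e).2 h2))
  have hcnt : ∀ s ∈ D, ∀ i, |cntOut g D x s i - n / k| ≤ 2 * δ * n + 1 := fun s hs i =>
    abs_cntOut_sub_le (hbal.out hDc) (by
      rw [Finset.sum_eq_zero]
      · exact zero_le_one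
      · intro t ht
        rw [if_neg]
        exact fun h => hD s hs t (Finset.mem_compl.1 ht) h.2)
  refine le_neg_log_ratio hL hx (by positivity) ?_
  rw [mg_eq_sum_update (lik n a b g) (B := Dᶜ) (by simpa using hv) x]
  rw [mul_comm, ← nsmul_eq_mul]
  have hc : k = (Finset.univ : Finset (Fin k)).card := by simp
  nth_rewrite 1 [hc]
  rw [← Finset.sum_const]
  refine Finset.sum_le_sum fun j' _ => ?_
  have h := swap_mass ha hb g D hv (fun s hs t ht h => absurd h (hD s hs t ht)) hcn hn x (x v) j'
    (n / k) (2 * δ * n + 1) (by positivity) fun s hs => ⟨hcnt s hs _, hcnt s hs _⟩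
  rw [hE, hE, mul_one, mul_one, Function.update_eq_self] at h
  refine le_trans (mul_le_mul_of_nonneg_right (Real.exp_le_exp.2 (neg_le_neg hε))
    (mg_nonneg hL _ _)) h

/-- The vertex `v` has no neighbour with its own label, nor with some other label. -/
def Free (g : VPair n → Bool) (x : Fin n → Fin k) (v : Fin n) : Prop :=
  (∀ t, gg g v t → x t ≠ x v) ∧ ∃ j ≠ x v, ∀ t, gg g v t → x t ≠ j

theorem free_cent (ha : 0 ≤ a) (hb : 0 ≤ b) (hcn : 2 * max a b ≤ n) (hn : 0 < n)
    (hδ : 0 ≤ δ) (hDc : 1 ≤ δ * n)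
    (hε : 4 * (2 * δ * n + 1) * max a b / n ≤ ε) :
    ∑ x : Fin n → Fin k, lik n a b g x *
      (if Bal δ x ∧ Free g x v then Real.log 2 - ε else 0) ≤
        cent (lik n (k := k) a b g) v {v}ᶜ := by
  have hL : ∀ x : Fin n → Fin k, 0 ≤ lik n a b g x :=
    lik_nonneg ha hb (by have := le_max_of_le_left (c := b) ha; linarith) g
  have hc0 : 0 ≤ max a b := le_max_of_le_left ha
  have hε0 : 0 ≤ ε := le_trans (by positivity) hε
  refine le_cent_of_pointwise hL v _ _ _ fun x hx hbal => ?_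
  obtain ⟨hbal, h0, j', hj', h1⟩ := hbal
  refine le_neg_log_ratio hL hx (by positivity) ?_
  rw [mg_eq_sum_update (lik n a b g) (B := {v}ᶜ) (v := v) (by simp) x]
  have hsub : ∑ j ∈ {x v, j'}, mg (lik n a b g) (insert v {v}ᶜ) (Function.update x v j) ≤
      ∑ j, mg (lik n a b g) (insert v {v}ᶜ) (Function.update x v j) :=
    Finset.sum_le_sum_of_subset_of_nonneg (Finset.subset_univ _) fun j _ _ => mg_nonneg hL _ _
  refine le_trans ?_ hsub
  rw [Finset.sum_pair hj'.symm, Function.update_eq_self]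
  have hb' : BalOut δ {v} x := hbal.out (by simpa using hDc)
  have hcnt : ∀ i, (∀ t, gg g v t → x t ≠ i) → |cntOut g {v} x v i - n / k| ≤ 2 * δ * n + 1 :=
    fun i hi => abs_cntOut_sub_le hb' (by
      rw [Finset.sum_eq_zero]
      · exact zero_le_one
      · intro t ht
        rw [if_neg]
        exact fun h => hi t h.2 h.1)
  have h := swap_mass ha hb g {v} (Finset.mem_singleton_self v)
    (fun s hs t ht h => Finset.mem_singleton.1 hs) hcn hn x (x v) j'
    (n / k) (2 * δ * n + 1) (by positivity) fun s hs => by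
      rw [Finset.mem_singleton.1 hs]; exact ⟨hcnt _ h0, hcnt _ h1⟩
  rw [Function.update_eq_self] at h
  have hE : crossEdge n a b g {v} (Function.update x v j') = crossEdge n a b g {v} x := by
    unfold crossEdge
    refine Finset.prod_congr rfl fun e _ => ?_
    by_cases h : Crosses {v} e ∧ g e = true
    · rw [if_pos h, if_pos h]
      have hg := (gg_pair g e).2 h.2
      unfold ep wt
      rcases h.1 with ⟨h3, h2⟩ | ⟨h3, h2⟩
      · simp only [Finset.mem_singleton] at h2 h3
        rw [h3, Function.update_self, Function.update_of_ne h2]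
        rw [h3] at hg
        rw [if_neg (h1 _ hg).symm, if_neg (h0 _ hg).symm]
      · simp only [Finset.mem_singleton] at h2 h3
        rw [h2, Function.update_self, Function.update_of_ne h3]
        rw [h2, gg_comm] at hg
        rw [if_neg (h1 _ hg), if_neg (h0 _ hg)]
    · rw [if_neg h, if_neg h]
  have hE0 : 0 < crossEdge n a b g {v} x := by
    have hx' := hx
    unfold lik at hx'
    rw [pw_ep_split a b g {v} x] at hx'
    have hnn : 0 ≤ crossEdge n a b g {v} x := Finset.prod_nonneg fun e _ => by
      split_ifs
      · exact ep_nonneg ha hb _ _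
      · exact zero_le_one
    rcases hnn.eq_or_lt with h0 | h0
    · rw [← h0] at hx'; simp at hx'
    · exact h0
  rw [hE, ← mul_assoc] at h
  have h2 := le_of_mul_le_mul_right h hE0
  rw [Finset.card_singleton, Nat.cast_one, one_mul] at h2
  have h3 : Real.exp (-ε) * mg (lik n a b g) (insert v {v}ᶜ) x ≤
      Real.exp (-(4 * (2 * δ * n + 1) * max a b / n)) * mg (lik n a b g) (insert v {v}ᶜ) x :=
    mul_le_mul_of_nonneg_right (Real.exp_le_exp.2 (neg_le_neg hε)) (mg_nonneg hL _ _)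
  have h4 : Real.exp (-ε) * mg (lik n a b g) (insert v {v}ᶜ) x ≤
      1 * mg (lik n a b g) (insert v {v}ᶜ) x :=
    mul_le_mul_of_nonneg_right (Real.exp_le_one_iff.2 (neg_nonpos.2 hε0)) (mg_nonneg hL _ _)
  linarith

end Bounds
end Local

lemma sum_fiber_eq {ι α : Type*} [Fintype ι] [DecidableEq ι] [Fintype α] {L : (ι → α) → ℝ}
    {B : Finset ι} {v : ι} (hv : v ∉ B) (x : ι → α) {ψ : (ι → α) → ℝ} {φ : α → ℝ}
    (h : ∀ y, (∀ i ∈ B, y i = x i) → ψ y = φ (y v)) :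
    (∑ y, if ∀ i ∈ B, y i = x i then L y * ψ y else 0) =
      ∑ j, mg L (insert v B) (Function.update x v j) * φ j := by
  unfold mg
  simp only [Finset.sum_mul]
  rw [Finset.sum_comm]
  refine Finset.sum_congr rfl fun y _ => ?_
  have hiff : ∀ j, (∀ i ∈ insert v B, y i = Function.update x v j i) ↔
      (∀ i ∈ B, y i = x i) ∧ y v = j := by
    intro j
    rw [Finset.forall_mem_insert, Function.update_self, and_comm]
    refine and_congr_left fun _ => ?_
    exact forall₂_congr fun t ht => by
      rw [Function.update_of_ne (ne_of_mem_of_not_mem ht hv)]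
  simp only [hiff]
  rw [Finset.sum_eq_single (y v)]
  · by_cases hy : ∀ i ∈ B, y i = x i
    · rw [if_pos hy, if_pos ⟨hy, rfl⟩, h y hy]
    · rw [if_neg hy, if_neg fun h => hy h.1, zero_mul]
  · intro j _ hj
    rw [if_neg fun h => hj h.2.symm, zero_mul]
  · simp

section Hanging

variable {n k : ℕ} {a b d : ℝ} {g : VPair n → Bool} {D : Finset (Fin n)} {v w : Fin n} {δ ε : ℝ}

/-- The entropy of the label of a vertex, given the label of a neighbour. -/
noncomputable def edgeEnt (k : ℕ) (a b d : ℝ) : ℝ :=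
  a / (k * d) * -Real.log (a / (k * d)) + ((k : ℝ) - 1) * (b / (k * d) * -Real.log (b / (k * d)))

lemma sum_wt_comp (φ : ℝ → ℝ) (a b : ℝ) (i : Fin k) :
    ∑ j, φ (wt a b j i) = φ a + ((k : ℝ) - 1) * φ b := by
  have h : ∀ j, φ (wt a b j i) = φ b + if j = i then φ a - φ b else 0 := by
    intro j; unfold wt; split_ifs <;> ring
  simp only [h, Finset.sum_add_distrib, Finset.sum_ite_eq', Finset.mem_univ, if_true,
    Finset.sum_const, Finset.card_univ, Fintype.card_fin, nsmul_eq_mul]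
  ring

lemma crossEdge_single (x : Fin n → Fin k) (hv : v ∈ D) (hw : w ∉ D) (hvw : gg g v w)
    (hD : ∀ s ∈ D, ∀ t ∉ D, gg g s t → s = v ∧ t = w) :
    crossEdge n a b g D x = wt a b (x v) (x w) / n := by
  obtain ⟨e₀, h0, h1⟩ := hvw
  unfold crossEdge
  rw [Finset.prod_eq_single e₀]
  · rcases h1 with ⟨h1, h2⟩ | ⟨h1, h2⟩
    · rw [if_pos ⟨Or.inl ⟨h1 ▸ hv, h2 ▸ hw⟩, h0⟩]
      unfold ep
      rw [h1, h2]
    · rw [if_pos ⟨Or.inr ⟨h1 ▸ hw, h2 ▸ hv⟩, h0⟩]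
      unfold ep wt
      rw [h1, h2]
      simp only [eq_comm (a := x w)]
  · intro e _ he
    refine if_neg ?_
    rintro ⟨h2, h3⟩
    have hg := (gg_pair g e).2 h3
    apply he
    have key : (e.1.1 = v ∧ e.1.2 = w) ∨ (e.1.1 = w ∧ e.1.2 = v) := by
      rcases h2 with ⟨h4, h5⟩ | ⟨h4, h5⟩
      · exact Or.inl (hD _ h4 _ h5 hg)
      · exact Or.inr (hD _ h5 _ h4 ((gg_comm _ _ _).1 hg)).symm
    have l1 := e.2
    have l2 := e₀.2
    rcases key with ⟨h4, h5⟩ | ⟨h4, h5⟩ <;> rcases h1 with ⟨h6, h7⟩ | ⟨h6, h7⟩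
    · exact Subtype.ext (Prod.ext (h4.trans h6.symm) (h5.trans h7.symm))
    · rw [h4, h5] at l1; rw [h6, h7] at l2; exact absurd l1 (not_lt.2 l2.le)
    · rw [h4, h5] at l1; rw [h6, h7] at l2; exact absurd l1 (not_lt.2 l2.le)
    · exact Subtype.ext (Prod.ext (h4.trans h6.symm) (h5.trans h7.symm))
  · simp

lemma hang_mass (ha : 0 ≤ a) (hb : 0 ≤ b) (hcn : 2 * max a b ≤ n) (hn : 0 < n)
    (hδ : 0 ≤ δ) (hv : v ∈ D) (hw : w ∉ D) (hvw : gg g v w)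
    (hD : ∀ s ∈ D, ∀ t ∉ D, gg g s t → s = v ∧ t = w)
    (hε : D.card * (4 * (2 * δ * n + 1) * max a b / n) ≤ ε) (x : Fin n → Fin k)
    (hbal : BalOut δ D x) (j j' : Fin k) :
    Real.exp (-ε) * (mg (lik n a b g) (insert v Dᶜ) (Function.update x v j) *
        wt a b j' (x w)) ≤
      mg (lik n a b g) (insert v Dᶜ) (Function.update x v j') * wt a b j (x w) := by
  have hn' : (0 : ℝ) < n := by exact_mod_cast hn
  have hL : ∀ x : Fin n → Fin k, 0 ≤ lik n a b g x :=
    lik_nonneg ha hb (by have := le_max_of_le_left (c := b) ha; linarith) g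
  have hcnt : ∀ s ∈ D, ∀ i, |cntOut g D x s i - n / k| ≤ 2 * δ * n + 1 := fun s hs i =>
    abs_cntOut_sub_le hbal (by
      refine (Finset.sum_le_sum (g := fun t => if t = w then (1 : ℝ) else 0)
        fun t ht => ?_).trans ?_
      · by_cases h : x t = i ∧ gg g s t
        · rw [if_pos h, if_pos (hD s hs t (Finset.mem_compl.1 ht) h.2).2]
        · rw [if_neg h]
          split_ifs <;> norm_num
      · rw [Finset.sum_ite_eq']
        split_ifs <;> norm_num)
  have h := swap_mass ha hb g D hv (fun s hs t ht h => (hD s hs t ht h).1) hcn hn x j j'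
    (n / k) (2 * δ * n + 1) (by positivity) fun s hs => ⟨hcnt s hs _, hcnt s hs _⟩
  have hne : w ≠ v := (ne_of_mem_of_not_mem hv hw).symm
  rw [crossEdge_single _ hv hw hvw hD, crossEdge_single _ hv hw hvw hD, Function.update_self,
    Function.update_self, Function.update_of_ne hne, Function.update_of_ne hne] at h
  have cancel : ∀ E X Y p q : ℝ, E * (X * (p / n)) ≤ Y * (q / n) → E * (X * p) ≤ Y * q := by
    intro E X Y p q h
    have h3 := mul_le_mul_of_nonneg_right h hn'.le
    have e1 : E * (X * (p / n)) * n = E * (X * p) := by field_simp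
    have e2 : Y * (q / n) * n = Y * q := by field_simp
    linarith
  have h2 := cancel _ _ _ _ _ h
  refine le_trans (mul_le_mul_of_nonneg_right (Real.exp_le_exp.2 (neg_le_neg hε))
    (mul_nonneg (mg_nonneg hL _ _) (wt_nonneg ha hb _ _))) h2

theorem hang_cent (hk : 0 < k) (ha : 0 ≤ a) (hb : 0 ≤ b)
    (hd : d = (a + ((k : ℝ) - 1) * b) / k) (hd0 : 0 < d)
    (hcn : 2 * max a b ≤ n) (hn : 0 < n)
    (hδ : 0 ≤ δ) (hv : v ∈ D) (hw : w ∉ D) (hvw : gg g v w)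
    (hD : ∀ s ∈ D, ∀ t ∉ D, gg g s t → s = v ∧ t = w) (hDc : (D.card : ℝ) ≤ δ * n)
    (hε : D.card * (4 * (2 * δ * n + 1) * max a b / n) ≤ ε) :
    ∑ x : Fin n → Fin k, lik n a b g x *
      (if Bal δ x then Real.exp (-ε) * edgeEnt k a b d - ε else 0) ≤
      cent (lik n (k := k) a b g) v Dᶜ := by
  have hk' : (0 : ℝ) < k := by exact_mod_cast hk
  have hL : ∀ x : Fin n → Fin k, 0 ≤ lik n a b g x :=
    lik_nonneg ha hb (by have := le_max_of_le_left (c := b) ha; linarith) g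
  have hkd : (k : ℝ) * d = a + ((k : ℝ) - 1) * b := by rw [hd]; field_simp
  have hkd0 : 0 < (k : ℝ) * d := by positivity
  set κ := Real.exp (-ε) * edgeEnt k a b d - ε with hκ
  rcases le_total κ 0 with hκ0 | hκ0
  · refine le_trans (Finset.sum_nonpos fun x _ => ?_) (cent_nonneg hL v Dᶜ)
    refine mul_nonpos_of_nonneg_of_nonpos (hL x) ?_
    split_ifs <;> simp [hκ0]
  set φ : Fin k → Fin k → ℝ := fun j i => -Real.log (wt a b j i / (k * d)) with hφ
  have hsumwt : ∀ i : Fin k, ∑ j, wt a b j i = k * d := by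
    intro i; rw [sum_wt_comp (fun t => t), hkd]
  have hwtle : ∀ j i : Fin k, wt a b j i ≤ k * d := by
    intro j i
    rw [← hsumwt i]
    exact Finset.single_le_sum (f := fun j => wt a b j i) (fun j _ => wt_nonneg ha hb _ _)
      (Finset.mem_univ j)
  have hφ0 : ∀ j i, 0 ≤ φ j i := fun j i => by
    simp only [hφ, neg_nonneg]
    exact Real.log_nonpos (div_nonneg (wt_nonneg ha hb _ _) hkd0.le)
      (div_le_one_of_le₀ (hwtle j i) hkd0.le)
  have hmg := fun x => mg_eq_sum_update (lik n (k := k) a b g) (B := Dᶜ) (v := v)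
    (by simpa using hv) x
  have hlow : ∀ x : Fin n → Fin k, BalOut δ D x → ∀ j,
      Real.exp (-ε) * mg (lik n a b g) Dᶜ x * wt a b j (x w) ≤
      mg (lik n a b g) (insert v Dᶜ) (Function.update x v j) * (k * d) := by
    intro x hx j
    rw [hmg x, ← hsumwt (x w), Finset.mul_sum, Finset.mul_sum, Finset.sum_mul]
    refine Finset.sum_le_sum fun i _ => ?_
    rw [mul_assoc]
    exact hang_mass ha hb hcn hn hδ hv hw hvw hD hε x hx i j
  have hup : ∀ x : Fin n → Fin k, BalOut δ D x → ∀ j, Real.exp (-ε) *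
      (mg (lik n a b g) (insert v Dᶜ) (Function.update x v j) * (k * d)) ≤
      mg (lik n a b g) Dᶜ x * wt a b j (x w) := by
    intro x hx j
    rw [hmg x, ← hsumwt (x w), Finset.mul_sum, Finset.mul_sum, Finset.sum_mul]
    exact Finset.sum_le_sum fun i _ => hang_mass ha hb hcn hn hδ hv hw hvw hD hε x hx j i
  have hpt : ∀ x : Fin n → Fin k, 0 < lik n a b g x → BalOut δ D x → φ (x v) (x w) - ε ≤
      -Real.log (mg (lik n a b g) (insert v Dᶜ) x / mg (lik n a b g) Dᶜ x) := by
    intro x hx hbal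
    have p : ∀ C, 0 < mg (lik n a b g) C x := fun C => hx.trans_le (le_mg hL C x)
    have h := hup x hbal (x v)
    rw [Function.update_eq_self] at h
    have hwpos : 0 < wt a b (x v) (x w) := by
      have : 0 < mg (lik n a b g) Dᶜ x * wt a b (x v) (x w) :=
        lt_of_lt_of_le (mul_pos (Real.exp_pos _) (mul_pos (p _) hkd0)) h
      exact pos_of_mul_pos_right this (p _).le
    have h2 := le_neg_log_ratio (v := v) (B := Dᶜ) (K := (k * d) / wt a b (x v) (x w)) (ε := ε)
      hL hx (div_pos hkd0 hwpos) (by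
        rw [← mul_div_assoc, div_le_iff₀ hwpos]
        linarith)
    refine le_trans (le_of_eq ?_) h2
    simp only [hφ]
    rw [← Real.log_inv, inv_div]
  have htower : ∑ x : Fin n → Fin k, lik n a b g x *
      (if BalOut δ D x then Real.exp (-ε) * edgeEnt k a b d else 0) ≤
      ∑ x : Fin n → Fin k, lik n a b g x * (if BalOut δ D x then φ (x v) (x w) else 0) := by
    rw [sum_mul_eq_sum_fiber hL Dᶜ (fun x => if BalOut δ D x then φ (x v) (x w) else 0)]
    refine Finset.sum_le_sum fun x _ => ?_
    rcases (hL x).eq_or_lt with h0 | h0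
    · simp [← h0]
    have p : ∀ C, 0 < mg (lik n a b g) C x := fun C => h0.trans_le (le_mg hL C x)
    rw [div_mul_eq_mul_div, mul_div_assoc]
    refine mul_le_mul_of_nonneg_left ?_ h0.le
    rw [le_div_iff₀ (p _)]
    by_cases hbal : BalOut δ D x
    · rw [if_pos hbal]
      rw [sum_fiber_eq (φ := fun j => φ j (x w)) (v := v) (by simpa using hv) x (by
        intro y hy
        have hby : BalOut δ D y := by
          intro i
          have e : ∀ t ∈ Dᶜ, (if y t = i then (1 : ℝ) else 0) = if x t = i then 1 else 0 :=
            fun t ht => by rw [hy t ht]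
          rw [Finset.sum_congr rfl e]
          exact hbal i
        rw [if_pos hby, hy w (Finset.mem_compl.2 hw)])]
      have e2 : edgeEnt k a b d = ∑ j, wt a b j (x w) / (k * d) * φ j (x w) := by
        simp only [hφ]
        rw [sum_wt_comp (fun t => t / (k * d) * -Real.log (t / (k * d)))]
        rfl
      rw [e2, Finset.mul_sum, Finset.sum_mul]
      refine Finset.sum_le_sum fun j _ => ?_
      have h := hlow x hbal j
      have h2 : Real.exp (-ε) * mg (lik n a b g) Dᶜ x * wt a b j (x w) / (k * d) ≤
          mg (lik n a b g) (insert v Dᶜ) (Function.update x v j) := by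
        rwa [div_le_iff₀ hkd0]
      refine le_trans (le_of_eq ?_) (mul_le_mul_of_nonneg_right h2 (hφ0 j (x w)))
      ring
    · rw [if_neg hbal, zero_mul]
      refine Finset.sum_nonneg fun y _ => ?_
      split_ifs <;> first | exact mul_nonneg (hL y) (hφ0 _ _) | simp
  have h1 : ∑ x : Fin n → Fin k, lik n a b g x * (if BalOut δ D x then φ (x v) (x w) - ε else 0) ≤
      cent (lik n (k := k) a b g) v Dᶜ := by
    refine Finset.sum_le_sum fun x _ => ?_
    rcases (hL x).eq_or_lt with h0 | h0
    · simp [← h0]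
    refine mul_le_mul_of_nonneg_left ?_ h0.le
    split_ifs with hP
    · exact hpt x h0 hP
    · exact neg_log_ratio_nonneg hL v _ x
  refine le_trans ?_ h1
  have h2 : ∑ x : Fin n → Fin k, lik n a b g x * (if Bal δ x then κ else 0) ≤
      ∑ x : Fin n → Fin k, lik n a b g x * (if BalOut δ D x then κ else 0) := by
    refine Finset.sum_le_sum fun x _ => mul_le_mul_of_nonneg_left ?_ (hL x)
    by_cases hx : Bal δ x
    · rw [if_pos hx, if_pos (hx.out hDc)]
    · rw [if_neg hx]
      split_ifs <;> simp [hκ0]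
  refine h2.trans ?_
  have e3 : ∀ (x : Fin n → Fin k) (s : ℝ), lik n a b g x * (if BalOut δ D x then s - ε else 0) =
      lik n a b g x * (if BalOut δ D x then s else 0) -
      lik n a b g x * (if BalOut δ D x then ε else 0) := by
    intro x s; split_ifs <;> ring
  simp only [hκ, e3, Finset.sum_sub_distrib]
  linarith

end Hanging

section Balanced

variable {n k : ℕ}

lemma bal_prob (hk : 0 < k) (hn : 0 < n) {δ : ℝ} (hδ : 0 < δ) :
    1 - k / (δ ^ 2 * n) ≤ pE (um n k) fun x => if Bal δ x then 1 else 0 := by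
  have hn' : (0 : ℝ) < n := by exact_mod_cast hn
  have hum := isP_um (n := n) hk
  have hmean : ∀ i : Fin k, pE (um n k) (fun x => ∑ t, if x t = i then (1 : ℝ) else 0) = n / k := by
    intro i
    rw [pE_sum]
    have : ∀ t : Fin n, pE (um n k) (fun x => if x t = i then (1 : ℝ) else 0) = 1 / k := by
      intro t
      rw [pE_single hum t (fun j => if j = i then (1 : ℝ) else 0)]
      simp [um]
    rw [Finset.sum_congr rfl fun t _ => this t]
    simp [div_eq_mul_inv]
  have hcheb : ∀ i : Fin k, pE (um n k) (fun x =>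
      if δ * n ≤ |(∑ t, if x t = i then (1 : ℝ) else 0) - n / k| then 1 else 0) ≤
      1 / (δ ^ 2 * n) := by
    intro i
    have hv := efron_stein hum (fun x => ∑ t, if x t = i then (1 : ℝ) else 0) (fun _ => 1)
      (fun _ => 1) (fun _ => ⟨0, hk⟩) (fun _ => zero_le_one) (by
        intro u x j j'
        rw [← Finset.sum_sub_distrib, Finset.sum_eq_single u]
        · simp only [Function.update_self]
          split_ifs <;> norm_num
        · intro t _ ht
          rw [Function.update_of_ne ht, Function.update_of_ne ht, sub_self]
        · simp) (fun u => by
          have : 0 ≤ um n k u ⟨0, hk⟩ := hum.1 _ _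
          simpa using this)
    rw [hmean] at hv
    refine (pE_chebyshev hum _ _ _ (δ * n) (by positivity) hv).trans (le_of_eq ?_)
    simp
    field_simp
  have hpt : ∀ x : Fin n → Fin k, 1 - ∑ i : Fin k,
      (if δ * n ≤ |(∑ t, if x t = i then (1 : ℝ) else 0) - n / k| then (1 : ℝ) else 0) ≤
      if Bal δ x then 1 else 0 := by
    intro x
    split_ifs with h
    · have : 0 ≤ ∑ i : Fin k,
        (if δ * n ≤ |(∑ t, if x t = i then (1 : ℝ) else 0) - n / k| then (1 : ℝ) else 0) :=
        Finset.sum_nonneg fun i _ => by split_ifs <;> norm_num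
      linarith
    · unfold Bal at h
      push Not at h
      obtain ⟨i, hi⟩ := h
      have := Finset.single_le_sum (f := fun i : Fin k =>
        (if δ * n ≤ |(∑ t, if x t = i then (1 : ℝ) else 0) - n / k| then (1 : ℝ) else 0))
        (fun i _ => by split_ifs <;> norm_num) (Finset.mem_univ i)
      rw [if_pos hi.le] at this
      linarith
  refine le_trans ?_ (pE_mono hum.1 hpt)
  rw [pE_sub, pE_const hum, pE_sum]
  have := Finset.sum_le_sum fun i (_ : i ∈ (Finset.univ : Finset (Fin k))) => hcheb i
  rw [Finset.sum_const, Finset.card_univ, Fintype.card_fin, nsmul_eq_mul, mul_one_div] at this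
  linarith

lemma sE_eq (a b : ℝ) (f : (Fin n → Fin k) → (VPair n → Bool) → ℝ) :
    sE n a b f = (1 / (k : ℝ)) ^ n * ∑ g, ∑ x, lik n a b g x * f x g := by
  unfold sE pE
  simp only [pw_um, ← Finset.mul_sum]
  rw [Finset.sum_comm]
  rfl

lemma entropy_ge {a b : ℝ} (T : (Fin n → Fin k) → (VPair n → Bool) → ℝ)
    (hT : ∀ g, ∑ x, lik n a b g x * T x g ≤
      ∑ x : Fin n → Fin k, lik n a b g x *
        -Real.log (lik n a b g x / ∑ y : Fin n → Fin k, lik n a b g y)) :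
    sE n a b T ≤ sE n a b fun (x : Fin n → Fin k) g => -Real.log (post n a b x g) := by
  rw [sE_eq, sE_eq]
  exact mul_le_mul_of_nonneg_left (Finset.sum_le_sum fun g _ => hT g) (by positivity)

end Balanced

section Disjoint

variable {ι α κ : Type*} [Fintype ι] [DecidableEq ι] [Fintype α] {m : ι → α → ℝ}

lemma pE_prod_of_disjoint (hm : IsP m) (S : κ → Finset ι) (f : κ → (ι → α) → ℝ)
    (hf : ∀ j ω ω', (∀ i ∈ S j, ω i = ω' i) → f j ω = f j ω') (T : Finset κ)
    (hS : ∀ j ∈ T, ∀ j' ∈ T, j ≠ j' → Disjoint (S j) (S j')) :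
    pE m (fun ω => ∏ j ∈ T, f j ω) = ∏ j ∈ T, pE m (f j) := by
  induction T using Finset.induction_on with
  | empty => simp [pE_const hm]
  | insert j T hj ih =>
    simp only [Finset.prod_insert hj]
    rw [pE_mul_of_disjoint hm (S j) (f j) (fun ω => ∏ i ∈ T, f i ω) (hf j), ih]
    · exact fun i hi i' hi' => hS i (Finset.mem_insert_of_mem hi) i' (Finset.mem_insert_of_mem hi')
    · intro ω ω' h
      refine Finset.prod_congr rfl fun i hi => hf i _ _ fun t ht => h t fun ht' => ?_
      exact Finset.disjoint_left.1 (hS j (Finset.mem_insert_self _ _) i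
        (Finset.mem_insert_of_mem hi) fun h => hj (h ▸ hi)) ht' ht

end Disjoint

section FreeCount

variable {n k : ℕ} {a b : ℝ}

/-- The pairs joining `v` to a vertex with label `i`. -/
noncomputable def starSet (x : Fin n → Fin k) (v : Fin n) (i : Fin k) : Finset (VPair n) :=
  Finset.univ.filter fun e => (e.1.1 = v ∧ x e.1.2 = i) ∨ (e.1.2 = v ∧ x e.1.1 = i)

lemma card_starSet_le (x : Fin n → Fin k) (v : Fin n) (i : Fin k) :
    ((starSet x v i).card : ℝ) ≤ ∑ t, if x t = i then (1 : ℝ) else 0 := by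
  have h := sum_sum_eq_two_mul_sum_vpair (n := n)
    (fun u w => if (u = v ∧ x w = i) ∨ (w = v ∧ x u = i) then (1 : ℝ) else 0) (by
      intro u w
      simp only [or_comm])
  have h1 : ((starSet x v i).card : ℝ) = ∑ e : VPair n,
      if (e.1.1 = v ∧ x e.1.2 = i) ∨ (e.1.2 = v ∧ x e.1.1 = i) then (1 : ℝ) else 0 := by
    simp [starSet, Finset.sum_boole]
  have h2 : ∑ u, ∑ w, (if (u = v ∧ x w = i) ∨ (w = v ∧ x u = i) then (1 : ℝ) else 0) ≤
      ∑ u, ∑ w, ((if u = v then if x w = i then (1 : ℝ) else 0 else 0) +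
        (if w = v then if x u = i then (1 : ℝ) else 0 else 0)) := by
    refine Finset.sum_le_sum fun u _ => Finset.sum_le_sum fun w _ => ?_
    by_cases c1 : u = v <;> by_cases c2 : x w = i <;> by_cases c3 : w = v <;>
      by_cases c4 : x u = i <;> simp [c1, c2, c3, c4] <;> split_ifs <;> norm_num
  have h3 : ∑ u, ∑ w, ((if u = v then if x w = i then (1 : ℝ) else 0 else 0) +
        (if w = v then if x u = i then (1 : ℝ) else 0 else 0)) =
      2 * ∑ t, if x t = i then (1 : ℝ) else 0 := by
    simp only [Finset.sum_add_distrib]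
    rw [Finset.sum_comm]
    simp only [Finset.sum_ite_eq', Finset.mem_univ, if_true]
    ring
  have h4 : 0 ≤ ∑ u, (if (u = v ∧ x u = i) ∨ (u = v ∧ x u = i) then (1 : ℝ) else 0) :=
    Finset.sum_nonneg fun u _ => by split_ifs <;> norm_num
  rw [h1]
  linarith

lemma ep_of_mem_starSet {x : Fin n → Fin k} {v : Fin n} {i : Fin k} {e : VPair n}
    (he : e ∈ starSet x v i) : ep n a b x e = wt a b (x v) i / n := by
  unfold ep
  rcases (Finset.mem_filter.1 he).2 with ⟨h1, h2⟩ | ⟨h1, h2⟩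
  · rw [h1, h2]
  · rw [h1, h2]
    unfold wt
    simp only [eq_comm]

lemma disjoint_starSet (x : Fin n → Fin k) (v : Fin n) {i j : Fin k} (hij : i ≠ j) :
    Disjoint (starSet x v i) (starSet x v j) := by
  rw [Finset.disjoint_left]
  intro e h1 h2
  have hl := e.2
  rcases (Finset.mem_filter.1 h1).2 with ⟨h3, h4⟩ | ⟨h3, h4⟩ <;>
    rcases (Finset.mem_filter.1 h2).2 with ⟨h5, h6⟩ | ⟨h5, h6⟩
  · exact hij (h4.symm.trans h6)
  · rw [h3, h5] at hl; exact lt_irrefl _ hl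
  · rw [h3, h5] at hl; exact lt_irrefl _ hl
  · exact hij (h4.symm.trans h6)

/-- Indicator that `v` has no neighbour with label `i`. -/
noncomputable def noNbr (x : Fin n → Fin k) (v : Fin n) (i : Fin k) (g : VPair n → Bool) : ℝ :=
  ∏ e, if e ∈ starSet x v i ∧ g e = true then 0 else 1

lemma noNbr_eq (x : Fin n → Fin k) (v : Fin n) (i : Fin k) (g : VPair n → Bool) :
    noNbr x v i g = if ∀ t, gg g v t → x t ≠ i then 1 else 0 := by
  unfold noNbr
  split_ifs with h
  · refine Finset.prod_eq_one fun e _ => if_neg ?_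
    rintro ⟨h1, h2⟩
    have hg := (gg_pair g e).2 h2
    rcases (Finset.mem_filter.1 h1).2 with ⟨h3, h4⟩ | ⟨h3, h4⟩
    · exact h _ (h3 ▸ hg) h4
    · exact h _ (h3 ▸ (gg_comm _ _ _).1 hg) h4
  · push Not at h
    obtain ⟨t, ⟨e, he, h1⟩, ht⟩ := h
    refine Finset.prod_eq_zero (Finset.mem_univ e) (if_pos ⟨?_, he⟩)
    refine Finset.mem_filter.2 ⟨Finset.mem_univ _, ?_⟩
    rcases h1 with ⟨h1, h2⟩ | ⟨h1, h2⟩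
    · exact Or.inl ⟨h1, h2 ▸ ht⟩
    · exact Or.inr ⟨h2, h1 ▸ ht⟩

lemma exp_le_one_sub {p : ℝ} (h0 : 0 ≤ p) (h1 : p ≤ 1 / 2) :
    Real.exp (-(p * (1 + 2 * p))) ≤ 1 - p := by
  have h2 := Real.one_sub_inv_le_log_of_pos (x := 1 - p) (by linarith)
  have h3 : (1 - p)⁻¹ ≤ 1 + p * (1 + 2 * p) := by
    rw [inv_le_iff_one_le_mul₀ (by linarith)]
    nlinarith [mul_nonneg h0 h0, mul_nonneg (mul_nonneg h0 h0) (by linarith : 0 ≤ 1 - 2 * p)]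
  rw [← Real.le_log_iff_exp_le (by linarith)]
  linarith

lemma pE_noNbr (x : Fin n → Fin k) (v : Fin n)
    (i : Fin k) : pE (bm (ep n a b x)) (noNbr x v i) =
      (1 - wt a b (x v) i / n) ^ (starSet x v i).card := by
  have h1 := pE_prod (bm (ep n a b x)) (fun e t => if e ∈ starSet x v i ∧ t = true then 0 else 1)
  have h2 : ∀ e, ∑ t, bm (ep n a b x) e t *
      (if e ∈ starSet x v i ∧ t = true then (0 : ℝ) else 1) =
      if e ∈ starSet x v i then 1 - wt a b (x v) i / n else 1 := by
    intro e
    by_cases he : e ∈ starSet x v i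
    · simp [he, bm, ep_of_mem_starSet he]
    · simp [he, bm]
  simp only [h2] at h1
  rw [Finset.prod_ite, Finset.prod_const_one, mul_one, Finset.prod_const,
    Finset.filter_univ_mem] at h1
  exact h1

lemma le_pE_noNbr (ha : 0 ≤ a) (hb : 0 ≤ b) (hcn : 2 * max a b ≤ n) (hn : 0 < n)
    {x : Fin n → Fin k} {δ s : ℝ}
    (hbal : Bal δ x) (hs : (1 / k + δ) * (1 + 2 * max a b / n) ≤ s) (v : Fin n) (i : Fin k) :
    Real.exp (-(wt a b (x v) i * s)) ≤ pE (bm (ep n a b x)) (noNbr x v i) ∧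
      pE (bm (ep n a b x)) (noNbr x v i) ≤ 1 := by
  have hn' : (0 : ℝ) < n := by exact_mod_cast hn
  have hc0 : 0 ≤ max a b := le_max_of_le_left ha
  rw [pE_noNbr]
  set w := wt a b (x v) i
  have hw0 : 0 ≤ w := wt_nonneg ha hb _ _
  have hwc : w ≤ max a b := wt_le _ _ _ _
  have h1 : w / n ≤ 1 / 2 := by rw [div_le_iff₀ hn']; linarith
  have h2 : 0 ≤ w / n := by positivity
  refine ⟨?_, pow_le_one₀ (by linarith) (by linarith)⟩
  refine le_trans ?_ (pow_le_pow_left₀ (Real.exp_pos _).le (exp_le_one_sub h2 h1) _)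
  rw [← Real.exp_nat_mul, Real.exp_le_exp, mul_neg, neg_le_neg_iff]
  have h3 : ((starSet x v i).card : ℝ) ≤ n * (1 / k + δ) := by
    have := (abs_le.1 (hbal i)).2
    have h4 := card_starSet_le x v i
    have : (n : ℝ) * (1 / k + δ) = n / k + δ * n := by ring
    linarith
  have h5 : 0 ≤ (n : ℝ) * (1 / k + δ) := (Nat.cast_nonneg _).trans h3
  calc ((starSet x v i).card : ℝ) * (w / n * (1 + 2 * (w / n)))
      ≤ (n * (1 / k + δ)) * (w / n * (1 + 2 * (max a b / n))) := by gcongr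
    _ = w * ((1 / k + δ) * (1 + 2 * max a b / n)) := by field_simp
    _ ≤ w * s := by gcongr

lemma le_pE_free (ha : 0 ≤ a) (hb : 0 ≤ b) (hcn : 2 * max a b ≤ n) (hn : 0 < n)
    {x : Fin n → Fin k} {δ s : ℝ} (hs0 : 0 ≤ s)
    (hbal : Bal δ x) (hs : (1 / k + δ) * (1 + 2 * max a b / n) ≤ s) (v : Fin n) :
    Real.exp (-(a * s)) * (1 - (1 - Real.exp (-(b * s))) ^ (k - 1)) ≤
      pE (bm (ep n a b x)) fun g => if Free g x v then 1 else 0 := by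
  have hc0 : 0 ≤ max a b := le_max_of_le_left ha
  have hm := isP_ep ha hb (by linarith) x
  set J : Finset (Fin k) := Finset.univ.erase (x v) with hJ
  have hpt : ∀ g, (if Free g x v then (1 : ℝ) else 0) =
      noNbr x v (x v) g - ∏ i, (if i = x v then noNbr x v i g else 1 - noNbr x v i g) := by
    intro g
    rw [← Finset.mul_prod_erase _ _ (Finset.mem_univ (x v)), if_pos rfl]
    by_cases h0 : ∀ t, gg g v t → x t ≠ x v
    · rw [noNbr_eq, if_pos h0, one_mul]
      by_cases h1 : ∃ j ≠ x v, ∀ t, gg g v t → x t ≠ j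
      · rw [if_pos ⟨h0, h1⟩]
        obtain ⟨j, hj, h2⟩ := h1
        rw [Finset.prod_eq_zero (i := j) (by simpa using hj)]
        · simp
        · rw [if_neg hj, noNbr_eq, if_pos h2, sub_self]
      · rw [if_neg fun h => h1 h.2, Finset.prod_eq_one]
        · simp
        · intro j hj
          have hj' := Finset.ne_of_mem_erase hj
          rw [if_neg hj', noNbr_eq, if_neg fun h => h1 ⟨j, hj', h⟩, sub_zero]
    · rw [if_neg fun h => h0 h.1, noNbr_eq, if_neg h0]
      simp
  simp only [hpt]
  rw [pE_sub, pE_prod_of_disjoint hm (starSet x v)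
    (fun i g => if i = x v then noNbr x v i g else 1 - noNbr x v i g)]
  · rw [← Finset.mul_prod_erase _ _ (Finset.mem_univ (x v))]
    simp only [if_true]
    obtain ⟨h1, h2⟩ := le_pE_noNbr ha hb hcn hn hbal hs v (x v)
    rw [show wt a b (x v) (x v) = a by simp [wt]] at h1
    have h3 : ∏ i ∈ Finset.univ.erase (x v),
        pE (bm (ep n a b x)) (fun g => if i = x v then noNbr x v i g else 1 - noNbr x v i g) ≤
        (1 - Real.exp (-(b * s))) ^ (k - 1) := by
      have hcard : (Finset.univ.erase (x v)).card = k - 1 := by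
        rw [Finset.card_erase_of_mem (Finset.mem_univ _), Finset.card_univ, Fintype.card_fin]
      rw [← hcard, ← Finset.prod_const]
      have hi : ∀ i ∈ Finset.univ.erase (x v),
          pE (bm (ep n a b x)) (fun g => if i = x v then noNbr x v i g else 1 - noNbr x v i g) =
            1 - pE (bm (ep n a b x)) (noNbr x v i) ∧
          Real.exp (-(b * s)) ≤ pE (bm (ep n a b x)) (noNbr x v i) ∧
          pE (bm (ep n a b x)) (noNbr x v i) ≤ 1 := by
        intro i hi
        have hi' := Finset.ne_of_mem_erase hi
        have h6 := le_pE_noNbr ha hb hcn hn hbal hs v i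
        rw [show wt a b (x v) i = b by simp [wt, hi'.symm]] at h6
        refine ⟨?_, h6⟩
        simp only [if_neg hi']
        rw [pE_sub, pE_const hm]
      refine Finset.prod_le_prod (fun i h => ?_) fun i h => ?_
      · rw [(hi i h).1]; linarith [(hi i h).2.2]
      · rw [(hi i h).1]; linarith [(hi i h).2.1]
    have h4 : (1 - Real.exp (-(b * s))) ^ (k - 1) ≤ 1 := by
      have : Real.exp (-(b * s)) ≤ 1 := Real.exp_le_one_iff.2 (by
        rw [neg_nonpos]; positivity)
      exact pow_le_one₀ (by linarith) (by linarith [Real.exp_pos (-(b * s))])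
    have h5 := mul_le_mul h1 (sub_le_sub_left h3 1) (by linarith) ((Real.exp_pos _).le.trans h1)
    linarith
  · intro i g g' h
    have : noNbr x v i g = noNbr x v i g' := by
      unfold noNbr
      refine Finset.prod_congr rfl fun e _ => ?_
      by_cases he : e ∈ starSet x v i
      · rw [h e he]
      · simp [he]
    simp only [this]
  · exact fun i _ j _ hij => disjoint_starSet x v hij

end FreeCount

section FreeBound

variable {n k : ℕ} {a b δ : ℝ}

lemma le_sE_of_bal (hk : 0 < k) (hn : 0 < n) (hδ : 0 < δ) {M : ℝ} (hM : 0 ≤ M)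
    (T : (Fin n → Fin k) → (VPair n → Bool) → ℝ)
    (hT : ∀ x, (if Bal δ x then M else 0) ≤ pE (bm (ep n a b x)) (T x)) :
    M * (1 - k / (δ ^ 2 * n)) ≤ sE n a b T := by
  refine le_trans (mul_le_mul_of_nonneg_left (bal_prob hk hn hδ) hM) ?_
  rw [← pE_mul_left]
  refine pE_mono (isP_um hk).1 fun x => ?_
  refine le_trans (le_of_eq ?_) (hT x)
  split_ifs <;> simp

lemma eventually_le_mul_one_sub {h m : ℝ} (hm : h < m) (K : ℝ) :
    ∀ᶠ n : ℕ in atTop, n * h ≤ (n * m) * (1 - k / (K * n)) := by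
  filter_upwards [eventually_gt_atTop 0,
    (tendsto_natCast_atTop_atTop (R := ℝ)).eventually_ge_atTop (m * k / K / (m - h))] with n hn h1
  have hn' : (0 : ℝ) < n := by exact_mod_cast hn
  rw [div_le_iff₀ (by linarith)] at h1
  have h2 : (n * m) * (1 - k / (K * n)) = n * m - m * k / K := by
    by_cases hK : K = 0
    · simp [hK]
    · field_simp
  rw [h2]
  linarith

/-- The entropy lower bound coming from vertices that see neither their own label nor some other
label among their neighbours. -/
theorem entropy_free_bound (hk : 0 < k) (ha : 0 ≤ a) (hb : 0 ≤ b) {h : ℝ}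
    (hh : h < Real.log 2 *
      (Real.exp (-(a * (1 / k))) * (1 - (1 - Real.exp (-(b * (1 / k)))) ^ (k - 1)))) :
    ∀ᶠ n : ℕ in atTop,
      n * h ≤ sE n a b fun (x : Fin n → Fin k) g => -Real.log (post n a b x g) := by
  set c := max a b with hc
  have hc0 : 0 ≤ c := le_max_of_le_left ha
  set F : ℝ → ℝ := fun s => Real.exp (-(a * s)) * (1 - (1 - Real.exp (-(b * s))) ^ (k - 1)) with hF
  have hcont : Continuous fun δ : ℝ => (Real.log 2 - 12 * δ * c) * F (1 / k + 2 * δ) := by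
    simp only [hF]; fun_prop
  have hcont2 : Continuous fun δ : ℝ => Real.log 2 - 12 * δ * c := by fun_prop
  have ev1 : ∀ᶠ δ in nhds (0 : ℝ), h < (Real.log 2 - 12 * δ * c) * F (1 / k + 2 * δ) := by
    refine hcont.continuousAt.eventually (lt_mem_nhds ?_)
    simpa [hF] using hh
  have ev2 : ∀ᶠ δ in nhds (0 : ℝ), 0 < Real.log 2 - 12 * δ * c := by
    refine hcont2.continuousAt.eventually (lt_mem_nhds ?_)
    simpa using Real.log_pos one_lt_two
  obtain ⟨δ, ⟨h1, h2⟩, hδ⟩ := (((ev1.and ev2).filter_mono nhdsWithin_le_nhds).and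
    (self_mem_nhdsWithin : ∀ᶠ δ in nhdsWithin (0 : ℝ) (Set.Ioi 0), δ ∈ Set.Ioi (0 : ℝ))).exists
  have hδ : 0 < δ := hδ
  have hkp : (0 : ℝ) < 1 / k := by positivity
  have hF0 : 0 ≤ F (1 / k + 2 * δ) := by
    have : Real.exp (-(b * (1 / k + 2 * δ))) ≤ 1 := Real.exp_le_one_iff.2 (by
      rw [neg_nonpos]; positivity)
    have := pow_le_one₀ (n := k - 1) (by linarith : 0 ≤ 1 - Real.exp (-(b * (1 / k + 2 * δ))))
      (by linarith [Real.exp_pos (-(b * (1 / k + 2 * δ)))])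
    exact mul_nonneg (Real.exp_pos _).le (by linarith)
  filter_upwards [eventually_le_mul_one_sub (k := k) h1 (δ ^ 2), eventually_gt_atTop 0,
    (tendsto_natCast_atTop_atTop (R := ℝ)).eventually_ge_atTop (2 * c),
    (tendsto_natCast_atTop_atTop (R := ℝ)).eventually_ge_atTop (1 / δ),
    (tendsto_natCast_atTop_atTop (R := ℝ)).eventually_ge_atTop (2 * c * (1 / k + δ) / δ)]
    with n h3 hn hcn h4 h5
  have hn' : (0 : ℝ) < n := by exact_mod_cast hn
  rw [div_le_iff₀ hδ] at h4 h5
  have h6 : (1 / k + δ) * (1 + 2 * c / n) ≤ 1 / k + 2 * δ := by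
    have : (1 / k + δ) * (2 * c / n) ≤ δ := by
      rw [← mul_div_assoc, div_le_iff₀ hn']; linarith
    linarith
  have h7 : 4 * (2 * δ * n + 1) * c / n ≤ 12 * δ * c := by
    rw [div_le_iff₀ hn']
    nlinarith
  set ε := 12 * δ * c with hε
  refine h3.trans (le_trans ?_ (entropy_ge (fun (x : Fin n → Fin k) g => ∑ v : Fin n,
    if Bal δ x ∧ Free g x v then Real.log 2 - ε else 0) fun g => ?_))
  · refine le_sE_of_bal hk hn hδ (by positivity) _ fun x => ?_
    rw [pE_sum]
    split_ifs with hbal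
    · have : ∀ v : Fin n, (Real.log 2 - ε) * F (1 / k + 2 * δ) ≤ pE (bm (ep n a b x))
          (fun g => if Bal δ x ∧ Free g x v then Real.log 2 - ε else 0) := by
        intro v
        refine (mul_le_mul_of_nonneg_left
          (le_pE_free ha hb hcn hn (by positivity) hbal h6 v) h2.le).trans (le_of_eq ?_)
        rw [← pE_mul_left]
        congr 1
        ext g
        simp [hbal]
      refine le_trans (le_of_eq ?_) (Finset.sum_le_sum fun v _ => this v)
      simp
    · simp [hbal, pE]
  · simp only [Finset.mul_sum]
    rw [Finset.sum_comm]
    have hL : ∀ x : Fin n → Fin k, 0 ≤ lik n a b g x := lik_nonneg ha hb (by linarith) g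
    refine le_trans (Finset.sum_le_sum fun v _ =>
      free_cent (v := v) ha hb hcn hn hδ.le (by linarith) h7) ?_
    refine sum_cent_le_entropy hL Finset.univ (fun v => {v}) (fun _ => 0) fun u _ v _ huv h => ?_
    exact absurd (Finset.mem_singleton.1 h) huv

end FreeBound

section Structure

variable {n : ℕ} {g : VPair n → Bool} {A D D' : Finset (Fin n)} {u v w v' w' : Fin n} {R : ℕ}

/-- The vertices reached from `v` along edges of `g` whose endpoints, except possibly the first,
lie in `A`. -/
noncomputable def cl (g : VPair n → Bool) (A : Finset (Fin n)) (v : Fin n) : Finset (Fin n) :=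
  Finset.univ.filter fun u => Relation.ReflTransGen (fun s t => gg g s t ∧ t ∈ A) v u

/-- The connected component of `v`. -/
noncomputable def cc (g : VPair n → Bool) (v : Fin n) : Finset (Fin n) := cl g Finset.univ v

lemma mem_cl : u ∈ cl g A v ↔ Relation.ReflTransGen (fun s t => gg g s t ∧ t ∈ A) v u := by
  simp [cl]

lemma self_mem_cl : v ∈ cl g A v := mem_cl.2 .refl

lemma cl_step (hu : u ∈ cl g A v) (h : gg g u w) (hw : w ∈ A) : w ∈ cl g A v :=
  mem_cl.2 ((mem_cl.1 hu).tail ⟨h, hw⟩)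

lemma cl_subset_of_closed (hv : v ∈ D) (hD : ∀ s ∈ D, ∀ t ∈ A, gg g s t → t ∈ D) :
    cl g A v ⊆ D := by
  intro u hu
  induction mem_cl.1 hu with
  | refl => exact hv
  | tail h1 h2 ih => exact hD _ (ih (mem_cl.2 h1)) _ h2.2 h2.1

lemma self_mem_cc : v ∈ cc g v := self_mem_cl

lemma cc_step (hu : u ∈ cc g v) (h : gg g u w) : w ∈ cc g v := cl_step hu h (Finset.mem_univ _)

lemma mem_cc_comm : u ∈ cc g v ↔ v ∈ cc g u := by
  have : Std.Symm fun s t => gg g s t ∧ t ∈ (Finset.univ : Finset (Fin n)) :=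
    ⟨fun s t h => ⟨(gg_comm g s t).1 h.1, Finset.mem_univ _⟩⟩
  unfold cc
  rw [mem_cl, mem_cl]
  exact ⟨fun h => Std.Symm.symm _ _ h, fun h => Std.Symm.symm _ _ h⟩

lemma cc_eq_of_mem (h : u ∈ cc g v) : cc g u = cc g v := by
  have key : ∀ {u v : Fin n}, u ∈ cc g v → cc g u ⊆ cc g v := fun {u v} h =>
    cl_subset_of_closed h fun s hs t _ hst => cc_step hs hst
  exact (key h).antisymm (key (mem_cc_comm.1 h))

lemma cc_subset_of_closed (hv : v ∈ D) (hD : ∀ s ∈ D, ∀ t ∉ D, ¬ gg g s t) : cc g v ⊆ D :=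
  cl_subset_of_closed hv fun s hs t _ hst => by
    by_contra ht
    exact hD s hs t ht hst

lemma not_gg_of_cc {s t : Fin n} (hs : s ∈ cc g v) (ht : t ∉ cc g v) : ¬ gg g s t :=
  fun h => ht (cc_step hs h)

/-- The least vertex of the component of `v`. -/
noncomputable def mn (g : VPair n → Bool) (v : Fin n) : Fin n := (cc g v).min' ⟨v, self_mem_cc⟩

lemma mn_mem : mn g v ∈ cc g v := Finset.min'_mem _ _

lemma mn_congr (h : cc g u = cc g v) : mn g u = mn g v := by
  unfold mn
  congr 1

/-- `D` is connected, contains `v`, and is joined to its complement by the single edge `vw`. -/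
structure Pend (g : VPair n → Bool) (v w : Fin n) (D : Finset (Fin n)) : Prop where
  mem : v ∈ D
  not_mem : w ∉ D
  adj : gg g v w
  only : ∀ s ∈ D, ∀ t ∉ D, gg g s t → s = v ∧ t = w
  conn : ∀ s ∈ D, s ∈ cl g D v

/-- The pendant set `D` is the distinguished side of its edge. -/
def Sel (g : VPair n → Bool) (R : ℕ) (v : Fin n) (D : Finset (Fin n)) : Prop :=
  (2 * R < (cc g v).card ∧ D.card ≤ R) ∨ ((cc g v).card ≤ 2 * R ∧ mn g v ∉ D)

lemma cl_subset_cc : cl g A v ⊆ cc g v :=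
  cl_subset_of_closed self_mem_cc fun _ hs _ _ hst => cc_step hs hst

lemma cl_subset_insert : cl g A v ⊆ insert v A :=
  cl_subset_of_closed (Finset.mem_insert_self _ _) fun _ _ _ ht _ => Finset.mem_insert_of_mem ht

lemma Pend.subset_cc (h : Pend g v w D) : D ⊆ cc g v := fun s hs => cl_subset_cc (h.conn s hs)

lemma Pend.exists_cross (h : Pend g v w D) {E : Finset (Fin n)} (h1 : ∃ z ∈ D, z ∈ E)
    (h2 : ∃ z ∈ D, z ∉ E) : ∃ s ∈ D, ∃ t ∈ D, s ∈ E ∧ t ∉ E ∧ gg g s t := by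
  by_contra! hcon
  obtain ⟨z, hz, hzE⟩ := h1
  obtain ⟨z', hz', hzE'⟩ := h2
  by_cases hv : v ∈ E
  · have : cl g D v ⊆ D ∩ E := cl_subset_of_closed (Finset.mem_inter.2 ⟨h.mem, hv⟩)
      fun s hs t ht hst => Finset.mem_inter.2 ⟨ht, by
        by_contra htE
        exact hcon s (Finset.mem_inter.1 hs).1 t ht (Finset.mem_inter.1 hs).2 htE hst⟩
    exact hzE' (Finset.mem_inter.1 (this (h.conn z' hz'))).2
  · have : cl g D v ⊆ D \ E := cl_subset_of_closed (Finset.mem_sdiff.2 ⟨h.mem, hv⟩)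
      fun s hs t ht hst => Finset.mem_sdiff.2 ⟨ht, fun htE =>
        hcon t ht s (Finset.mem_sdiff.1 hs).1 htE (Finset.mem_sdiff.1 hs).2
          ((gg_comm g s t).1 hst)⟩
    exact (Finset.mem_sdiff.1 (this (h.conn z hz))).2 hzE

/-- Distinguished pendant sets form a laminar family. -/
lemma Pend.nested (h : Pend g v w D) (h' : Pend g v' w' D') (hs : Sel g R v D)
    (hs' : Sel g R v' D') (hne : ∃ z ∈ D, z ∈ D') : D ⊆ D' ∨ D' ⊆ D := by
  by_contra! hcon
  obtain ⟨z, hz, hz'⟩ := hne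
  obtain ⟨s, hsD, t, htD, hsE, htE, hst⟩ := h.exists_cross ⟨z, hz, hz'⟩
    (Finset.not_subset.1 hcon.1)
  obtain ⟨s', hsD', t', htD', hsE', htE', hst'⟩ := h'.exists_cross ⟨z, hz', hz⟩
    (Finset.not_subset.1 hcon.2)
  have e1 := h'.only s hsE t htE hst
  have e2 := h.only s' hsE' t' htE' hst'
  have hw' : w' ∈ D := e1.2 ▸ htD
  have hw : w ∈ D' := e2.2 ▸ htD'
  have hC : cc g v ⊆ D ∪ D' := by
    refine cc_subset_of_closed (Finset.mem_union_left _ h.mem) fun p hp q hq hpq => ?_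
    rw [Finset.mem_union, not_or] at hq
    rcases Finset.mem_union.1 hp with hp | hp
    · exact hq.2 ((h.only p hp q hq.1 hpq).2 ▸ hw)
    · exact hq.1 ((h'.only p hp q hq.2 hpq).2 ▸ hw')
  have hcc : cc g v' = cc g v :=
    (cc_eq_of_mem (h'.subset_cc hz')).symm.trans (cc_eq_of_mem (h.subset_cc hz))
  have hcard := (Finset.card_le_card hC).trans (Finset.card_union_le _ _)
  unfold Sel at hs'
  rw [hcc, mn_congr hcc] at hs'
  rcases hs with ⟨a1, a2⟩ | ⟨a1, a2⟩ <;> rcases hs' with ⟨b1, b2⟩ | ⟨b1, b2⟩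
  · omega
  · omega
  · omega
  · rcases Finset.mem_union.1 (hC mn_mem) with h1 | h1
    · exact a2 h1
    · exact b2 h1

lemma Sel.card_le (h : Pend g v w D) (hs : Sel g R v D) : D.card ≤ 2 * R := by
  rcases hs with ⟨_, h2⟩ | ⟨h1, _⟩
  · omega
  · exact (Finset.card_le_card h.subset_cc).trans h1

/-- The vertices at which a distinguished pendant set hangs. -/
noncomputable def hangs (g : VPair n → Bool) (R : ℕ) : Finset (Fin n) :=
  Finset.univ.filter fun v => ∃ w D, Pend g v w D ∧ Sel g R v D

/-- The least vertices of the small components. -/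
noncomputable def roots (g : VPair n → Bool) (R : ℕ) : Finset (Fin n) :=
  Finset.univ.filter fun v => (cc g v).card ≤ 2 * R ∧ mn g v = v

lemma disjoint_hangs_roots : Disjoint (hangs g R) (roots g R) := by
  rw [Finset.disjoint_left]
  intro v h1 h2
  obtain ⟨w, D, hP, hS⟩ := (Finset.mem_filter.1 h1).2
  obtain ⟨h3, h4⟩ := (Finset.mem_filter.1 h2).2
  rcases hS with ⟨h5, _⟩ | ⟨_, h6⟩
  · omega
  · exact h6 (h4.symm ▸ hP.mem)

/-- The set attached to each hanging vertex or root. -/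
noncomputable def att (g : VPair n → Bool) (R : ℕ) (v : Fin n) : Finset (Fin n) :=
  if h : ∃ D, (∃ w, Pend g v w D) ∧ Sel g R v D then h.choose else cc g v

lemma att_hang (hv : v ∈ hangs g R) :
    (∃ w, Pend g v w (att g R v)) ∧ Sel g R v (att g R v) := by
  obtain ⟨w, D, h1, h2⟩ := (Finset.mem_filter.1 hv).2
  have h : ∃ D, (∃ w, Pend g v w D) ∧ Sel g R v D := ⟨D, ⟨w, h1⟩, h2⟩
  unfold att
  rw [dif_pos h]
  exact h.choose_spec

lemma att_root (hv : v ∈ roots g R) : att g R v = cc g v := by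
  unfold att
  rw [dif_neg]
  rintro ⟨D, ⟨w, h1⟩, h2⟩
  exact Finset.disjoint_left.1 (disjoint_hangs_roots (g := g) (R := R))
    (Finset.mem_filter.2 ⟨Finset.mem_univ _, w, D, h1, h2⟩) hv

lemma att_card_lt (hu : u ∈ hangs g R ∪ roots g R) (hv : v ∈ hangs g R ∪ roots g R) (huv : u ≠ v)
    (h : u ∈ att g R v) : (att g R u).card < (att g R v).card := by
  rcases Finset.mem_union.1 hv with hv | hv
  · obtain ⟨⟨w, hP⟩, hS⟩ := att_hang hv
    rcases Finset.mem_union.1 hu with hu | hu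
    · obtain ⟨⟨w', hP'⟩, hS'⟩ := att_hang hu
      have hnot : ¬ att g R v ⊆ att g R u := fun hsub =>
        huv (hP.only u h w' (fun h1 => hP'.not_mem (hsub h1)) hP'.adj).1
      rcases hP'.nested hP hS' hS ⟨u, hP'.mem, h⟩ with h1 | h1
      · exact Finset.card_lt_card ⟨h1, hnot⟩
      · exact absurd h1 hnot
    · exfalso
      obtain ⟨h3, h4⟩ := (Finset.mem_filter.1 hu).2
      have hcc := cc_eq_of_mem (hP.subset_cc h)
      rcases hS with ⟨h5, _⟩ | ⟨_, h6⟩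
      · rw [hcc] at h3; omega
      · rw [← mn_congr hcc, h4] at h6
        exact h6 h
  · rw [att_root hv] at h ⊢
    have hcc := cc_eq_of_mem h
    rcases Finset.mem_union.1 hu with hu | hu
    · obtain ⟨⟨w', hP'⟩, hS'⟩ := att_hang hu
      rw [← hcc]
      exact Finset.card_lt_card ⟨hP'.subset_cc, fun hsub =>
        hP'.not_mem (hsub (cc_step self_mem_cc hP'.adj))⟩
    · have h3 := (Finset.mem_filter.1 hu).2.2
      have h4 := (Finset.mem_filter.1 hv).2.2
      exact absurd (h3.symm.trans ((mn_congr hcc).trans h4)) huv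

lemma le_card_roots : ∑ v, (if (cc g v).card ≤ 2 * R then 1 / ((cc g v).card : ℝ) else 0) ≤
    (roots g R).card := by
  rw [← Finset.sum_filter]
  have hmap : ∀ v ∈ Finset.univ.filter (fun v => (cc g v).card ≤ 2 * R), mn g v ∈ roots g R := by
    intro v hv
    have hcc := cc_eq_of_mem (mn_mem (g := g) (v := v))
    refine Finset.mem_filter.2 ⟨Finset.mem_univ _, ?_, mn_congr hcc⟩
    rw [hcc]
    exact (Finset.mem_filter.1 hv).2
  rw [← Finset.sum_fiberwise_of_maps_to hmap, ← nsmul_one, ← Finset.sum_const]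
  refine Finset.sum_le_sum fun m hm => ?_
  have hpos : (0 : ℝ) < (cc g m).card := by
    exact_mod_cast Finset.card_pos.2 ⟨m, self_mem_cc⟩
  have h1 : ∀ v, mn g v = m → v ∈ cc g m ∧ cc g v = cc g m := by
    rintro v rfl
    have hcc := cc_eq_of_mem (mn_mem (g := g) (v := v))
    exact ⟨hcc.symm ▸ self_mem_cc, hcc.symm⟩
  refine (Finset.sum_le_sum (g := fun _ => 1 / ((cc g m).card : ℝ)) fun v hv => ?_).trans ?_
  · rw [(h1 v (Finset.mem_filter.1 hv).2).2]
  · rw [Finset.sum_const, nsmul_eq_mul, mul_one_div, div_le_one hpos]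
    exact_mod_cast Finset.card_le_card fun v hv => (h1 v (Finset.mem_filter.1 hv).2).1

/-- The endpoints of `e` lie in distinct components, one of which has at most `R` vertices. -/
def Sep (g : VPair n → Bool) (R : ℕ) (u v : Fin n) : Prop :=
  v ∉ cc g u ∧ ((cc g u).card ≤ R ∨ (cc g v).card ≤ R)

/-- The edges whose removal cuts off a component with at most `R` vertices. -/
noncomputable def cuts (g : VPair n → Bool) (R : ℕ) : Finset (VPair n) :=
  Finset.univ.filter fun e => g e = true ∧ Sep (Function.update g e false) R e.1.1 e.1.2

lemma gg_of_gg_update {e : VPair n} {s t : Fin n} (h : gg (Function.update g e false) s t) :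
    gg g s t := by
  obtain ⟨e', h1, h2⟩ := h
  by_cases he : e' = e
  · subst he; simp at h1
  · rw [Function.update_of_ne he] at h1
    exact ⟨e', h1, h2⟩

lemma gg_update_of_gg {e : VPair n} {s t : Fin n} (h : gg g s t)
    (hst : ¬ ((e.1.1 = s ∧ e.1.2 = t) ∨ (e.1.1 = t ∧ e.1.2 = s))) :
    gg (Function.update g e false) s t := by
  obtain ⟨e', h1, h2⟩ := h
  have he : e' ≠ e := fun he => hst (he ▸ h2)
  exact ⟨e', by rwa [Function.update_of_ne he], h2⟩

lemma pend_update {e : VPair n} (hge : g e = true)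
    (he : (e.1.1 = v ∧ e.1.2 = w) ∨ (e.1.1 = w ∧ e.1.2 = v))
    (hw : w ∉ cc (Function.update g e false) v) :
    Pend g v w (cc (Function.update g e false) v) where
  mem := self_mem_cc
  not_mem := hw
  adj := ⟨e, hge, he⟩
  only := by
    intro s hs t ht hst
    by_contra hne
    by_cases h1 : (e.1.1 = s ∧ e.1.2 = t) ∨ (e.1.1 = t ∧ e.1.2 = s)
    · rcases he with ⟨h2, h3⟩ | ⟨h2, h3⟩ <;> rcases h1 with ⟨h4, h5⟩ | ⟨h4, h5⟩
      · exact hne ⟨h4.symm.trans h2, h5.symm.trans h3⟩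
      · exact hw (h3.symm.trans h5 ▸ hs)
      · exact hw (h2.symm.trans h4 ▸ hs)
      · exact hne ⟨h5.symm.trans h3, h4.symm.trans h2⟩
    · exact ht (cc_step hs (gg_update_of_gg hst h1))
  conn := by
    intro s hs
    have key : cc (Function.update g e false) v ⊆ cc (Function.update g e false) v ∩
        cl g (cc (Function.update g e false) v) v :=
      cl_subset_of_closed (Finset.mem_inter.2 ⟨self_mem_cc, self_mem_cl⟩) fun p hp q _ hpq => by
        rw [Finset.mem_inter] at hp ⊢
        exact ⟨cc_step hp.1 hpq, cl_step hp.2 (gg_of_gg_update hpq) (cc_step hp.1 hpq)⟩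
    exact (Finset.mem_inter.1 (key hs)).2

lemma exists_pend_of_cut {e : VPair n} (he : e ∈ cuts g R) :
    ∃ v w D, ((e.1.1 = v ∧ e.1.2 = w) ∨ (e.1.1 = w ∧ e.1.2 = v)) ∧ Pend g v w D ∧ Sel g R v D := by
  obtain ⟨hge, hne, hsm⟩ := (Finset.mem_filter.1 he).2
  set g' := Function.update g e false with hg'
  have hP1 : Pend g e.1.1 e.1.2 (cc g' e.1.1) := pend_update hge (Or.inl ⟨rfl, rfl⟩) hne
  have hP2 : Pend g e.1.2 e.1.1 (cc g' e.1.2) := pend_update hge (Or.inr ⟨rfl, rfl⟩)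
    fun h => hne (mem_cc_comm.1 h)
  have hcc : cc g e.1.2 = cc g e.1.1 := cc_eq_of_mem (cc_step self_mem_cc hP1.adj)
  by_cases hbig : 2 * R < (cc g e.1.1).card
  · rcases hsm with h1 | h1
    · exact ⟨_, _, _, Or.inl ⟨rfl, rfl⟩, hP1, Or.inl ⟨hbig, h1⟩⟩
    · exact ⟨_, _, _, Or.inr ⟨rfl, rfl⟩, hP2, Or.inl ⟨hcc ▸ hbig, h1⟩⟩
  · rw [not_lt] at hbig
    by_cases hm : mn g e.1.1 ∈ cc g' e.1.1
    · refine ⟨_, _, _, Or.inr ⟨rfl, rfl⟩, hP2, Or.inr ⟨hcc ▸ hbig, fun h => ?_⟩⟩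
      rw [mn_congr hcc] at h
      refine hne ?_
      rw [← cc_eq_of_mem hm, cc_eq_of_mem h]
      exact self_mem_cc
    · exact ⟨_, _, _, Or.inl ⟨rfl, rfl⟩, hP1, Or.inr ⟨hbig, hm⟩⟩

lemma card_cuts_le : (cuts g R).card ≤ (hangs g R).card := by
  rcases (cuts g R).eq_empty_or_nonempty with h0 | ⟨e₀, _⟩
  · simp [h0]
  have : Nonempty (Fin n) := ⟨e₀.1.1⟩
  choose! F W D h1 h2 h3 using fun e (he : e ∈ cuts g R) => exists_pend_of_cut he
  refine Finset.card_le_card_of_injOn F (fun e he => Finset.mem_coe.2 (Finset.mem_filter.2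
    ⟨Finset.mem_univ _, W e, D e, h2 e he, h3 e he⟩)) fun e he e' he' hF => ?_
  have p := h2 e he
  have p' := h2 e' he'
  rw [← hF] at p'
  have q' := h3 e' he'
  rw [← hF] at q'
  have hW : W e = W e' := by
    by_contra hW
    have hW1 : W e' ∈ D e := by
      by_contra hc
      exact hW (p.only _ p.mem _ hc p'.adj).2.symm
    have hW2 : W e ∈ D e' := by
      by_contra hc
      exact hW (p'.only _ p'.mem _ hc p.adj).2
    rcases p.nested p' (h3 e he) q' ⟨_, p.mem, p'.mem⟩ with hs | hs
    · exact p'.not_mem (hs hW1)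
    · exact p.not_mem (hs hW2)
  have l := e.2
  have l' := e'.2
  have m := h1 e he
  have m' := h1 e' he'
  rw [← hF, ← hW] at m'
  refine Subtype.ext (Prod.ext ?_ ?_)
  all_goals
    rcases m with ⟨m1, m2⟩ | ⟨m1, m2⟩ <;> rcases m' with ⟨m3, m4⟩ | ⟨m3, m4⟩
    · simp [m1, m2, m3, m4]
    · rw [m1, m2] at l
      rw [m3, m4] at l'
      exact absurd (l.trans l') (lt_irrefl _)
    · rw [m1, m2] at l
      rw [m3, m4] at l'
      exact absurd (l.trans l') (lt_irrefl _)
    · simp [m1, m2, m3, m4]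

end Structure

section PendEntropy

variable {n k R : ℕ} {a b d δ ε : ℝ}

lemma sE_roots_cuts_le (hk : 0 < k) (ha : 0 ≤ a) (hb : 0 ≤ b)
    (hd : d = (a + ((k : ℝ) - 1) * b) / k) (hd0 : 0 < d) (hcn : 2 * max a b ≤ n) (hn : 0 < n)
    (hδ : 0 ≤ δ) (hR : 2 * (R : ℝ) ≤ δ * n)
    (hε : 2 * R * (4 * (2 * δ * n + 1) * max a b / n) ≤ ε) :
    sE n a b (fun (x : Fin n → Fin k) g => if Bal δ x then
      (roots g R).card * (Real.log k - ε) +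
        (cuts g R).card * max (Real.exp (-ε) * edgeEnt k a b d - ε) 0 else 0) ≤
    sE n a b fun (x : Fin n → Fin k) g => -Real.log (post n a b x g) := by
  have hc0 : 0 ≤ max a b := le_max_of_le_left ha
  set μ := Real.exp (-ε) * edgeEnt k a b d - ε with hμ
  have hcard : ∀ m : ℕ, m ≤ 2 * R → (m : ℝ) ≤ δ * n ∧
      m * (4 * (2 * δ * n + 1) * max a b / n) ≤ ε := by
    intro m hm
    have hm' : (m : ℝ) ≤ 2 * R := by exact_mod_cast hm
    refine ⟨hm'.trans hR, le_trans ?_ hε⟩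
    gcongr
  refine entropy_ge _ fun g => ?_
  have hL : ∀ x : Fin n → Fin k, 0 ≤ lik n a b g x := lik_nonneg ha hb (by linarith) g
  have hroot : ∀ v ∈ roots g R, ∑ x : Fin n → Fin k, lik n a b g x *
      (if Bal δ x then Real.log k - ε else 0) ≤ cent (lik n (k := k) a b g) v (att g R v)ᶜ := by
    intro v hv
    rw [att_root hv]
    obtain ⟨h1, h2⟩ := hcard _ (Finset.mem_filter.1 hv).2.1
    exact root_cent hk ha hb hcn hn hδ self_mem_cc (fun s hs t ht => not_gg_of_cc hs ht) h1 h2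
  have hhang : ∀ v ∈ hangs g R, ∑ x : Fin n → Fin k, lik n a b g x *
      (if Bal δ x then max μ 0 else 0) ≤ cent (lik n (k := k) a b g) v (att g R v)ᶜ := by
    intro v hv
    obtain ⟨⟨w, hP⟩, hS⟩ := att_hang hv
    obtain ⟨h1, h2⟩ := hcard _ (hS.card_le hP)
    rcases max_choice μ 0 with h | h
    · rw [h]
      exact hang_cent hk ha hb hd hd0 hcn hn hδ hP.mem hP.not_mem hP.adj hP.only h1 h2
    · rw [h]
      simpa using cent_nonneg hL v (att g R v)ᶜ
  have hsum := sum_cent_le_entropy hL (hangs g R ∪ roots g R) (att g R)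
    (fun v => (att g R v).card) fun u hu v hv huv h => att_card_lt hu hv huv h
  rw [Finset.sum_union disjoint_hangs_roots] at hsum
  refine le_trans ?_ hsum
  have h1 := Finset.sum_le_sum hroot
  have h2 := Finset.sum_le_sum hhang
  rw [Finset.sum_const, nsmul_eq_mul, Finset.mul_sum] at h1 h2
  have hc : ((cuts g R).card : ℝ) ≤ (hangs g R).card := by exact_mod_cast card_cuts_le
  refine le_trans ?_ (add_le_add h2 h1)
  rw [← Finset.sum_add_distrib]
  refine Finset.sum_le_sum fun x _ => ?_
  split_ifs with hB
  · have h3 := mul_le_mul_of_nonneg_left hc (mul_nonneg (hL x) (le_max_right μ 0))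
    linarith
  · simp

end PendEntropy

section Harris

lemma bm_mul_bm {ι : Type*} {p : ι → ℝ} (i : ι) (s t : Bool) :
    bm p i s * bm p i t = bm p i (s ⊓ t) * bm p i (s ⊔ t) := by
  cases s <;> cases t <;> simp [bm, mul_comm]

variable {ι : Type*} [Fintype ι] [DecidableEq ι] {p : ι → ℝ}

/-- Harris' inequality for decreasing functions of independent bits. -/
lemma harris (h0 : ∀ i, 0 ≤ p i) (h1 : ∀ i, p i ≤ 1) {f h : (ι → Bool) → ℝ} (hf0 : ∀ ω, 0 ≤ f ω)
    (hh0 : ∀ ω, 0 ≤ h ω) (hf : Antitone f) (hh : Antitone h) :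
    pE (bm p) f * pE (bm p) h ≤ pE (bm p) fun ω => f ω * h ω := by
  have hm := isP_bm h0 h1
  have key := fkg (α := (ι → Bool)ᵒᵈ) (fun ω => f (OrderDual.ofDual ω))
    (fun ω => h (OrderDual.ofDual ω)) (fun ω => pw (bm p) (OrderDual.ofDual ω))
    (fun ω => pw_nonneg hm.1 _) (fun ω => hf0 _) (fun ω => hh0 _)
    (fun s t hst => hf hst) (fun s t hst => hh hst) (fun s t => le_of_eq (by
      unfold pw
      rw [← Finset.prod_mul_distrib, ← Finset.prod_mul_distrib]
      refine Finset.prod_congr rfl fun i _ => ?_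
      rw [bm_mul_bm]
      exact mul_comm _ _))
  have hone : ∑ ω : ι → Bool, pw (bm p) ω = 1 := by
    have := pE_const hm 1
    simpa [pE] using this
  have e : ∀ F : (ι → Bool) → ℝ, ∑ ω : (ι → Bool)ᵒᵈ, F (OrderDual.ofDual ω) = ∑ ω, F ω :=
    fun F => rfl
  rw [e fun ω => pw (bm p) ω * f ω, e fun ω => pw (bm p) ω * h ω, e fun ω => pw (bm p) ω, hone,
    one_mul] at key
  exact key

lemma harris_prod {κ : Type*} (h0 : ∀ i, 0 ≤ p i) (h1 : ∀ i, p i ≤ 1) (T : Finset κ)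
    {f : κ → (ι → Bool) → ℝ} (hf0 : ∀ j ω, 0 ≤ f j ω) (hf : ∀ j, Antitone (f j)) :
    ∏ j ∈ T, pE (bm p) (f j) ≤ pE (bm p) fun ω => ∏ j ∈ T, f j ω := by
  have hm := isP_bm h0 h1
  induction T using Finset.induction_on with
  | empty => simp [pE_const hm]
  | insert j T hj ih =>
    simp only [Finset.prod_insert hj]
    refine (mul_le_mul_of_nonneg_left ih (pE_nonneg hm.1 (hf0 j))).trans ?_
    refine harris h0 h1 (hf0 j) (fun ω => Finset.prod_nonneg fun i _ => hf0 i ω) (hf j) ?_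
    exact fun ω ω' hω => Finset.prod_le_prod (fun i _ => hf0 i _) fun i _ => hf i hω

end Harris

section Tree

variable {n : ℕ} {p : VPair n → ℝ} {A : Finset (Fin n)} {u v : Fin n}

/-- The symmetric function of two vertices determined by `p`, zero on the diagonal. -/
noncomputable def pq (p : VPair n → ℝ) (u v : Fin n) : ℝ :=
  if h : u < v then p ⟨(u, v), h⟩ else if h : v < u then p ⟨(v, u), h⟩ else 0

lemma pq_comm (u v : Fin n) : pq p u v = pq p v u := by
  unfold pq
  rcases lt_trichotomy u v with h | h | h
  · simp [h, h.not_gt]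
  · simp [h]
  · simp [h, h.not_gt]

lemma pq_pair (e : VPair n) : pq p e.1.1 e.1.2 = p e := by
  unfold pq
  rw [dif_pos e.2]

lemma exists_edge (huv : u ≠ v) :
    ∃ e : VPair n, pq p u v = p e ∧ (∀ g, gg g u v ↔ g e = true) ∧
      ((e.1.1 = u ∧ e.1.2 = v) ∨ (e.1.1 = v ∧ e.1.2 = u)) := by
  rcases lt_or_gt_of_ne huv with h | h
  · exact ⟨⟨(u, v), h⟩, pq_pair ⟨(u, v), h⟩, fun g => gg_pair g ⟨(u, v), h⟩, Or.inl ⟨rfl, rfl⟩⟩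
  · exact ⟨⟨(v, u), h⟩, (pq_comm _ _).trans (pq_pair ⟨(v, u), h⟩),
      fun g => (gg_comm g u v).trans (gg_pair g ⟨(v, u), h⟩), Or.inr ⟨rfl, rfl⟩⟩

lemma pq_nonneg (h0 : ∀ e, 0 ≤ p e) (u v : Fin n) : 0 ≤ pq p u v := by
  unfold pq; split_ifs <;> simp [h0]

lemma pq_le {C : ℝ} (hC : 0 ≤ C) (h1 : ∀ e, p e ≤ C) (u v : Fin n) : pq p u v ≤ C := by
  unfold pq; split_ifs <;> simp [h1, hC]

lemma gg_mono {g g' : VPair n → Bool} (h : g ≤ g') {s t : Fin n} (hst : gg g s t) : gg g' s t := by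
  obtain ⟨e, h1, h2⟩ := hst
  refine ⟨e, ?_, h2⟩
  have := h e
  rw [h1] at this
  exact top_le_iff.1 this

lemma cl_mono {g g' : VPair n → Bool} (h : g ≤ g') : cl g A v ⊆ cl g' A v :=
  cl_subset_of_closed self_mem_cl fun _ hs _ ht hst => cl_step hs (gg_mono h hst) ht

lemma cl_congr {g g' : VPair n → Bool}
    (h : ∀ e : VPair n, e.1.1 ∈ insert v A → e.1.2 ∈ insert v A → g e = g' e) :
    cl g A v = cl g' A v := by
  have key : ∀ {g g' : VPair n → Bool},
      (∀ e : VPair n, e.1.1 ∈ insert v A → e.1.2 ∈ insert v A → g e = g' e) →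
      cl g A v ⊆ cl g' A v := by
    intro g g' h
    refine cl_subset_of_closed self_mem_cl fun s hs t ht hst => cl_step hs ?_ ht
    have hs' := cl_subset_insert hs
    have ht' := Finset.mem_insert_of_mem (b := v) ht
    obtain ⟨e, h1, h2⟩ := hst
    refine ⟨e, ?_, h2⟩
    rcases h2 with ⟨h2, h3⟩ | ⟨h2, h3⟩
    · rw [← h e (h2 ▸ hs') (h3 ▸ ht')]; exact h1
    · rw [← h e (h2 ▸ ht') (h3 ▸ hs')]; exact h1
  exact (key h).antisymm (key fun e h1 h2 => (h e h1 h2).symm)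

lemma cl_erase (g : VPair n → Bool) : cl g (A.erase v) v = cl g A v := by
  refine (cl_subset_of_closed self_mem_cl fun s hs t ht hst =>
    cl_step hs hst (Finset.mem_of_mem_erase ht)).antisymm
    (cl_subset_of_closed self_mem_cl fun s hs t ht hst => ?_)
  by_cases htv : t = v
  · exact htv ▸ self_mem_cl
  · exact cl_step hs hst (Finset.mem_erase.2 ⟨htv, ht⟩)

lemma card_cl_le (g : VPair n → Bool) (A : Finset (Fin n)) (v : Fin n) :
    (cl g A v).card ≤ 1 + ∑ u ∈ A.filter (gg g v), (cl g (A.erase u) u).card := by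
  have h : cl g A v ⊆ insert v ((A.filter (gg g v)).biUnion fun u => cl g (A.erase u) u) := by
    refine cl_subset_of_closed (Finset.mem_insert_self _ _) fun s hs t ht hst => ?_
    refine Finset.mem_insert_of_mem (Finset.mem_biUnion.2 ?_)
    rcases Finset.mem_insert.1 hs with rfl | hs
    · exact ⟨t, Finset.mem_filter.2 ⟨ht, hst⟩, self_mem_cl⟩
    · obtain ⟨u, hu, hs⟩ := Finset.mem_biUnion.1 hs
      refine ⟨u, hu, ?_⟩
      by_cases htu : t = u
      · exact htu ▸ self_mem_cl
      · exact cl_step hs hst (Finset.mem_erase.2 ⟨htu, ht⟩)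
  refine (Finset.card_le_card h).trans ((Finset.card_insert_le _ _).trans ?_)
  rw [add_comm]
  exact Nat.add_le_add_left Finset.card_biUnion_le _

lemma pE_edge_mul (hm : IsP (bm p)) (huv : u ≠ v) (X : (VPair n → Bool) → ℝ)
    (hX : ∀ g g' : VPair n → Bool, (∀ e : VPair n,
      ¬ ((e.1.1 = u ∧ e.1.2 = v) ∨ (e.1.1 = v ∧ e.1.2 = u)) → g e = g' e) → X g = X g') :
    pE (bm p) (fun g => (if gg g u v then 1 else 0) * X g) = pq p u v * pE (bm p) X := by
  obtain ⟨e, h1, h2, h3⟩ := exists_edge (p := p) huv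
  simp only [h2, h1]
  rw [pE_mul_of_disjoint hm {e} (fun g => if g e = true then (1 : ℝ) else 0) X,
    pE_single hm e (fun t => if t = true then (1 : ℝ) else 0)]
  · simp [bm]
  · intro g g' h
    rw [h e (Finset.mem_singleton_self e)]
  · intro g g' h
    refine hX g g' fun e' he' => h e' fun h4 => he' ?_
    rw [Finset.mem_singleton.1 h4]
    exact h3

lemma pE_factor (hm : IsP (bm p)) (huv : u ≠ v) (X : (VPair n → Bool) → ℝ)
    (hX : ∀ g g' : VPair n → Bool, (∀ e : VPair n,
      ¬ ((e.1.1 = u ∧ e.1.2 = v) ∨ (e.1.1 = v ∧ e.1.2 = u)) → g e = g' e) → X g = X g') :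
    pE (bm p) (fun g => if gg g u v then X g else 1) = 1 - pq p u v * (1 - pE (bm p) X) := by
  have h := pE_edge_mul hm huv (fun g => 1 - X g) fun g g' hg => by rw [hX g g' hg]
  rw [pE_sub, pE_const hm] at h
  rw [← h]
  have h1 := pE_sub (m := bm p) (fun _ => 1) (fun g => (if gg g u v then 1 else 0) * (1 - X g))
  rw [pE_const hm] at h1
  rw [← h1]
  congr 1
  ext g
  split_ifs <;> ring

/-- The generating function of the size of a cluster dominates that of a Poisson branching
process. -/
theorem tree_bound (h0 : ∀ e, 0 ≤ p e) (h1 : ∀ e, p e ≤ 1 / 2) {D y : ℝ}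
    (hD : ∀ v, ∑ u, pq p v u * (1 + 2 * pq p v u) ≤ D) (hy0 : 0 ≤ y) (hy1 : y ≤ 1)
    (hs : y * Real.exp (D * (1 - y)) ≤ 1) (A : Finset (Fin n)) (v : Fin n) :
    y ≤ pE (bm p) fun g => (y * Real.exp (D * (1 - y))) ^ (cl g A v).card := by
  set s := y * Real.exp (D * (1 - y)) with hsdef
  have hs0 : 0 ≤ s := by positivity
  have hm : IsP (bm p) := isP_bm h0 fun e => (h1 e).trans (by norm_num)
  have hq0 : ∀ u v, 0 ≤ pq p u v := pq_nonneg h0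
  have hq1 : ∀ u v, pq p u v ≤ 1 / 2 := pq_le (by norm_num) h1
  suffices H : ∀ A : Finset (Fin n), ∀ v ∉ A, y ≤ pE (bm p) fun g => s ^ (cl g A v).card by
    have := H (A.erase v) v (Finset.notMem_erase v A)
    simpa only [cl_erase] using this
  intro A
  induction A using Finset.strongInduction with
  | H A ih =>
  intro v hv
  set X : Fin n → (VPair n → Bool) → ℝ := fun u g => s ^ (cl g (A.erase u) u).card with hX
  have hX0 : ∀ u g, 0 ≤ X u g := fun u g => pow_nonneg hs0 _
  have hX1 : ∀ u g, X u g ≤ 1 := fun u g => pow_le_one₀ hs0 hs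
  have hXanti : ∀ u, Antitone (X u) := fun u g g' hg =>
    pow_le_pow_of_le_one hs0 hs (Finset.card_le_card (cl_mono hg))
  have hstep : ∀ g, s * ∏ u ∈ A, (if gg g v u then X u g else 1) ≤ s ^ (cl g A v).card := by
    intro g
    rw [← Finset.prod_filter, Finset.prod_pow_eq_pow_sum, ← pow_succ', add_comm]
    exact pow_le_pow_of_le_one hs0 hs (card_cl_le g A v)
  have hharris := harris_prod h0 (fun e => (h1 e).trans (by norm_num)) A
    (f := fun u g => if gg g v u then X u g else 1)
    (fun u g => by split_ifs <;> simp [hX0]) (fun u g g' hg => by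
      dsimp only
      by_cases h2 : gg g v u
      · rw [if_pos h2, if_pos (gg_mono hg h2)]
        exact hXanti u hg
      · rw [if_neg h2]
        split_ifs
        · exact hX1 _ _
        · exact le_rfl)
  have hfac : ∀ u ∈ A, Real.exp (-(pq p v u * (1 + 2 * pq p v u)) * (1 - y)) ≤
      pE (bm p) fun g => if gg g v u then X u g else 1 := by
    intro u hu
    have huv : v ≠ u := fun h => hv (h ▸ hu)
    rw [pE_factor hm huv (X u) fun g g' h => by
      simp only [hX]
      rw [cl_congr (g := g) (g' := g') fun e he1 he2 => h e ?_]
      rw [Finset.insert_erase hu] at he1 he2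
      rintro (⟨h3, h4⟩ | ⟨h3, h4⟩)
      · exact hv (h3 ▸ he1)
      · exact hv (h4 ▸ he2)]
    have h3 := ih (A.erase u) (Finset.erase_ssubset hu) u (Finset.notMem_erase u A)
    have hq := hq0 v u
    have hq' := hq1 v u
    have h4 : pq p v u * (1 - y) ≤ 1 / 2 := by nlinarith
    have h5 : 0 ≤ pq p v u * (1 - y) := mul_nonneg hq (by linarith)
    have h6 := exp_le_one_sub h5 h4
    have h7 : pq p v u * (1 - y) * (2 * (pq p v u * (1 - y))) ≤
        pq p v u * (2 * pq p v u) * (1 - y) := by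
      nlinarith [mul_nonneg (mul_nonneg hq hq) (mul_nonneg hy0 (sub_nonneg.2 hy1))]
    refine le_trans (Real.exp_le_exp.2 ?_) (h6.trans ?_)
    · nlinarith
    · have := mul_le_mul_of_nonneg_left (sub_le_sub_left h3 1) hq
      linarith
  have hprod := Finset.prod_le_prod (fun u _ => (Real.exp_pos _).le) hfac
  rw [← Real.exp_sum, ← Finset.sum_mul, Finset.sum_neg_distrib] at hprod
  have hsum : ∑ u ∈ A, pq p v u * (1 + 2 * pq p v u) ≤ D := by
    refine le_trans (Finset.sum_le_univ_sum_of_nonneg fun u => ?_) (hD v)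
    have := hq0 v u
    positivity
  have hexp : Real.exp (-(D * (1 - y))) ≤
      Real.exp ((-∑ u ∈ A, pq p v u * (1 + 2 * pq p v u)) * (1 - y)) := by
    rw [Real.exp_le_exp]
    nlinarith
  calc y = s * Real.exp (-(D * (1 - y))) := by
        rw [hsdef, mul_assoc, ← Real.exp_add, add_neg_cancel, Real.exp_zero, mul_one]
    _ ≤ s * pE (bm p) (fun g => ∏ u ∈ A, if gg g v u then X u g else 1) :=
        mul_le_mul_of_nonneg_left (hexp.trans (hprod.trans hharris)) hs0
    _ = pE (bm p) (fun g => s * ∏ u ∈ A, if gg g v u then X u g else 1) := (pE_mul_left _ _).symm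
    _ ≤ _ := pE_mono hm.1 hstep

end Tree

section Sizes

lemma branching_mono {D t y : ℝ} (ht : 0 ≤ t) (hty : t ≤ y) (hDy : D * y ≤ 1) :
    t * Real.exp (D * (1 - t)) ≤ y * Real.exp (D * (1 - y)) := by
  have h1 : Real.exp (D * (1 - y)) = Real.exp (D * (1 - t)) * Real.exp (-(D * (y - t))) := by
    rw [← Real.exp_add]; ring_nf
  have h2 := Real.add_one_le_exp (-(D * (y - t)))
  have h3 : t ≤ y * Real.exp (-(D * (y - t))) := by
    refine le_trans ?_ (mul_le_mul_of_nonneg_left h2 (ht.trans hty))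
    nlinarith [mul_nonneg (sub_nonneg.2 hty) (sub_nonneg.2 hDy)]
  rw [h1]
  nlinarith [Real.exp_pos (D * (1 - t))]

lemma inv_size_bound {Ω : Type*} [Fintype Ω] {w : Ω → ℝ} {c : Ω → ℕ} (hw : ∀ ω, 0 ≤ w ω)
    (hc : ∀ ω, 1 ≤ c ω) {D y : ℝ} (hy0 : 0 ≤ y) (hDy : D * y ≤ 1)
    (hs : y * Real.exp (D * (1 - y)) ≤ 1)
    (H : ∀ t, 0 ≤ t → t ≤ y → t ≤ ∑ ω, w ω * (t * Real.exp (D * (1 - t))) ^ c ω) :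
    y - D * y ^ 2 / 2 ≤ ∑ ω, w ω * (1 / (c ω : ℝ)) := by
  set Φ : ℝ → ℝ := fun t =>
    ∑ ω, w ω * ((t * Real.exp (D * (1 - t))) ^ c ω / c ω) - (t - D * t ^ 2 / 2) with hΦ
  have hder : ∀ t, HasDerivAt Φ (∑ ω, w ω * ((t * Real.exp (D * (1 - t))) ^ (c ω - 1) *
      (Real.exp (D * (1 - t)) * (1 - D * t))) - (1 - D * t)) t := by
    intro t
    have h1 : HasDerivAt (fun t => t * Real.exp (D * (1 - t)))
        (Real.exp (D * (1 - t)) * (1 - D * t)) t := by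
      have h2 : HasDerivAt (fun t : ℝ => D * (1 - t)) (D * (-1)) t :=
        ((hasDerivAt_id t).const_sub 1).const_mul D
      exact ((hasDerivAt_id t).mul h2.exp).congr_deriv (by simp only [id]; ring)
    refine HasDerivAt.fun_sub ?_ ?_
    · refine HasDerivAt.fun_sum fun ω _ => HasDerivAt.const_mul _ ?_
      have hc0 : (c ω : ℝ) ≠ 0 := by exact_mod_cast (Nat.one_le_iff_ne_zero.1 (hc ω))
      exact ((h1.pow (c ω)).div_const (c ω : ℝ)).congr_deriv (by
        rw [mul_assoc, mul_div_cancel_left₀ _ hc0])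
    · have h2 : HasDerivAt (fun t : ℝ => D * t ^ 2 / 2) (D * (2 * t) / 2) t := by
        have := ((hasDerivAt_id t).pow 2).const_mul D |>.div_const 2
        simpa using this
      exact ((hasDerivAt_id t).sub h2).congr_deriv (by ring)
  have hmono : MonotoneOn Φ (Set.Icc 0 y) := by
    refine monotoneOn_of_deriv_nonneg (convex_Icc 0 y)
      (fun t _ => (hder t).continuousAt.continuousWithinAt)
      (fun t _ => (hder t).differentiableAt.differentiableWithinAt) fun t ht => ?_
    rw [interior_Icc] at ht
    rw [(hder t).deriv]
    have h1 := H t ht.1.le ht.2.le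
    have h2 : t * ∑ ω, w ω * ((t * Real.exp (D * (1 - t))) ^ (c ω - 1) *
        (Real.exp (D * (1 - t)) * (1 - D * t))) =
        (1 - D * t) * ∑ ω, w ω * (t * Real.exp (D * (1 - t))) ^ c ω := by
      rw [Finset.mul_sum, Finset.mul_sum]
      refine Finset.sum_congr rfl fun ω _ => ?_
      conv_rhs => rw [← Nat.sub_add_cancel (hc ω), pow_succ]
      ring
    have h3 : 0 ≤ 1 - D * t := by
      rcases le_or_gt D 0 with hD | hD
      · nlinarith [ht.1]
      · nlinarith [ht.2]
    refine nonneg_of_mul_nonneg_right (a := t) ?_ ht.1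
    rw [mul_sub, h2]
    nlinarith [mul_nonneg h3 (sub_nonneg.2 h1)]
  have h0 := hmono (Set.left_mem_Icc.2 hy0) (Set.right_mem_Icc.2 hy0) hy0
  have h1 : Φ 0 = 0 := by
    simp only [hΦ]
    rw [Finset.sum_eq_zero]
    · simp
    · intro ω _
      simp [Nat.one_le_iff_ne_zero.1 (hc ω)]
  rw [h1] at h0
  refine le_trans (sub_nonneg.1 h0)
    (Finset.sum_le_sum fun ω _ => mul_le_mul_of_nonneg_left
      (div_le_div_of_nonneg_right (pow_le_one₀ (by positivity) hs) (Nat.cast_nonneg _)) (hw ω))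

variable {n R : ℕ} {p : VPair n → ℝ} {A : Finset (Fin n)} {D y : ℝ}

lemma le_prob_small (h0 : ∀ e, 0 ≤ p e) (h1 : ∀ e, p e ≤ 1 / 2)
    (hD : ∀ v, ∑ u, pq p v u * (1 + 2 * pq p v u) ≤ D) (hy0 : 0 ≤ y) (hy1 : y ≤ 1)
    (hs : y * Real.exp (D * (1 - y)) ≤ 1) (v : Fin n) :
    y - (y * Real.exp (D * (1 - y))) ^ R ≤
      pE (bm p) fun g => if (cc g v).card ≤ R then 1 else 0 := by
  have hm : IsP (bm p) := isP_bm h0 fun e => (h1 e).trans (by norm_num)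
  have hs0 : 0 ≤ y * Real.exp (D * (1 - y)) := by positivity
  have h2 := tree_bound h0 h1 hD hy0 hy1 hs Finset.univ v
  have h3 : pE (bm p) (fun g => (y * Real.exp (D * (1 - y))) ^ (cl g Finset.univ v).card) ≤
      pE (bm p) fun g => (if (cc g v).card ≤ R then (1 : ℝ) else 0) +
        (y * Real.exp (D * (1 - y))) ^ R := by
    refine pE_mono hm.1 fun g => ?_
    have h4 := pow_nonneg hs0 R
    split_ifs with h
    · have := pow_le_one₀ (n := (cl g Finset.univ v).card) hs0 hs
      linarith
    · rw [zero_add]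
      exact pow_le_pow_of_le_one hs0 hs (not_le.1 h).le
  rw [pE_add, pE_const hm] at h3
  linarith

lemma le_mean_inv_size (h0 : ∀ e, 0 ≤ p e) (h1 : ∀ e, p e ≤ 1 / 2)
    (hD : ∀ v, ∑ u, pq p v u * (1 + 2 * pq p v u) ≤ D) (hy0 : 0 ≤ y) (hy1 : y ≤ 1)
    (hDy : D * y ≤ 1) (hs : y * Real.exp (D * (1 - y)) ≤ 1) (hR : 0 < R) (v : Fin n) :
    y - D * y ^ 2 / 2 - 1 / (2 * R) ≤
      pE (bm p) fun g => if (cc g v).card ≤ 2 * R then 1 / ((cc g v).card : ℝ) else 0 := by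
  have hm : IsP (bm p) := isP_bm h0 fun e => (h1 e).trans (by norm_num)
  have hR' : (0 : ℝ) < R := by exact_mod_cast hR
  have h2 := inv_size_bound (w := pw (bm p)) (c := fun g => (cc g v).card) (pw_nonneg hm.1)
    (fun g => Finset.card_pos.2 ⟨v, self_mem_cc⟩) hy0 hDy hs fun t ht hty =>
      tree_bound h0 h1 hD ht (hty.trans hy1) ((branching_mono ht hty hDy).trans hs) Finset.univ v
  have h3 : pE (bm p) (fun g => 1 / ((cc g v).card : ℝ)) ≤
      pE (bm p) fun g => (if (cc g v).card ≤ 2 * R then 1 / ((cc g v).card : ℝ) else 0) +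
        1 / (2 * R) := by
    refine pE_mono hm.1 fun g => ?_
    split_ifs with h
    · have : 0 ≤ 1 / (2 * (R : ℝ)) := by positivity
      linarith
    · rw [zero_add]
      refine one_div_le_one_div_of_le (by positivity) ?_
      exact_mod_cast (not_le.1 h).le
  rw [pE_add, pE_const hm] at h3
  exact sub_le_iff_le_add.2 (h2.trans h3)

end Sizes

section Cuts

variable {n R : ℕ} {p : VPair n → ℝ} {C : ℝ} {S : Finset (Fin n)} {u v : Fin n}

lemma cc_eq_congr {g g' : VPair n → Bool} (hu : u ∈ S)
    (h : ∀ e : VPair n, e.1.1 ∈ S ∨ e.1.2 ∈ S → g e = g' e) : cc g u = S ↔ cc g' u = S := by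
  have key : ∀ {g g' : VPair n → Bool},
      (∀ e : VPair n, e.1.1 ∈ S ∨ e.1.2 ∈ S → g e = g' e) → cc g u = S → cc g' u = S := by
    intro g g' h hS
    have hgg : ∀ {g g' : VPair n → Bool},
        (∀ e : VPair n, e.1.1 ∈ S ∨ e.1.2 ∈ S → g e = g' e) →
        ∀ s ∈ S, ∀ t, gg g s t → gg g' s t := by
      rintro g g' h s hs t ⟨e, h1, h2⟩
      refine ⟨e, ?_, h2⟩
      rw [← h e]
      · exact h1
      · rcases h2 with ⟨h2, _⟩ | ⟨_, h2⟩
        · exact Or.inl (h2.symm ▸ hs)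
        · exact Or.inr (h2.symm ▸ hs)
    refine (cl_subset_of_closed hu fun s hs t _ hst => ?_).antisymm ?_
    · rw [← hS] at hs ⊢
      exact cc_step hs (hgg (fun e he => (h e he).symm) s (hS ▸ hs) t hst)
    · have : cc g u ⊆ cc g u ∩ cc g' u :=
        cl_subset_of_closed (Finset.mem_inter.2 ⟨self_mem_cc, self_mem_cc⟩) fun s hs t _ hst => by
          rw [Finset.mem_inter] at hs ⊢
          exact ⟨cc_step hs.1 hst, cc_step hs.2 (hgg h s (hS ▸ hs.1) t hst)⟩
      rw [hS] at this
      exact fun s hs => (Finset.mem_inter.1 (this hs)).2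
  exact ⟨key h, key fun e he => (h e he).symm⟩

lemma prob_small_avoid_le (h0 : ∀ e, 0 ≤ p e) (h1 : ∀ e, p e ≤ 1) (hC0 : 0 ≤ C)
    (hC : ∀ e, p e ≤ C) (hv : v ∉ S) :
    pE (bm p) (fun g => if (cl g Sᶜ v).card ≤ R then 1 else 0) ≤
      pE (bm p) (fun g => if (cc g v).card ≤ R then 1 else 0) + S.card * (C * R) := by
  have hm : IsP (bm p) := isP_bm h0 h1
  set X : Fin n → (VPair n → Bool) → ℝ := fun t g =>
    if t ∈ cl g Sᶜ v ∧ (cl g Sᶜ v).card ≤ R then 1 else 0 with hX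
  have hX0 : ∀ t g, 0 ≤ X t g := fun t g => by simp only [hX]; split_ifs <;> norm_num
  have hins : insert v Sᶜ = Sᶜ := Finset.insert_eq_self.2 (Finset.mem_compl.2 hv)
  have hpt : ∀ g, (if (cl g Sᶜ v).card ≤ R then (1 : ℝ) else 0) ≤
      (if (cc g v).card ≤ R then 1 else 0) +
        ∑ s ∈ S, ∑ t, (if gg g t s then 1 else 0) * X t g := by
    intro g
    have hnn : ∀ s t, 0 ≤ (if gg g t s then 1 else 0) * X t g := fun s t =>
      mul_nonneg (by split_ifs <;> norm_num) (hX0 t g)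
    have hsum : 0 ≤ ∑ s ∈ S, ∑ t, (if gg g t s then 1 else 0) * X t g :=
      Finset.sum_nonneg fun s _ => Finset.sum_nonneg fun t _ => hnn s t
    by_cases h2 : (cl g Sᶜ v).card ≤ R
    · by_cases h3 : (cc g v).card ≤ R
      · rw [if_pos h2, if_pos h3]; linarith
      · rw [if_pos h2, if_neg h3, zero_add]
        have : ∃ t ∈ cl g Sᶜ v, ∃ s ∉ cl g Sᶜ v, gg g t s := by
          by_contra! hcon
          exact h3 ((Finset.card_le_card (cc_subset_of_closed self_mem_cl hcon)).trans h2)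
        obtain ⟨t, ht, s, hs, hts⟩ := this
        have hsS : s ∈ S := by
          by_contra hsS
          exact hs (cl_step ht hts (Finset.mem_compl.2 hsS))
        refine le_trans (le_trans (le_of_eq ?_) (Finset.single_le_sum
          (f := fun t => (if gg g t s then 1 else 0) * X t g) (fun t _ => hnn s t)
          (Finset.mem_univ t))) (Finset.single_le_sum
          (f := fun s => ∑ t, (if gg g t s then 1 else 0) * X t g)
          (fun s _ => Finset.sum_nonneg fun t _ => hnn s t) hsS)
        simp only [hX]
        rw [if_pos hts, if_pos ⟨ht, h2⟩, one_mul]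
    · rw [if_neg h2]
      have : (0 : ℝ) ≤ if (cc g v).card ≤ R then 1 else 0 := by split_ifs <;> norm_num
      linarith
  refine (pE_mono hm.1 hpt).trans ?_
  rw [pE_add, pE_sum]
  refine add_le_add le_rfl ?_
  rw [← nsmul_eq_mul, ← Finset.sum_const]
  refine Finset.sum_le_sum fun s hs => ?_
  rw [pE_sum]
  have hterm : ∀ t, pE (bm p) (fun g => (if gg g t s then 1 else 0) * X t g) ≤
      C * pE (bm p) (X t) := by
    intro t
    by_cases ht : t ∈ S
    · have hzero : ∀ g, (if gg g t s then (1 : ℝ) else 0) * X t g = 0 := by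
        intro g
        have : t ∉ cl g Sᶜ v := fun h => by
          have := cl_subset_insert h
          rw [hins, Finset.mem_compl] at this
          exact this ht
        simp [hX, this]
      simp only [hzero]
      rw [pE_const hm]
      exact mul_nonneg hC0 (pE_nonneg hm.1 (hX0 t))
    · rw [pE_edge_mul hm (fun h : t = s => ht (h ▸ hs)) (X t) fun g g' h => ?_]
      · exact mul_le_mul_of_nonneg_right (pq_le hC0 hC t s) (pE_nonneg hm.1 (hX0 t))
      · simp only [hX]
        rw [cl_congr (g := g) (g' := g') fun e he1 he2 => h e ?_]
        rw [hins, Finset.mem_compl] at he1 he2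
        rintro (⟨_, h4⟩ | ⟨h3, _⟩)
        · exact he2 (h4 ▸ hs)
        · exact he1 (h3 ▸ hs)
  refine (Finset.sum_le_sum fun t _ => hterm t).trans ?_
  rw [← Finset.mul_sum, ← pE_sum]
  refine mul_le_mul_of_nonneg_left ?_ hC0
  rw [← pE_const hm (R : ℝ)]
  refine pE_mono hm.1 fun g => ?_
  simp only [hX]
  by_cases h2 : (cl g Sᶜ v).card ≤ R
  · simp only [h2, and_true, Finset.sum_boole, Finset.filter_univ_mem]
    exact_mod_cast h2
  · simp [h2]

lemma prob_both_small_le (h0 : ∀ e, 0 ≤ p e) (h1 : ∀ e, p e ≤ 1) (hC0 : 0 ≤ C)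
    (hC : ∀ e, p e ≤ C) (u v : Fin n) :
    pE (bm p) (fun g => if v ∉ cc g u ∧ (cc g u).card ≤ R ∧ (cc g v).card ≤ R then 1 else 0) ≤
      pE (bm p) (fun g => if (cc g u).card ≤ R then 1 else 0) *
        (pE (bm p) (fun g => if (cc g v).card ≤ R then 1 else 0) + C * R ^ 2) := by
  have hm : IsP (bm p) := isP_bm h0 h1
  set F : Finset (Finset (Fin n)) :=
    Finset.univ.filter fun S => u ∈ S ∧ v ∉ S ∧ S.card ≤ R with hF
  have hpt : ∀ g, (if v ∉ cc g u ∧ (cc g u).card ≤ R ∧ (cc g v).card ≤ R then (1 : ℝ) else 0) ≤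
      ∑ S ∈ F, (if cc g u = S then 1 else 0) * (if (cl g Sᶜ v).card ≤ R then 1 else 0) := by
    intro g
    have hnn : ∀ S : Finset (Fin n), (0 : ℝ) ≤
        (if cc g u = S then 1 else 0) * (if (cl g Sᶜ v).card ≤ R then 1 else 0) := fun S =>
      mul_nonneg (by split_ifs <;> norm_num) (by split_ifs <;> norm_num)
    split_ifs with h
    · refine le_trans (le_of_eq ?_) (Finset.single_le_sum (f := fun S : Finset (Fin n) =>
        (if cc g u = S then (1 : ℝ) else 0) * (if (cl g Sᶜ v).card ≤ R then 1 else 0))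
        (fun S _ => hnn S) (Finset.mem_filter.2 ⟨Finset.mem_univ (cc g u),
          self_mem_cc, h.1, h.2.1⟩ : cc g u ∈ F))
      rw [if_pos rfl, if_pos ((Finset.card_le_card cl_subset_cc).trans h.2.2), one_mul]
    · exact Finset.sum_nonneg fun S _ => hnn S
  refine (pE_mono hm.1 hpt).trans ?_
  rw [pE_sum]
  have hterm : ∀ S ∈ F, pE (bm p) (fun g => (if cc g u = S then 1 else 0) *
      (if (cl g Sᶜ v).card ≤ R then 1 else 0)) ≤
      pE (bm p) (fun g => if cc g u = S then 1 else 0) *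
        (pE (bm p) (fun g => if (cc g v).card ≤ R then 1 else 0) + C * R ^ 2) := by
    intro S hS
    obtain ⟨hu, hv, hcard⟩ := (Finset.mem_filter.1 hS).2
    have hcard' : (S.card : ℝ) ≤ R := by exact_mod_cast hcard
    rw [pE_mul_of_disjoint hm (Finset.univ.filter fun e : VPair n => e.1.1 ∈ S ∨ e.1.2 ∈ S)
      (fun g => if cc g u = S then (1 : ℝ) else 0)
      (fun g => if (cl g Sᶜ v).card ≤ R then (1 : ℝ) else 0)]
    · refine mul_le_mul_of_nonneg_left ?_ (pE_nonneg hm.1 fun g => by split_ifs <;> norm_num)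
      refine (prob_small_avoid_le h0 h1 hC0 hC hv).trans (add_le_add le_rfl ?_)
      have : 0 ≤ C * R := by positivity
      nlinarith
    · intro g g' h
      simp only [cc_eq_congr hu fun e he => h e (Finset.mem_filter.2 ⟨Finset.mem_univ e, he⟩)]
    · intro g g' h
      rw [cl_congr (g := g) (g' := g') fun e he1 he2 => h e ?_]
      rw [Finset.insert_eq_self.2 (Finset.mem_compl.2 hv), Finset.mem_compl] at he1 he2
      intro he
      exact (Finset.mem_filter.1 he).2.elim he1 he2
  refine (Finset.sum_le_sum hterm).trans ?_
  rw [← Finset.sum_mul, ← pE_sum]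
  refine mul_le_mul_of_nonneg_right ?_ (add_nonneg (pE_nonneg hm.1 fun g => by
    split_ifs <;> norm_num) (by positivity))
  refine pE_mono hm.1 fun g => ?_
  rw [Finset.sum_ite_eq]
  split_ifs with h2 h3
  · exact le_rfl
  · exact absurd (Finset.mem_filter.1 h2).2.2.2 h3
  · norm_num
  · norm_num

lemma le_prob_sep (h0 : ∀ e, 0 ≤ p e) (h1 : ∀ e, p e ≤ 1) (hC0 : 0 ≤ C)
    (hC : ∀ e, p e ≤ C) {θ : ℝ} (hθ1 : θ ≤ 1)
    (hθ : ∀ v, θ ≤ pE (bm p) fun g => if (cc g v).card ≤ R then 1 else 0) (u v : Fin n) :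
    2 * θ - θ ^ 2 - C * R ^ 2 -
      2 * pE (bm p) (fun g => if v ∈ cc g u ∧ (cc g u).card ≤ R then 1 else 0) ≤
      pE (bm p) fun g => if Sep g R u v then 1 else 0 := by
  have hm : IsP (bm p) := isP_bm h0 h1
  have hle : ∀ v, pE (bm p) (fun g => if (cc g v).card ≤ R then (1 : ℝ) else 0) ≤ 1 := fun v => by
    refine (pE_mono hm.1 fun g => ?_).trans (le_of_eq (pE_const hm 1))
    split_ifs <;> norm_num
  have hb := prob_both_small_le (R := R) h0 h1 hC0 hC u v
  have hpt : ∀ g, (if (cc g u).card ≤ R then (1 : ℝ) else 0) +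
      (if (cc g v).card ≤ R then 1 else 0) -
      (if v ∉ cc g u ∧ (cc g u).card ≤ R ∧ (cc g v).card ≤ R then 1 else 0) -
      2 * (if v ∈ cc g u ∧ (cc g u).card ≤ R then 1 else 0) ≤
      if Sep g R u v then 1 else 0 := by
    intro g
    unfold Sep
    by_cases h : v ∈ cc g u
    · rw [cc_eq_of_mem h]
      by_cases h2 : (cc g u).card ≤ R <;> simp [h, h2]; norm_num
    · by_cases h2 : (cc g u).card ≤ R <;> by_cases h3 : (cc g v).card ≤ R <;> simp [h, h2, h3]
  have hE := pE_mono hm.1 hpt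
  rw [pE_sub, pE_sub, pE_add, pE_mul_left] at hE
  refine le_trans ?_ hE
  have hu := hθ u
  have hv := hθ v
  have hu1 := hle u
  have hv1 := hle v
  have h2 : 0 ≤ C * (R : ℝ) ^ 2 := by positivity
  set x := pE (bm p) (fun g => if (cc g u).card ≤ R then (1 : ℝ) else 0)
  set y := pE (bm p) (fun g => if (cc g v).card ≤ R then (1 : ℝ) else 0)
  have h3 : (1 - x) * (1 - y) ≤ (1 - θ) * (1 - θ) :=
    mul_le_mul (by linarith) (by linarith) (by linarith) (by linarith)
  have h4 : x * (C * R ^ 2) ≤ 1 * (C * R ^ 2) := mul_le_mul_of_nonneg_right hu1 h2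
  nlinarith

/-- Lower bound for the expected number of edges cutting off a small component. -/
theorem le_mean_cuts (h0 : ∀ e, 0 ≤ p e) (h1 : ∀ e, p e ≤ 1) (hC0 : 0 ≤ C)
    (hC : ∀ e, p e ≤ C) {θ : ℝ} (hθ1 : θ ≤ 1)
    (hθ : ∀ v, θ ≤ pE (bm p) fun g => if (cc g v).card ≤ R then 1 else 0) :
    (∑ e, p e) * (2 * θ - θ ^ 2 - C * R ^ 2) - C * (n * R) ≤
      pE (bm p) fun g => ((cuts g R).card : ℝ) := by
  have hm : IsP (bm p) := isP_bm h0 h1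
  set Q : Fin n → Fin n → ℝ := fun u v =>
    pE (bm p) (fun g => if v ∈ cc g u ∧ (cc g u).card ≤ R then 1 else 0) with hQ
  have hQ0 : ∀ u v, 0 ≤ Q u v := fun u v => pE_nonneg hm.1 fun g => by split_ifs <;> norm_num
  have hQs : ∀ u v, Q u v = Q v u := by
    intro u v
    simp only [hQ]
    congr 1
    ext g
    by_cases h : v ∈ cc g u
    · rw [cc_eq_of_mem h]
      simp [h, self_mem_cc]
    · have h' : u ∉ cc g v := fun h' => h (mem_cc_comm.1 h')
      simp [h, h']
  have hQsum : ∀ u, ∑ v, Q u v ≤ R := by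
    intro u
    simp only [hQ]
    rw [← pE_sum, ← pE_const hm (R : ℝ)]
    refine pE_mono hm.1 fun g => ?_
    by_cases h2 : (cc g u).card ≤ R
    · simp only [h2, and_true, Finset.sum_boole, Finset.filter_univ_mem]
      exact_mod_cast h2
    · simp [h2]
  have hQe : 2 * ∑ e : VPair n, Q e.1.1 e.1.2 ≤ n * R := by
    have h2 := sum_sum_eq_two_mul_sum_vpair (n := n) Q hQs
    have h3 : ∑ u, ∑ v, Q u v ≤ ∑ _u : Fin n, (R : ℝ) := Finset.sum_le_sum fun u _ => hQsum u
    rw [Finset.sum_const, Finset.card_univ, Fintype.card_fin, nsmul_eq_mul] at h3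
    have h4 : 0 ≤ ∑ u, Q u u := Finset.sum_nonneg fun u _ => hQ0 u u
    linarith
  have hcard : ∀ g, ((cuts g R).card : ℝ) = ∑ e : VPair n, (if g e = true then 1 else 0) *
      (if Sep (Function.update g e false) R e.1.1 e.1.2 then 1 else 0) := by
    intro g
    unfold cuts
    rw [Finset.card_filter]
    push_cast
    refine Finset.sum_congr rfl fun e _ => ?_
    by_cases h2 : g e = true <;> simp [h2]
  simp only [hcard]
  rw [pE_sum]
  have hterm : ∀ e : VPair n, p e * (2 * θ - θ ^ 2 - C * R ^ 2 - 2 * Q e.1.1 e.1.2) ≤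
      pE (bm p) fun g => (if g e = true then 1 else 0) *
        (if Sep (Function.update g e false) R e.1.1 e.1.2 then 1 else 0) := by
    intro e
    rw [pE_mul_of_disjoint hm {e} (fun g => if g e = true then (1 : ℝ) else 0)
      (fun g => if Sep (Function.update g e false) R e.1.1 e.1.2 then (1 : ℝ) else 0),
      pE_single hm e (fun t => if t = true then (1 : ℝ) else 0)]
    · have h2 : ∑ t, bm p e t * (if t = true then (1 : ℝ) else 0) = p e := by simp [bm]
      rw [h2]
      refine mul_le_mul_of_nonneg_left ?_ (h0 e)
      refine (le_prob_sep h0 h1 hC0 hC hθ1 hθ e.1.1 e.1.2).trans (pE_mono hm.1 fun g => ?_)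
      by_cases hS : Sep g R e.1.1 e.1.2
      · have hge : g e = false := by
          by_contra hge
          rw [Bool.not_eq_false] at hge
          exact hS.1 (cc_step self_mem_cc ((gg_pair g e).2 hge))
        rw [show Function.update g e false = g by rw [← hge, Function.update_eq_self]]
      · rw [if_neg hS]
        split_ifs <;> norm_num
    · intro g g' h
      rw [h e (Finset.mem_singleton_self e)]
    · intro g g' h
      have : Function.update g e false = Function.update g' e false := by
        ext e'
        by_cases he : e' = e
        · subst he; simp
        · rw [Function.update_of_ne he, Function.update_of_ne he,
            h e' (fun h' => he (Finset.mem_singleton.1 h'))]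
      rw [this]
  refine le_trans ?_ (Finset.sum_le_sum fun e _ => hterm e)
  have h2 : ∀ e : VPair n, p e * (2 * θ - θ ^ 2 - C * R ^ 2) - 2 * (C * Q e.1.1 e.1.2) ≤
      p e * (2 * θ - θ ^ 2 - C * R ^ 2 - 2 * Q e.1.1 e.1.2) := by
    intro e
    have := mul_le_mul_of_nonneg_right (hC e) (hQ0 e.1.1 e.1.2)
    linarith
  refine le_trans ?_ (Finset.sum_le_sum fun e _ => h2 e)
  rw [Finset.sum_sub_distrib, ← Finset.sum_mul, ← Finset.mul_sum, ← Finset.mul_sum]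
  have := mul_le_mul_of_nonneg_left hQe hC0
  linarith

end Cuts

section PendantBound

variable {n k : ℕ} {a b d δ : ℝ} {x : Fin n → Fin k}

lemma abs_sum_wt_sub_le (hk : 0 < k) (ha : 0 ≤ a) (hb : 0 ≤ b)
    (hd : d = (a + ((k : ℝ) - 1) * b) / k) (hbal : Bal δ x) (i : Fin k) :
    |∑ u, wt a b (x u) i - n * d| ≤ k * max a b * δ * n := by
  have hk' : (0 : ℝ) < k := by exact_mod_cast hk
  have h1 : ∑ u, wt a b (x u) i = ∑ j, wt a b j i * ∑ t, if x t = j then (1 : ℝ) else 0 := by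
    simp only [Finset.mul_sum]
    rw [Finset.sum_comm]
    refine Finset.sum_congr rfl fun u _ => ?_
    simp
  have h2 : n * d = ∑ j, wt a b j i * (n / k) := by
    rw [← Finset.sum_mul, sum_wt_comp (fun t => t), hd]
    field_simp
  rw [h1, h2, ← Finset.sum_sub_distrib]
  refine (Finset.abs_sum_le_sum_abs _ _).trans ?_
  have h3 : ∀ j ∈ (Finset.univ : Finset (Fin k)),
      |wt a b j i * (∑ t, if x t = j then (1 : ℝ) else 0) - wt a b j i * (n / k)| ≤
        max a b * (δ * n) := by
    intro j _
    rw [← mul_sub, abs_mul, abs_of_nonneg (wt_nonneg ha hb j i)]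
    exact mul_le_mul (wt_le a b j i) (hbal j) (abs_nonneg _) (le_max_of_le_left ha)
  refine (Finset.sum_le_sum h3).trans (le_of_eq ?_)
  rw [Finset.sum_const, Finset.card_univ, Fintype.card_fin, nsmul_eq_mul]
  ring

lemma pq_ep_le (ha : 0 ≤ a) (hb : 0 ≤ b) (u v : Fin n) :
    pq (ep n a b x) v u ≤ wt a b (x u) (x v) / n := by
  have h0 : 0 ≤ wt a b (x u) (x v) / n := div_nonneg (wt_nonneg ha hb _ _) (Nat.cast_nonneg n)
  unfold pq ep
  split_ifs
  · simp only [wt, eq_comm]; exact le_rfl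
  · exact le_rfl
  · exact h0

lemma sum_pq_ep_le (hk : 0 < k) (ha : 0 ≤ a) (hb : 0 ≤ b) (hn : 0 < n)
    (hd : d = (a + ((k : ℝ) - 1) * b) / k) (hbal : Bal δ x) (v : Fin n) :
    ∑ u, pq (ep n a b x) v u * (1 + 2 * pq (ep n a b x) v u) ≤
      (d + k * max a b * δ) * (1 + 2 * (max a b / n)) := by
  have hn' : (0 : ℝ) < n := by exact_mod_cast hn
  have hc0 : 0 ≤ max a b := le_max_of_le_left ha
  have hpq : ∀ u, pq (ep n a b x) v u ≤ max a b / n :=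
    pq_le (by positivity) (ep_le x) v
  have h1 : ∀ u ∈ (Finset.univ : Finset (Fin n)),
      pq (ep n a b x) v u * (1 + 2 * pq (ep n a b x) v u) ≤
        wt a b (x u) (x v) / n * (1 + 2 * (max a b / n)) := by
    intro u _
    have h0 := pq_nonneg (ep_nonneg ha hb x) v u
    exact mul_le_mul (pq_ep_le ha hb u v) (by linarith [hpq u]) (by linarith)
      (div_nonneg (wt_nonneg ha hb _ _) hn'.le)
  refine (Finset.sum_le_sum h1).trans ?_
  rw [← Finset.sum_mul, ← Finset.sum_div]
  refine mul_le_mul_of_nonneg_right ?_ (by positivity)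
  rw [div_le_iff₀ hn']
  have := (abs_le.1 (abs_sum_wt_sub_le hk ha hb hd hbal (x v))).2
  linarith

lemma le_sum_ep (hk : 0 < k) (ha : 0 ≤ a) (hb : 0 ≤ b) (hn : 0 < n)
    (hd : d = (a + ((k : ℝ) - 1) * b) / k) (hbal : Bal δ x) :
    (n * (d - k * max a b * δ) - max a b) / 2 ≤ ∑ e, ep n a b x e := by
  have hn' : (0 : ℝ) < n := by exact_mod_cast hn
  have h1 := sum_sum_eq_two_mul_sum_vpair (n := n) (fun u v => wt a b (x u) (x v) / n)
    fun u v => by simp only [wt, eq_comm]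
  have h2 : ∑ v : Fin n, (d - k * max a b * δ) ≤ ∑ v, ∑ u, wt a b (x v) (x u) / n := by
    rw [Finset.sum_comm]
    refine Finset.sum_le_sum fun v _ => ?_
    rw [← Finset.sum_div, le_div_iff₀ hn']
    have := (abs_le.1 (abs_sum_wt_sub_le hk ha hb hd hbal (x v))).1
    linarith
  have h3 : ∑ u, wt a b (x u) (x u) / n ≤ ∑ _u : Fin n, max a b / n :=
    Finset.sum_le_sum fun u _ => div_le_div_of_nonneg_right (wt_le _ _ _ _) hn'.le
  rw [Finset.sum_const, Finset.card_univ, Fintype.card_fin, nsmul_eq_mul] at h2 h3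
  rw [mul_div_cancel₀ _ hn'.ne'] at h3
  have h4 : ∑ e, ep n a b x e = ∑ e : VPair n, wt a b (x e.1.1) (x e.1.2) / n := rfl
  rw [h4]
  linarith

/-- The mean contribution of small components and of small pendant pieces, for a balanced
labelling. -/
lemma le_mean_roots_cuts (hk : 0 < k) (ha : 0 ≤ a) (hb : 0 ≤ b) (hn : 0 < n)
    (hd : d = (a + ((k : ℝ) - 1) * b) / k) (hcn : 2 * max a b ≤ n) (hbal : Bal δ x)
    {D y l μ θ : ℝ} {R : ℕ} (hD : (d + k * max a b * δ) * (1 + 2 * (max a b / n)) ≤ D)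
    (hy0 : 0 ≤ y) (hy1 : y ≤ 1) (hDy : D * y ≤ 1) (hs : y * Real.exp (D * (1 - y)) ≤ 1)
    (hR : 0 < R) (hl : 0 ≤ l) (hμ : 0 ≤ μ) (hθ : θ = y - (y * Real.exp (D * (1 - y))) ^ R)
    (hθ2 : 0 ≤ 2 * θ - θ ^ 2 - max a b / n * R ^ 2) :
    n * (l * (y - D * y ^ 2 / 2 - 1 / (2 * R)) +
      μ * ((d - k * max a b * δ - max a b / n) / 2 * (2 * θ - θ ^ 2 - max a b / n * R ^ 2) -
        max a b / n * R)) ≤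
      pE (bm (ep n a b x)) fun g => (roots g R).card * l + (cuts g R).card * μ := by
  have hn' : (0 : ℝ) < n := by exact_mod_cast hn
  have hc0 : 0 ≤ max a b := le_max_of_le_left ha
  have h0 := ep_nonneg (n := n) ha hb x
  have h1 : ∀ e, ep n a b x e ≤ 1 / 2 := fun e => (ep_le x e).trans (by
    rw [div_le_iff₀ hn']; linarith)
  have h1' : ∀ e, ep n a b x e ≤ 1 := fun e => (h1 e).trans (by norm_num)
  have hm := isP_bm h0 h1'
  have hrow : ∀ v, ∑ u, pq (ep n a b x) v u * (1 + 2 * pq (ep n a b x) v u) ≤ D := fun v =>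
    (sum_pq_ep_le hk ha hb hn hd hbal v).trans hD
  have hroots : n * (y - D * y ^ 2 / 2 - 1 / (2 * R)) ≤
      pE (bm (ep n a b x)) fun g => ((roots g R).card : ℝ) := by
    refine le_trans ?_ (pE_mono hm.1 fun g => le_card_roots (g := g) (R := R))
    rw [pE_sum]
    refine le_trans (le_of_eq ?_) (Finset.sum_le_sum fun v _ =>
      le_mean_inv_size h0 h1 hrow hy0 hy1 hDy hs hR v)
    rw [Finset.sum_const, Finset.card_univ, Fintype.card_fin, nsmul_eq_mul]
  have hθ1 : θ ≤ 1 := by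
    have : 0 ≤ (y * Real.exp (D * (1 - y))) ^ R := by positivity
    linarith
  have hcuts := le_mean_cuts (C := max a b / n) (R := R) h0 h1' (by positivity) (ep_le x) hθ1
    fun v => hθ ▸ le_prob_small h0 h1 hrow hy0 hy1 hs v
  have hsum := mul_le_mul_of_nonneg_right (le_sum_ep hk ha hb hn hd hbal) hθ2
  have hcuts' : n * ((d - k * max a b * δ - max a b / n) / 2 *
      (2 * θ - θ ^ 2 - max a b / n * R ^ 2) - max a b / n * R) ≤
      pE (bm (ep n a b x)) fun g => ((cuts g R).card : ℝ) := by
    refine le_trans (le_of_eq ?_) ((sub_le_sub_right hsum _).trans hcuts)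
    field_simp
  rw [pE_add]
  have e1 : pE (bm (ep n a b x)) (fun g => ((roots g R).card : ℝ) * l) =
      l * pE (bm (ep n a b x)) fun g => ((roots g R).card : ℝ) := by
    rw [← pE_mul_left]; simp only [mul_comm]
  have e2 : pE (bm (ep n a b x)) (fun g => ((cuts g R).card : ℝ) * μ) =
      μ * pE (bm (ep n a b x)) fun g => ((cuts g R).card : ℝ) := by
    rw [← pE_mul_left]; simp only [mul_comm]
  rw [e1, e2]
  have := mul_le_mul_of_nonneg_left hroots hl
  have := mul_le_mul_of_nonneg_left hcuts' hμ
  linarith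

lemma exists_subcritical {η h l H : ℝ} (hd0 : 0 < d) (hη0 : 0 < η) (hη1 : η < 1)
    (hdη : d * η < 1) (hη : η * Real.exp (d * (1 - η)) = 1)
    (hh : h < l * (η - d * η ^ 2 / 2) + H * (d / 2 * (2 * η - η ^ 2))) :
    ∃ y D, 0 < y ∧ y < 1 ∧ d < D ∧ D * y < 1 ∧ y * Real.exp (D * (1 - y)) < 1 ∧
      h < l * (y - D * y ^ 2 / 2) + H * (d / 2 * (2 * y - y ^ 2)) := by
  have hc1 : Continuous fun y => l * (y - d * y ^ 2 / 2) + H * (d / 2 * (2 * y - y ^ 2)) := by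
    fun_prop
  have ev1 := hc1.continuousAt.eventually (lt_mem_nhds hh)
  obtain ⟨y, ⟨h1, hy0⟩, hyη⟩ := (((ev1.and (lt_mem_nhds hη0)).filter_mono
    nhdsWithin_le_nhds).and
    (self_mem_nhdsWithin : ∀ᶠ y in nhdsWithin η (Set.Iio η), y ∈ Set.Iio η)).exists
  have hyη : y < η := hyη
  have hs : y * Real.exp (d * (1 - y)) < 1 := by
    have h2 : d * (η - y) ≤ 1 / η * (η - y) := by
      refine mul_le_mul_of_nonneg_right ?_ (by linarith)
      rw [le_div_iff₀ hη0]; exact hdη.le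
    have h3 : 1 / η * (η - y) = 1 - y / η := by field_simp
    have h4 : -(d * (η - y)) + 1 < Real.exp (-(d * (η - y))) :=
      Real.add_one_lt_exp (by have := mul_pos hd0 (sub_pos.2 hyη); linarith)
    have h5 : y / η < Real.exp (-(d * (η - y))) := by linarith
    rw [div_lt_iff₀ hη0] at h5
    calc y * Real.exp (d * (1 - y)) < Real.exp (-(d * (η - y))) * η * Real.exp (d * (1 - y)) :=
          mul_lt_mul_of_pos_right h5 (Real.exp_pos _)
      _ = η * Real.exp (d * (1 - η)) := by
          rw [mul_comm (Real.exp _) η, mul_assoc, ← Real.exp_add]; ring_nf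
      _ = 1 := hη
  have hc2 : Continuous fun D => l * (y - D * y ^ 2 / 2) + H * (d / 2 * (2 * y - y ^ 2)) := by
    fun_prop
  have hc3 : Continuous fun D => D * y := by fun_prop
  have hc4 : Continuous fun D => y * Real.exp (D * (1 - y)) := by fun_prop
  have hdy : d * y < 1 := (mul_lt_mul_of_pos_left hyη hd0).trans hdη
  obtain ⟨D, ⟨h2, h3, h4⟩, hD⟩ := ((((hc2.continuousAt.eventually (lt_mem_nhds h1)).and
    ((hc3.continuousAt.eventually (gt_mem_nhds hdy)).and
    (hc4.continuousAt.eventually (gt_mem_nhds hs)))).filter_mono nhdsWithin_le_nhds).and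
    (self_mem_nhdsWithin : ∀ᶠ D in nhdsWithin d (Set.Ioi d), D ∈ Set.Ioi d)).exists
  exact ⟨y, D, hy0, hyη.trans hη1, hD, h3, h4, h2⟩

/-- The entropy bound coming from small components and pendant pieces of the graph. -/
theorem entropy_pend_bound (hk : 2 ≤ k) (ha : 0 ≤ a) (hb : 0 ≤ b)
    (hd : d = (a + ((k : ℝ) - 1) * b) / k) (hd0 : 0 < d) {η h : ℝ} (hη0 : 0 < η) (hη1 : η < 1)
    (hdη : d * η < 1) (hη : η * Real.exp (d * (1 - η)) = 1) (hh0 : 0 ≤ h)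
    (hh : h < Real.log k * (η - d * η ^ 2 / 2) +
      max (edgeEnt k a b d) 0 * (d / 2 * (2 * η - η ^ 2))) :
    ∀ᶠ n : ℕ in atTop,
      n * h ≤ sE n a b fun (x : Fin n → Fin k) g => -Real.log (post n a b x g) := by
  have hk0 : 0 < k := by omega
  have hlogk : 0 < Real.log k := Real.log_pos (by exact_mod_cast hk)
  set c := max a b with hc
  set H := edgeEnt k a b d with hH
  have hc0 : 0 ≤ c := le_max_of_le_left ha
  obtain ⟨y, D, hy0, hy1, hdD, hDy, hs, h1⟩ := exists_subcritical hd0 hη0 hη1 hdη hη hh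
  set σ := y * Real.exp (D * (1 - y)) with hσ
  have hσ0 : 0 ≤ σ := by positivity
  have hθlim : Tendsto (fun R : ℕ => y - σ ^ R) atTop (nhds y) := by
    simpa using (tendsto_pow_atTop_nhds_zero_of_lt_one hσ0 hs).const_sub y
  have hRlim : Tendsto (fun R : ℕ => (1 : ℝ) / (2 * R)) atTop (nhds 0) := by
    have := (tendsto_const_div_atTop_nhds_zero_nat (1 / 2 : ℝ))
    refine this.congr fun R => ?_
    rw [div_div]
  have hlim : Tendsto (fun R : ℕ => Real.log k * (y - D * y ^ 2 / 2 - 1 / (2 * R)) +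
      max H 0 * (d / 2 * (2 * (y - σ ^ R) - (y - σ ^ R) ^ 2))) atTop
      (nhds (Real.log k * (y - D * y ^ 2 / 2 - 0) + max H 0 * (d / 2 * (2 * y - y ^ 2)))) :=
    ((hRlim.const_sub _).const_mul _).add
      ((((hθlim.const_mul 2).sub (hθlim.pow 2)).const_mul _).const_mul _)
  rw [sub_zero] at hlim
  obtain ⟨R, h2, hθ0, hR⟩ := ((hlim.eventually (lt_mem_nhds h1)).and
    ((hθlim.eventually (lt_mem_nhds hy0)).and (eventually_gt_atTop 0))).exists
  set θ := y - σ ^ R with hθ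
  have hθ1 : θ ≤ 1 := by have := pow_nonneg hσ0 R; linarith
  set G : ℝ → ℝ → ℝ := fun δ t =>
    (Real.log k - 24 * R * c * δ) * (y - D * y ^ 2 / 2 - 1 / (2 * R)) +
      max (Real.exp (-(24 * R * c * δ)) * H - 24 * R * c * δ) 0 *
        ((d - k * c * δ - c * t) / 2 * (2 * θ - θ ^ 2 - c * t * R ^ 2) - c * t * R) with hG
  have hc1 : Continuous fun δ => G δ 0 := by simp only [hG]; fun_prop
  have hc2 : Continuous fun δ => Real.log k - 24 * R * c * δ := by fun_prop
  have hc3 : Continuous fun δ => d + k * c * δ := by fun_prop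
  have hG0 : h < G 0 0 := by simpa [hG] using h2
  obtain ⟨δ, ⟨h3, h4, h5⟩, hδ⟩ := ((((hc1.continuousAt.eventually (lt_mem_nhds hG0)).and
    ((hc2.continuousAt.eventually (lt_mem_nhds (by simpa using hlogk))).and
    (hc3.continuousAt.eventually (gt_mem_nhds (by simpa using hdD))))).filter_mono
    nhdsWithin_le_nhds).and
    (self_mem_nhdsWithin : ∀ᶠ δ in nhdsWithin (0 : ℝ) (Set.Ioi 0), δ ∈ Set.Ioi (0 : ℝ))).exists
  have hδ : 0 < δ := hδ
  obtain ⟨m, hm1, hm2⟩ := exists_between h3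
  have hinv : Tendsto (fun n : ℕ => (1 : ℝ) / n) atTop (nhds 0) :=
    tendsto_const_div_atTop_nhds_zero_nat 1
  have hc4 : Continuous fun t => G δ t := by simp only [hG]; fun_prop
  have hc5 : Continuous fun t => (d + k * c * δ) * (1 + 2 * (c * t)) := by fun_prop
  have hc6 : Continuous fun t => 2 * θ - θ ^ 2 - c * t * R ^ 2 := by fun_prop
  filter_upwards [eventually_le_mul_one_sub (k := k) hm1 (δ ^ 2), eventually_gt_atTop 0,
    (tendsto_natCast_atTop_atTop (R := ℝ)).eventually_ge_atTop (2 * c),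
    (tendsto_natCast_atTop_atTop (R := ℝ)).eventually_ge_atTop (1 / δ),
    (tendsto_natCast_atTop_atTop (R := ℝ)).eventually_ge_atTop (2 * R / δ),
    hinv.eventually (hc4.continuousAt.eventually (lt_mem_nhds hm2)),
    hinv.eventually (hc5.continuousAt.eventually (gt_mem_nhds
      (show (d + k * c * δ) * (1 + 2 * (c * 0)) < D by simpa using h5))),
    hinv.eventually (hc6.continuousAt.eventually (lt_mem_nhds (a := 0) (by
      have : 0 < θ * (2 - θ) := mul_pos hθ0 (by linarith)
      simp only [mul_zero, zero_mul, sub_zero]; linarith)))]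
    with n h6 hn hcn h7 h8 h9 h10 h11
  have hn' : (0 : ℝ) < n := by exact_mod_cast hn
  rw [div_le_iff₀ hδ] at h7 h8
  have hε : 2 * R * (4 * (2 * δ * n + 1) * c / n) ≤ 24 * R * c * δ := by
    have : 4 * (2 * δ * n + 1) * c / n ≤ 12 * δ * c := by
      rw [div_le_iff₀ hn']
      have := mul_le_mul_of_nonneg_left h7 hc0
      linarith only [this]
    have := mul_le_mul_of_nonneg_left this (by positivity : (0 : ℝ) ≤ 2 * R)
    linarith only [this]
  refine h6.trans (le_trans ?_ (sE_roots_cuts_le (R := R) hk0 ha hb hd hd0 hcn hn hδ.le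
    (by linarith only [h8]) hε))
  refine le_sE_of_bal hk0 hn hδ (mul_nonneg hn'.le (hh0.trans hm1.le)) _ fun x => ?_
  by_cases hbal : Bal δ x
  · simp only [if_pos hbal]
    have hcn1 : c * (1 / n) = c / n := by ring
    simp only [hG, hcn1] at h9 h10 h11
    exact (mul_le_mul_of_nonneg_left h9.le hn'.le).trans
      (le_mean_roots_cuts hk0 ha hb hn hd hcn hbal h10.le hy0.le hy1.le hDy.le hs.le hR h4.le
        (le_max_right _ _) hθ h11.le)
  · simp [hbal, pE]

end PendantBound

section Thresholds

variable {k : ℕ} {a b d : ℝ}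

lemma edgeEnt_eq (hk : 0 < k) (hd : d = (a + ((k : ℝ) - 1) * b) / k) (hd0 : 0 < d) :
    edgeEnt k a b d = Real.log k - infoGain k a b d / d := by
  have hk' : (0 : ℝ) < k := by exact_mod_cast hk
  have hkd : (k : ℝ) * d = a + ((k : ℝ) - 1) * b := by rw [hd]; field_simp
  have hS : 0 < (k : ℝ) * d := by positivity
  have key : ∀ w : ℝ, w / (k * d) * -Real.log (w / (k * d)) =
      (w * Real.log (k * d) - w * Real.log w) / (k * d) := by
    intro w
    rcases eq_or_ne w 0 with rfl | hw
    · simp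
    · rw [Real.log_div hw hS.ne']; ring
  unfold edgeEnt infoGain
  rw [key, key, Real.log_mul hk'.ne' hd0.ne']
  have h1 : (a * (Real.log k + Real.log d) - a * Real.log a) / (k * d) +
      ((k : ℝ) - 1) * ((b * (Real.log k + Real.log d) - b * Real.log b) / (k * d)) =
      ((k * d) * (Real.log k + Real.log d) -
        (a * Real.log a + ((k : ℝ) - 1) * (b * Real.log b))) / (k * d) := by
    rw [hkd]; ring
  rw [h1]
  field_simp
  ring

lemma log_lt_of_pend {η : ℝ} (hk : 0 < k) (hd : d = (a + ((k : ℝ) - 1) * b) / k) (hd0 : 0 < d)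
    (hη0 : 0 < η) (hη1 : η < 1)
    (hI : (1 - d * η) / (1 - η) * (2 * Real.log k) < infoGain k a b d) :
    Real.log k < infoGain k a b d / 2 + (Real.log k * (η - d * η ^ 2 / 2) +
      max (edgeEnt k a b d) 0 * (d / 2 * (2 * η - η ^ 2))) := by
  have h1 : edgeEnt k a b d * (d / 2 * (2 * η - η ^ 2)) ≤
      max (edgeEnt k a b d) 0 * (d / 2 * (2 * η - η ^ 2)) := by
    refine mul_le_mul_of_nonneg_right (le_max_left _ _) (mul_nonneg (by positivity) ?_)
    nlinarith
  have hη : 0 < 1 - η := by linarith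
  have h2 : infoGain k a b d / d * (d / 2 * (2 * η - η ^ 2)) =
      infoGain k a b d / 2 * (2 * η - η ^ 2) := by field_simp
  have h0 : edgeEnt k a b d * (d / 2 * (2 * η - η ^ 2)) =
      Real.log k * (d / 2 * (2 * η - η ^ 2)) - infoGain k a b d / 2 * (2 * η - η ^ 2) := by
    rw [edgeEnt_eq hk hd hd0, sub_mul, h2]
  rw [h0] at h1
  rw [div_mul_eq_mul_div, div_lt_iff₀ hη] at hI
  have h3 := mul_lt_mul_of_pos_right hI hη
  have h4 : infoGain k a b d / 2 + (Real.log k * (η - d * η ^ 2 / 2) +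
      (Real.log k * (d / 2 * (2 * η - η ^ 2)) -
        infoGain k a b d / 2 * (2 * η - η ^ 2))) - Real.log k =
      (infoGain k a b d * (1 - η) * (1 - η) - (1 - d * η) * (2 * Real.log k) * (1 - η)) / 2 := by
    ring
  linarith

end Thresholds

end WeakRecovery

open WeakRecovery

/-- Information-theoretic condition for weak recovery in `SSBM(n,k,a/n,b/n)` via the
typicality sampling bound, with `d = (a+(k−1)b)/k` and `τ` the fixed point of
`τ e^{−τ} = d e^{−d}` in `(0,1)`. (By convention `b ln b = 0` when `b = 0`,
which holds automatically since `Real.log 0 = 0`.) -/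
theorem weak_recovery_typicality_bound (k : ℕ) (hk : 2 ≤ k) (a b : ℝ)
    (ha : 0 ≤ a) (hb : 0 ≤ b)
    (d : ℝ) (hd : d = (a + ((k : ℝ) - 1) * b) / k) (hd1 : 1 < d)
    (τ : ℝ) (hτ0 : 0 < τ) (hτ1 : τ < 1)
    (hτ : τ * Real.exp (-τ) = d * Real.exp (-d))
    (hbound :
      (a * Real.log a + ((k : ℝ) - 1) * (b * Real.log b)) / k - d * Real.log d >
        min
          ((1 - τ) / (1 - τ * k / (a + ((k : ℝ) - 1) * b)) * (2 * Real.log k))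
          (2 * Real.log k -
            2 * Real.log 2 * Real.exp (-a / k) *
              (1 - (1 - Real.exp (-b / k)) ^ (k - 1)))) :
    ∃ ε > (0 : ℝ), ∃ est : (n : ℕ) → (VPair n → Bool) → (Fin n → Fin k),
      Tendsto
        (fun n : ℕ =>
          sbmProb (fun _ : Fin k => 1 / (k : ℝ)) (ssbmW k (a / n) (b / n))
            fun x g => 1 / (k : ℝ) + ε ≤ agreement x (est n g))
        atTop (nhds 1) := by
  have hk0 : 0 < k := by omega
  have hk' : (0 : ℝ) < k := by exact_mod_cast hk0
  have hd0 : 0 < d := by linarith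
  have hkd : a + ((k : ℝ) - 1) * b = k * d := by rw [hd]; field_simp
  rcases min_lt_iff.1 hbound with hI | hI
  · set η := τ / d with hη
    have hτη : d * η = τ := by rw [hη]; field_simp
    have hη0 : 0 < η := by positivity
    have hη1 : η < 1 := by rw [hη, div_lt_one hd0]; linarith
    have hfix : η * Real.exp (d * (1 - η)) = 1 := by
      rw [mul_sub, hτη, mul_one, sub_eq_add_neg, Real.exp_add, hη, div_mul_eq_mul_div,
        div_eq_one_iff_eq hd0.ne', mul_left_comm, hτ, mul_left_comm, ← Real.exp_add, add_neg_cancel,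
        Real.exp_zero, mul_one]
    have hden : τ * k / (a + ((k : ℝ) - 1) * b) = η := by
      rw [hkd, hη]; field_simp
    rw [hden, ← hτη] at hI
    have hlog := log_lt_of_pend hk0 hd hd0 hη0 hη1 hI
    have hlogk : 0 < Real.log k := Real.log_pos (by exact_mod_cast hk)
    have hpos : 0 < Real.log k * (η - d * η ^ 2 / 2) +
        max (edgeEnt k a b d) 0 * (d / 2 * (2 * η - η ^ 2)) := by
      have h1 : 0 < η * (1 - d * η / 2) := mul_pos hη0 (by linarith)
      have h2 : 0 ≤ η * (2 - η) := mul_nonneg hη0.le (by linarith)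
      refine add_pos_of_pos_of_nonneg (mul_pos hlogk (by linarith))
        (mul_nonneg (le_max_right _ _) (mul_nonneg (by positivity) (by linarith)))
    obtain ⟨h, hl, hr⟩ := exists_between (max_lt hpos (sub_left_lt_of_lt_add hlog))
    rw [max_lt_iff] at hl
    exact recovery_of_entropy hk0 ha hb hd hd1 (by linarith [hl.2])
      (entropy_pend_bound hk ha hb hd hd0 hη0 hη1 (hτη.symm ▸ hτ1) hfix hl.1.le hr)
  · have hlog : Real.log k - infoGain k a b d / 2 < Real.log 2 * (Real.exp (-(a * (1 / k))) *
        (1 - (1 - Real.exp (-(b * (1 / k)))) ^ (k - 1))) := by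
      rw [show -(a * (1 / (k : ℝ))) = -a / k by ring, show -(b * (1 / (k : ℝ))) = -b / k by ring]
      unfold infoGain
      linarith
    obtain ⟨h, hl, hr⟩ := exists_between hlog
    exact recovery_of_entropy hk0 ha hb hd hd1 (by linarith) (entropy_free_bound hk0 ha hb hr)
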